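/- arXiv:1606.00738 — 2 statements merged into one kernel-verified Lean document; each statement's English description precedes it below -/
import Mathlib

section
/- Let K ⊂ ℝ^d be convex, closed, centrally symmetric with γ_d(K) ≥ Ψ(1) = γ₁(−1,1). Then for all t ≥ 1, γ_d(tK) ≥ Ψ(t), where Ψ(t) = γ₁(−t,t). -/
open MeasureTheory ProbabilityTheory Pointwise

/-- The standard Gaussian measure on `ℝ^d`. -/
noncomputable def stdGaussian (d : ℕ) : Measure (Fin d → ℝ) :=
  Measure.pi fun _ => gaussianReal 0 1

namespace GaussianDilation

/-! ### The standard normal density, distribution function and isoperimetric profile -/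

/-- The standard normal density. -/
noncomputable def dens (x : ℝ) : ℝ := (√(2 * Real.pi))⁻¹ * Real.exp (-x ^ 2 / 2)

/-- The standard normal distribution function. -/
noncomputable def ncdf (x : ℝ) : ℝ := (gaussianReal 0 1).real (Set.Iic x)

lemma dens_eq : dens = gaussianPDFReal 0 1 := by
  ext x; simp [dens, gaussianPDFReal]

lemma dens_pos (x : ℝ) : 0 < dens x := by unfold dens; positivity

lemma dens_neg (x : ℝ) : dens (-x) = dens x := by simp [dens]

lemma continuous_dens : Continuous dens := by unfold dens; fun_prop

lemma integrable_dens : Integrable dens := dens_eq ▸ integrable_gaussianPDFReal 0 1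

lemma hasDerivAt_dens (x : ℝ) : HasDerivAt dens (-x * dens x) x := by
  have h : HasDerivAt (fun y : ℝ => -y ^ 2 / 2) (-x) x := by
    have := ((hasDerivAt_pow 2 x).neg).div_const 2
    convert! this using 1
    simp
    ring
  convert! (h.exp.const_mul (√(2 * Real.pi))⁻¹) using 1
  simp only [dens]; ring

lemma measureReal_eq_integral (s : Set ℝ) :
    (gaussianReal 0 1).real s = ∫ x in s, dens x := by
  rw [measureReal_def, gaussianReal_apply_eq_integral _ one_ne_zero, dens_eq,
    ENNReal.toReal_ofReal]
  exact setIntegral_nonneg_of_ae (by filter_upwards with x using gaussianPDFReal_nonneg 0 1 x)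

lemma ncdf_sub (a b : ℝ) : ncdf b - ncdf a = ∫ x in a..b, dens x := by
  rw [ncdf, ncdf, measureReal_eq_integral, measureReal_eq_integral,
    intervalIntegral.integral_Iic_sub_Iic integrable_dens.integrableOn
      integrable_dens.integrableOn]

lemma hasDerivAt_ncdf (x : ℝ) : HasDerivAt ncdf (dens x) x := by
  have h : ncdf = fun y => ncdf 0 + ∫ u in (0 : ℝ)..y, dens u := by
    ext y; rw [← ncdf_sub]; ring
  rw [h]
  exact (intervalIntegral.integral_hasDerivAt_right (continuous_dens.intervalIntegrable _ _)
    (continuous_dens.stronglyMeasurableAtFilter _ _) continuous_dens.continuousAt).const_add _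

lemma continuous_ncdf : Continuous ncdf :=
  continuous_iff_continuousAt.2 fun x => (hasDerivAt_ncdf x).continuousAt

lemma strictMono_ncdf : StrictMono ncdf :=
  strictMono_of_hasDerivAt_pos hasDerivAt_ncdf dens_pos

lemma tendsto_ncdf_atBot : Filter.Tendsto ncdf Filter.atBot (nhds 0) := by
  have h := tendsto_cdf_atBot (gaussianReal 0 1)
  have e : ncdf = fun x => cdf (gaussianReal 0 1) x := by ext x; rw [cdf_eq_real]; rfl
  rw [e]; exact h

lemma tendsto_ncdf_atTop : Filter.Tendsto ncdf Filter.atTop (nhds 1) := by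
  have h := tendsto_cdf_atTop (gaussianReal 0 1)
  have e : ncdf = fun x => cdf (gaussianReal 0 1) x := by ext x; rw [cdf_eq_real]; rfl
  rw [e]; exact h

lemma ncdf_pos (x : ℝ) : 0 < ncdf x :=
  lt_of_le_of_lt measureReal_nonneg (strictMono_ncdf (sub_one_lt x))

lemma ncdf_lt_one (x : ℝ) : ncdf x < 1 :=
  lt_of_lt_of_le (strictMono_ncdf (lt_add_one x)) measureReal_le_one

lemma ncdf_neg (x : ℝ) : ncdf (-x) = 1 - ncdf x := by
  have h : ∀ y, HasDerivAt (fun y => ncdf (-y) + ncdf y) 0 y := fun y => by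
    have h1 := ((hasDerivAt_ncdf (-y)).comp y (hasDerivAt_neg y)).add (hasDerivAt_ncdf y)
    convert! h1 using 1
    rw [dens_neg]; ring
  have hc : ∀ y, ncdf (-y) + ncdf y = ncdf (-0) + ncdf 0 := fun y =>
    is_const_of_deriv_eq_zero (fun y => (h y).differentiableAt) (fun y => (h y).deriv) y 0
  have hl : Filter.Tendsto (fun y => ncdf (-y) + ncdf y) Filter.atTop (nhds (0 + 1)) :=
    (tendsto_ncdf_atBot.comp Filter.tendsto_neg_atTop_atBot).add tendsto_ncdf_atTop
  have hl' : Filter.Tendsto (fun y => ncdf (-y) + ncdf y) Filter.atTop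
      (nhds (ncdf (-0) + ncdf 0)) := tendsto_const_nhds.congr fun y => (hc y).symm
  have := tendsto_nhds_unique hl hl'
  linarith [hc x]

lemma ncdf_zero : ncdf 0 = 1 / 2 := by
  have := ncdf_neg 0
  rw [neg_zero] at this; linarith

lemma exists_ncdf_eq {y : ℝ} (h0 : 0 < y) (h1 : y < 1) : ∃ x, ncdf x = y := by
  obtain ⟨a, ha⟩ := (tendsto_ncdf_atBot.eventually_lt_const h0).exists
  obtain ⟨b, hb⟩ := (tendsto_ncdf_atTop.eventually_const_lt h1).exists
  exact mem_range_of_exists_le_of_exists_ge continuous_ncdf ⟨a, ha.le⟩ ⟨b, hb.le⟩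

/-- The normal quantile function. -/
noncomputable def quant (y : ℝ) : ℝ := Function.invFun ncdf y

lemma quant_ncdf (x : ℝ) : quant (ncdf x) = x :=
  Function.leftInverse_invFun strictMono_ncdf.injective x

lemma ncdf_quant {y : ℝ} (h0 : 0 < y) (h1 : y < 1) : ncdf (quant y) = y :=
  Function.invFun_eq (exists_ncdf_eq h0 h1)

lemma quant_mono {x y : ℝ} (h0 : 0 < x) (hxy : x ≤ y) (h1 : y < 1) : quant x ≤ quant y := by
  rw [← strictMono_ncdf.le_iff_le, ncdf_quant h0 (hxy.trans_lt h1),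
    ncdf_quant (h0.trans_le hxy) h1]
  exact hxy

lemma quant_one_sub {y : ℝ} (h0 : 0 < y) (h1 : y < 1) : quant (1 - y) = -quant y := by
  obtain ⟨x, rfl⟩ := exists_ncdf_eq h0 h1
  rw [← ncdf_neg, quant_ncdf, quant_ncdf]

lemma hasDerivAt_quant {y : ℝ} (h0 : 0 < y) (h1 : y < 1) :
    HasDerivAt quant (dens (quant y))⁻¹ y := by
  refine HasDerivAt.of_local_left_inverse ?_ (hasDerivAt_ncdf _) (dens_pos _).ne' ?_
  · obtain ⟨x, rfl⟩ := exists_ncdf_eq h0 h1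
    rw [Metric.continuousAt_iff]
    intro ε hε
    rw [quant_ncdf]
    have hU : Set.Ioo (ncdf (x - ε)) (ncdf (x + ε)) ∈ nhds (ncdf x) :=
      Ioo_mem_nhds (strictMono_ncdf (by linarith)) (strictMono_ncdf (by linarith))
    obtain ⟨δ, hδ, hs⟩ := Metric.mem_nhds_iff.1 hU
    refine ⟨δ, hδ, fun {u} hu => ?_⟩
    obtain ⟨ha, hb⟩ := hs hu
    have hu0 := (ncdf_pos _).trans ha
    have hu1 := hb.trans (ncdf_lt_one _)
    rw [← ncdf_quant hu0 hu1, strictMono_ncdf.lt_iff_lt] at ha hb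
    rw [Real.dist_eq, abs_lt]
    constructor <;> linarith
  · filter_upwards [Ioo_mem_nhds h0 h1] with u hu using ncdf_quant hu.1 hu.2

/-- The Gaussian isoperimetric profile, extended by zero outside `(0, 1)`. -/
noncomputable def prof (y : ℝ) : ℝ := if 0 < y ∧ y < 1 then dens (quant y) else 0

lemma prof_of_mem {y : ℝ} (h0 : 0 < y) (h1 : y < 1) : prof y = dens (quant y) :=
  if_pos ⟨h0, h1⟩

lemma prof_zero : prof 0 = 0 := if_neg (by simp)

lemma prof_one : prof 1 = 0 := if_neg (by simp)

lemma prof_nonneg (y : ℝ) : 0 ≤ prof y := by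
  unfold prof; split_ifs
  · exact (dens_pos _).le
  · exact le_rfl

lemma prof_ncdf (x : ℝ) : prof (ncdf x) = dens x := by
  rw [prof_of_mem (ncdf_pos x) (ncdf_lt_one x), quant_ncdf]

lemma dens_le (x : ℝ) : dens x ≤ 1 / 2 := by
  have h1 : Real.exp (-x ^ 2 / 2) ≤ 1 := Real.exp_le_one_iff.2 (by nlinarith [sq_nonneg x])
  have h2 : (2 : ℝ) ≤ √(2 * Real.pi) :=
    Real.le_sqrt_of_sq_le (by nlinarith [Real.pi_gt_three])
  have h3 : (√(2 * Real.pi))⁻¹ ≤ 2⁻¹ := inv_anti₀ (by norm_num) h2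
  unfold dens
  calc _ ≤ 2⁻¹ * (1 : ℝ) := mul_le_mul h3 h1 (Real.exp_pos _).le (by norm_num)
    _ = 1 / 2 := by norm_num

lemma prof_le (y : ℝ) : prof y ≤ 1 / 2 := by
  unfold prof; split_ifs
  · exact dens_le _
  · norm_num

lemma prof_one_sub (y : ℝ) : prof (1 - y) = prof y := by
  by_cases h : 0 < y ∧ y < 1
  · rw [prof_of_mem h.1 h.2, prof_of_mem (by linarith [h.2]) (by linarith [h.1]),
      quant_one_sub h.1 h.2, dens_neg]
  · rw [prof, prof, if_neg h, if_neg]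
    rintro ⟨h1, h2⟩
    exact h ⟨by linarith, by linarith⟩

lemma hasDerivAt_prof {y : ℝ} (h0 : 0 < y) (h1 : y < 1) : HasDerivAt prof (-quant y) y := by
  have h : HasDerivAt (fun u => dens (quant u)) (-quant y) y := by
    convert! (hasDerivAt_dens (quant y)).comp y (hasDerivAt_quant h0 h1) using 1
    field_simp [(dens_pos (quant y)).ne']
  refine h.congr_of_eventuallyEq ?_
  filter_upwards [Ioo_mem_nhds h0 h1] with u hu using prof_of_mem hu.1 hu.2

lemma tendsto_dens_atBot : Filter.Tendsto dens Filter.atBot (nhds 0) := by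
  have h1 : Filter.Tendsto (fun x : ℝ => -x ^ 2 / 2) Filter.atBot Filter.atBot := by
    have := (Filter.tendsto_pow_atTop (α := ℝ) two_ne_zero).comp Filter.tendsto_neg_atBot_atTop
    have h2 := (Filter.tendsto_neg_atTop_atBot.comp this).atBot_div_const (r := 2) (by norm_num)
    refine h2.congr fun x => ?_
    simp
  have := (Real.tendsto_exp_atBot.comp h1).const_mul (√(2 * Real.pi))⁻¹
  rw [mul_zero] at this
  exact this

lemma tendsto_prof_zero : Filter.Tendsto prof (nhds 0) (nhds 0) := by
  rw [Metric.tendsto_nhds]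
  intro ε hε
  obtain ⟨a, ha⟩ := Filter.eventually_atBot.1 (tendsto_dens_atBot.eventually_lt_const hε)
  filter_upwards [Iio_mem_nhds (ncdf_pos a)] with y hy
  rw [Real.dist_eq, sub_zero, abs_of_nonneg (prof_nonneg y)]
  unfold prof
  split_ifs with h
  · refine ha _ ?_
    rw [← strictMono_ncdf.le_iff_le, ncdf_quant h.1 h.2]
    exact hy.le
  · exact hε

lemma continuous_prof : Continuous prof := by
  rw [continuous_iff_continuousAt]
  intro y
  rcases lt_trichotomy y 0 with h | rfl | h
  · refine continuousAt_const.congr (f := fun _ => (0 : ℝ)) ?_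
    filter_upwards [Iio_mem_nhds h] with u hu
    exact (if_neg fun h' => absurd h'.1 (not_lt.2 (le_of_lt hu))).symm
  · rw [ContinuousAt, prof_zero]; exact tendsto_prof_zero
  · rcases lt_trichotomy y 1 with h' | rfl | h'
    · exact (hasDerivAt_prof h h').continuousAt
    · rw [ContinuousAt, prof_one]
      have : Filter.Tendsto (fun u : ℝ => 1 - u) (nhds 1) (nhds 0) := by
        have := (continuous_const.sub continuous_id (X := ℝ)).tendsto' (1:ℝ) (0:ℝ)
          (f := fun u : ℝ => 1 - u) (by simp)
        exact this
      refine (tendsto_prof_zero.comp this).congr fun u => prof_one_sub u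
    · refine continuousAt_const.congr (f := fun _ => (0 : ℝ)) ?_
      filter_upwards [Ioi_mem_nhds h'] with u hu
      exact (if_neg fun h' => absurd h'.2 (not_lt.2 (le_of_lt hu))).symm

lemma concaveOn_prof : ConcaveOn ℝ (Set.Icc 0 1) prof := by
  have h : ∀ y ∈ interior (Set.Icc (0 : ℝ) 1), HasDerivAt prof (-quant y) y := by
    intro y hy
    rw [interior_Icc] at hy
    exact hasDerivAt_prof hy.1 hy.2
  refine AntitoneOn.concaveOn_of_deriv (convex_Icc 0 1) continuous_prof.continuousOn
    (fun y hy => (h y hy).differentiableAt.differentiableWithinAt) ?_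
  intro x hx y hy hxy
  rw [(h x hx).deriv, (h y hy).deriv]
  rw [interior_Icc] at hx hy
  exact neg_le_neg (quant_mono hx.1 hxy hy.2)

/-! ### Bobkov's two-point inequality -/

lemma monotone_div_dens : Monotone fun u => u * (dens u)⁻¹ := by
  refine monotone_of_hasDerivAt_nonneg (f' := fun u => (1 + u ^ 2) * (dens u)⁻¹) ?_ ?_
  · intro u
    convert! (hasDerivAt_id u).mul ((hasDerivAt_dens u).inv (dens_pos u).ne') using 1
    have := (dens_pos u).ne'
    simp only [id, Pi.inv_apply]
    field_simp
  · intro u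
    have := dens_pos u
    simp only [Pi.zero_apply]
    positivity

/-- Integrating a derivative inequality on `[0, x]`. -/
lemma le_of_hasDerivAt_nonneg {f f' : ℝ → ℝ} {x : ℝ} (hx : 0 ≤ x)
    (hf : ∀ s ∈ Set.Icc 0 x, HasDerivAt f (f' s) s) (h : ∀ s ∈ Set.Icc 0 x, 0 ≤ f' s) :
    f 0 ≤ f x := by
  have hm : MonotoneOn f (Set.Icc 0 x) := by
    refine monotoneOn_of_deriv_nonneg (convex_Icc 0 x)
      (fun s hs => (hf s hs).continuousAt.continuousWithinAt)
      (fun s hs => (hf s (interior_subset hs)).differentiableAt.differentiableWithinAt) ?_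
    intro s hs
    rw [(hf s (interior_subset hs)).deriv]
    exact h s (interior_subset hs)
  exact hm (Set.left_mem_Icc.2 hx) (Set.right_mem_Icc.2 hx) hx

section TwoPoint

variable {c : ℝ}

lemma quant_sq_add_quant_sq {s : ℝ} (hs : 0 ≤ s) (h0 : 0 < c - s) (h1 : c + s < 1) :
    2 * quant c ^ 2 ≤ quant (c + s) ^ 2 + quant (c - s) ^ 2 := by
  have key := le_of_hasDerivAt_nonneg (f := fun u => quant (c + u) ^ 2 + quant (c - u) ^ 2)
    (f' := fun u => 2 * (quant (c + u) * (dens (quant (c + u)))⁻¹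
      - quant (c - u) * (dens (quant (c - u)))⁻¹)) hs ?_ ?_
  · simp only [add_zero, sub_zero] at key; linarith
  · intro u hu
    have ha := ((hasDerivAt_quant (y := c + u) (by linarith [hu.1]) (by linarith [hu.2])).comp u
      ((hasDerivAt_id u).const_add c)).pow 2
    have hb := ((hasDerivAt_quant (y := c - u) (by linarith [hu.2]) (by linarith [hu.1])).comp u
      ((hasDerivAt_id u).const_sub c)).pow 2
    convert! ha.add hb using 1
    simp; ring
  · intro u hu
    have := monotone_div_dens (quant_mono (x := c - u) (y := c + u) (by linarith [hu.2])
      (by linarith [hu.1]) (by linarith [hu.2]))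
    simp only at this
    linarith

lemma hasDerivAt_prof_sq {y : ℝ} (h0 : 0 < y) (h1 : y < 1) :
    HasDerivAt (fun y => prof y ^ 2) (-2 * (quant y * prof y)) y := by
  convert! (hasDerivAt_prof h0 h1).pow 2 using 1
  simp; ring

lemma hasDerivAt_quant_mul_prof {y : ℝ} (h0 : 0 < y) (h1 : y < 1) :
    HasDerivAt (fun y => quant y * prof y) (1 - quant y ^ 2) y := by
  convert! (hasDerivAt_quant h0 h1).mul (hasDerivAt_prof h0 h1) using 1
  rw [prof_of_mem h0 h1]
  have := (dens_pos (quant y)).ne'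
  field_simp
  ring

lemma prof_sq_second_difference {x : ℝ} (hx : 0 ≤ x) (h0 : 0 < c - x) (h1 : c + x < 1) :
    2 * quant c ^ 2 * x ^ 2 ≤
      prof (c + x) ^ 2 + prof (c - x) ^ 2 - 2 * prof c ^ 2 + 2 * x ^ 2 := by
  have hd : ∀ s ∈ Set.Icc 0 x, 0 ≤ -2 * (quant (c + s) * prof (c + s))
      + 2 * (quant (c - s) * prof (c - s)) + 4 * s - 4 * quant c ^ 2 * s := by
    intro s hs
    have key := le_of_hasDerivAt_nonneg (f := fun s => -2 * (quant (c + s) * prof (c + s))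
      + 2 * (quant (c - s) * prof (c - s)) + 4 * s - 4 * quant c ^ 2 * s)
      (f' := fun u => 2 * (quant (c + u) ^ 2 + quant (c - u) ^ 2) - 4 * quant c ^ 2) hs.1 ?_ ?_
    · simp only [add_zero, sub_zero, mul_zero] at key; linarith
    · intro u hu
      have ha := ((hasDerivAt_quant_mul_prof (y := c + u) (by linarith [hu.1])
        (by linarith [hu.2, hs.2])).comp u ((hasDerivAt_id u).const_add c)).const_mul (-2)
      have hb := ((hasDerivAt_quant_mul_prof (y := c - u) (by linarith [hu.2, hs.2])
        (by linarith [hu.1])).comp u ((hasDerivAt_id u).const_sub c)).const_mul 2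
      have hc := ((hasDerivAt_id u).const_mul 4).sub
        ((hasDerivAt_id u).const_mul (4 * quant c ^ 2))
      convert! (ha.add hb).add hc using 1
      · ext v; simp; ring
      · ring
    · intro u hu
      have := quant_sq_add_quant_sq (c := c) hu.1 (by linarith [hu.2, hs.2])
        (by linarith [hu.2, hs.2])
      linarith
  have key := le_of_hasDerivAt_nonneg (f := fun s => prof (c + s) ^ 2 + prof (c - s) ^ 2
      + 2 * s ^ 2 - 2 * quant c ^ 2 * s ^ 2) (f' := fun s => -2 * (quant (c + s) * prof (c + s))
      + 2 * (quant (c - s) * prof (c - s)) + 4 * s - 4 * quant c ^ 2 * s) hx ?_ hd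
  · simp only [add_zero, sub_zero] at key; nlinarith
  · intro u hu
    have ha := (hasDerivAt_prof_sq (y := c + u) (by linarith [hu.1]) (by linarith [hu.2])).comp u
      ((hasDerivAt_id u).const_add c)
    have hb := (hasDerivAt_prof_sq (y := c - u) (by linarith [hu.2]) (by linarith [hu.1])).comp u
      ((hasDerivAt_id u).const_sub c)
    have hc := ((hasDerivAt_pow 2 u).const_mul 2).sub
        ((hasDerivAt_pow 2 u).const_mul (2 * quant c ^ 2))
    convert! (ha.add hb).add hc using 1
    · ext v; simp; ring
    · simp; ring

lemma quant_sq_le {s : ℝ} (hc : c ≤ 1 / 2) (hs : 0 ≤ s) (h0 : 0 < c - s) :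
    quant (c + s) ^ 2 ≤ quant (c - s) ^ 2 := by
  have h1 := quant_mono (x := c - s) (y := c + s) h0 (by linarith) (by linarith)
  have h2 := quant_mono (x := c - s) (y := 1 - (c + s)) h0 (by linarith) (by linarith)
  rw [quant_one_sub (by linarith) (by linarith)] at h2
  nlinarith

lemma prof_sq_first_difference {x : ℝ} (hc : c ≤ 1 / 2) (hx : 0 ≤ x) (h0 : 0 < c - x) :
    prof (c + x) ^ 2 - prof (c - x) ^ 2 ≤ -4 * (quant c * prof c) * x := by
  have hd : ∀ s ∈ Set.Icc 0 x, 0 ≤ -4 * (quant c * prof c) + 2 * (quant (c + s) * prof (c + s))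
      + 2 * (quant (c - s) * prof (c - s)) := by
    intro s hs
    have key := le_of_hasDerivAt_nonneg (f := fun s => -4 * (quant c * prof c) +
      2 * (quant (c + s) * prof (c + s)) + 2 * (quant (c - s) * prof (c - s)))
      (f' := fun u => 2 * (quant (c - u) ^ 2 - quant (c + u) ^ 2)) hs.1 ?_ ?_
    · simp only [add_zero, sub_zero] at key; linarith
    · intro u hu
      have ha := ((hasDerivAt_quant_mul_prof (y := c + u) (by linarith [hu.1])
        (by linarith [hu.2, hs.2])).comp u ((hasDerivAt_id u).const_add c)).const_mul 2
      have hb := ((hasDerivAt_quant_mul_prof (y := c - u) (by linarith [hu.2, hs.2])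
        (by linarith [hu.1])).comp u ((hasDerivAt_id u).const_sub c)).const_mul 2
      convert! (ha.const_add (-4 * (quant c * prof c))).add hb using 1
      ring
    · intro u hu
      have := quant_sq_le (c := c) hc hu.1 (by linarith [hu.2, hs.2])
      linarith
  have key := le_of_hasDerivAt_nonneg (f := fun s => -4 * (quant c * prof c) * s
      - prof (c + s) ^ 2 + prof (c - s) ^ 2) (f' := fun s => -4 * (quant c * prof c) +
      2 * (quant (c + s) * prof (c + s)) + 2 * (quant (c - s) * prof (c - s))) hx ?_ hd
  · simp only [add_zero, sub_zero] at key; nlinarith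
  · intro u hu
    have ha := (hasDerivAt_prof_sq (y := c + u) (by linarith [hu.1]) (by linarith [hu.2])).comp u
      ((hasDerivAt_id u).const_add c)
    have hb := (hasDerivAt_prof_sq (y := c - u) (by linarith [hu.2]) (by linarith [hu.1])).comp u
      ((hasDerivAt_id u).const_sub c)
    have hc := (hasDerivAt_id u).const_mul (-4 * (quant c * prof c))
    convert! (hc.sub ha).add hb using 1
    ring

lemma prof_le_prof {s : ℝ} (hc : c ≤ 1 / 2) (hs : 0 ≤ s) (h0 : 0 < c - s) :
    prof (c - s) ≤ prof (c + s) := by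
  rw [prof_of_mem h0 (by linarith), prof_of_mem (by linarith) (by linarith), dens, dens]
  have := quant_sq_le hc hs h0
  gcongr

lemma two_point_of_le_half {x : ℝ} (hc : c ≤ 1 / 2) (hx : 0 ≤ x) (h0 : 0 < c - x) :
    2 * prof c ≤ √(prof (c + x) ^ 2 + x ^ 2) + √(prof (c - x) ^ 2 + x ^ 2) := by
  have hS := prof_sq_second_difference (c := c) hx h0 (by linarith)
  have hT := prof_sq_first_difference hc hx h0
  have hM := prof_le_prof hc hx h0
  have hI := prof_nonneg c
  set P := √(prof (c + x) ^ 2 + x ^ 2) with hP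
  set M := √(prof (c - x) ^ 2 + x ^ 2) with hM'
  have hP2 : P ^ 2 = prof (c + x) ^ 2 + x ^ 2 := Real.sq_sqrt (by positivity)
  have hM2 : M ^ 2 = prof (c - x) ^ 2 + x ^ 2 := Real.sq_sqrt (by positivity)
  have hP0 : 0 ≤ P := Real.sqrt_nonneg _
  have hM0 : 0 ≤ M := Real.sqrt_nonneg _
  have hd0 : 0 ≤ P ^ 2 - M ^ 2 := by
    have := prof_nonneg (c - x); nlinarith
  have hd1 : P ^ 2 - M ^ 2 ≤ -4 * (quant c * prof c) * x := by linarith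
  have hs : 2 * quant c ^ 2 * x ^ 2 ≤ P ^ 2 + M ^ 2 - 2 * prof c ^ 2 := by linarith
  have hsq : (P ^ 2 - M ^ 2) ^ 2 ≤ 8 * prof c ^ 2 * (P ^ 2 + M ^ 2 - 2 * prof c ^ 2) := by
    calc (P ^ 2 - M ^ 2) ^ 2 ≤ (-4 * (quant c * prof c) * x) ^ 2 := by gcongr
      _ = 8 * prof c ^ 2 * (2 * quant c ^ 2 * x ^ 2) := by ring
      _ ≤ _ := by gcongr
  by_contra! hlt
  have h1 : 0 < 4 * prof c ^ 2 - (P + M) ^ 2 := by nlinarith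
  have h2 : 0 < 4 * prof c ^ 2 - (P - M) ^ 2 := by nlinarith
  nlinarith [mul_pos h1 h2]

lemma two_point_of_mem_Ioo {a b : ℝ} (ha : a ∈ Set.Ioo (0 : ℝ) 1) (hb : b ∈ Set.Ioo (0 : ℝ) 1) :
    2 * prof ((a + b) / 2) ≤ √(prof a ^ 2 + ((a - b) / 2) ^ 2)
      + √(prof b ^ 2 + ((a - b) / 2) ^ 2) := by
  wlog hab : b ≤ a generalizing a b
  · have := this hb ha (le_of_not_ge hab)
    rw [add_comm a b, add_comm (√_), show ((a - b) / 2) ^ 2 = ((b - a) / 2) ^ 2 by ring]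
    exact this
  rcases le_total ((a + b) / 2) (1 / 2) with hc | hc
  · have := two_point_of_le_half (c := (a + b) / 2) (x := (a - b) / 2) hc (by linarith)
      (by linarith [hb.1])
    rwa [show (a + b) / 2 + (a - b) / 2 = a by ring,
      show (a + b) / 2 - (a - b) / 2 = b by ring] at this
  · have := two_point_of_le_half (c := 1 - (a + b) / 2) (x := (a - b) / 2) (by linarith)
      (by linarith) (by linarith [ha.2])
    rw [show 1 - (a + b) / 2 + (a - b) / 2 = 1 - b by ring,
      show 1 - (a + b) / 2 - (a - b) / 2 = 1 - a by ring, prof_one_sub, prof_one_sub,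
      prof_one_sub] at this
    linarith

/-- **Bobkov's two-point inequality.** -/
lemma two_point {a b : ℝ} (ha : a ∈ Set.Icc (0 : ℝ) 1) (hb : b ∈ Set.Icc (0 : ℝ) 1) :
    2 * prof ((a + b) / 2) ≤ √(prof a ^ 2 + ((a - b) / 2) ^ 2)
      + √(prof b ^ 2 + ((a - b) / 2) ^ 2) := by
  have hcl : (a, b) ∈ closure (Set.Ioo (0 : ℝ) 1 ×ˢ Set.Ioo (0 : ℝ) 1) := by
    rw [closure_prod_eq, closure_Ioo zero_ne_one]; exact ⟨ha, hb⟩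
  have hp := continuous_prof
  refine le_on_closure (s := Set.Ioo (0 : ℝ) 1 ×ˢ Set.Ioo (0 : ℝ) 1)
    (f := fun p : ℝ × ℝ => 2 * prof ((p.1 + p.2) / 2))
    (g := fun p : ℝ × ℝ => √(prof p.1 ^ 2 + ((p.1 - p.2) / 2) ^ 2)
      + √(prof p.2 ^ 2 + ((p.1 - p.2) / 2) ^ 2))
    (fun p hp => two_point_of_mem_Ioo hp.1 hp.2) ?_ ?_ hcl
  · exact Continuous.continuousOn (by fun_prop)
  · exact Continuous.continuousOn (by fun_prop)

end TwoPoint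

/-! ### Bobkov's inequality on the discrete cube -/

/-- The fair coin. -/
noncomputable def coin : Measure Bool :=
  (2⁻¹ : ENNReal) • Measure.dirac true + (2⁻¹ : ENNReal) • Measure.dirac false

instance : IsProbabilityMeasure coin := ⟨by simp [coin, ENNReal.inv_two_add_inv_two]⟩

lemma integral_coin {E : Type*} [NormedAddCommGroup E] [NormedSpace ℝ E] [CompleteSpace E]
    (f : Bool → E) :
    ∫ b, f b ∂coin = (2⁻¹ : ℝ) • (f true + f false) := by
  rw [coin, integral_add_measure (Integrable.of_finite.smul_measure (by simp))
    (Integrable.of_finite.smul_measure (by simp)), integral_smul_measure,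
    integral_smul_measure, integral_dirac, integral_dirac]
  simp [smul_add]

/-- The uniform measure on the discrete cube `{0, 1}^n`. -/
noncomputable abbrev cube (n : ℕ) : Measure (Fin n → Bool) := Measure.pi fun _ => coin

lemma integral_cube_succ {n : ℕ} (f : (Fin (n + 1) → Bool) → ℝ) :
    ∫ x, f x ∂cube (n + 1) = 2⁻¹ * (∫ y, f (Fin.cons true y) ∂cube n
      + ∫ y, f (Fin.cons false y) ∂cube n) := by
  have h := (measurePreserving_piFinSuccAbove (fun _ : Fin (n + 1) => coin) 0).symm
  rw [← h.integral_comp' (g := f), integral_prod _ .of_finite, integral_coin]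
  simp [MeasurableEquiv.piFinSuccAbove, Fin.insertNthEquiv]

/-- The discrete derivative on the cube. -/
noncomputable def discreteDeriv {n : ℕ} (f : (Fin n → Bool) → ℝ) (i : Fin n) (x : Fin n → Bool) : ℝ :=
  (f (Function.update x i true) - f (Function.update x i false)) / 2

lemma discreteDeriv_zero_cons {n : ℕ} (f : (Fin (n + 1) → Bool) → ℝ) (b : Bool) (y : Fin n → Bool) :
    discreteDeriv f 0 (Fin.cons b y) = (f (Fin.cons true y) - f (Fin.cons false y)) / 2 := by
  simp [discreteDeriv, Fin.update_cons_zero]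

lemma discreteDeriv_succ_cons {n : ℕ} (f : (Fin (n + 1) → Bool) → ℝ) (i : Fin n) (b : Bool)
    (y : Fin n → Bool) :
    discreteDeriv f i.succ (Fin.cons b y) = discreteDeriv (fun y => f (Fin.cons b y)) i y := by
  simp [discreteDeriv, Fin.cons_update]

lemma sqrt_integral_sq_add_sq_le {Ω : Type*} [MeasurableSpace Ω] {μ : Measure Ω} {h k : Ω → ℝ}
    (hh : Integrable h μ) (hk : Integrable k μ) :
    √((∫ x, h x ∂μ) ^ 2 + (∫ x, k x ∂μ) ^ 2) ≤ ∫ x, √(h x ^ 2 + k x ^ 2) ∂μ := by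
  have e : ∫ x, ((h x : ℂ) + (k x : ℂ) * Complex.I) ∂μ
      = ((∫ x, h x ∂μ : ℝ) : ℂ) + ((∫ x, k x ∂μ : ℝ) : ℂ) * Complex.I := by
    rw [integral_add hh.ofReal (hk.ofReal.mul_const _), integral_mul_const, integral_complex_ofReal,
      integral_complex_ofReal]
  have := norm_integral_le_integral_norm (μ := μ) fun x => (h x : ℂ) + (k x : ℂ) * Complex.I
  rw [e, Complex.norm_add_mul_I] at this
  simpa only [Complex.norm_add_mul_I] using this

/-- **Bobkov's inequality on the discrete cube.** -/
theorem bobkov_cube {n : ℕ} (f : (Fin n → Bool) → ℝ) (hf : ∀ x, f x ∈ Set.Icc (0 : ℝ) 1) :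
    prof (∫ x, f x ∂cube n) ≤ ∫ x, √(prof (f x) ^ 2 + ∑ i, discreteDeriv f i x ^ 2) ∂cube n := by
  induction n with
  | zero =>
    rw [integral_unique, integral_unique]
    simp [Real.sqrt_sq (prof_nonneg _)]
  | succ n ih =>
    have hm : ∀ b, ∫ y, f (Fin.cons b y) ∂cube n ∈ Set.Icc (0 : ℝ) 1 := fun b =>
      ⟨integral_nonneg fun y => (hf _).1, by
        simpa using integral_mono (μ := cube n) (g := fun _ => (1 : ℝ)) .of_finite .of_finite
          fun y => (hf (Fin.cons b y)).2⟩
    have hb : ∀ b, √(prof (∫ y, f (Fin.cons b y) ∂cube n) ^ 2 +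
        ((∫ y, f (Fin.cons true y) ∂cube n - ∫ y, f (Fin.cons false y) ∂cube n) / 2) ^ 2)
        ≤ ∫ y, √(prof (f (Fin.cons b y)) ^ 2 + ∑ i, discreteDeriv f i (Fin.cons b y) ^ 2) ∂cube n := by
      intro b
      have e : (∫ y, f (Fin.cons true y) ∂cube n - ∫ y, f (Fin.cons false y) ∂cube n) / 2
          = ∫ y, discreteDeriv f 0 (Fin.cons b y) ∂cube n := by
        simp_rw [discreteDeriv_zero_cons]
        rw [integral_div, integral_sub .of_finite .of_finite]
      rw [e]
      refine (Real.sqrt_le_sqrt (add_le_add_left (pow_le_pow_left₀ (prof_nonneg _)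
        (ih (fun y => f (Fin.cons b y)) fun y => hf _) 2) _)).trans ?_
      refine (sqrt_integral_sq_add_sq_le .of_finite .of_finite).trans (le_of_eq ?_)
      refine integral_congr_ae (.of_forall fun y => ?_)
      simp only [Fin.sum_univ_succ, discreteDeriv_succ_cons]
      rw [Real.sq_sqrt (by positivity)]
      congr 1; ring
    rw [integral_cube_succ, integral_cube_succ]
    have := two_point (hm true) (hm false)
    have e : 2⁻¹ * (∫ y, f (Fin.cons true y) ∂cube n + ∫ y, f (Fin.cons false y) ∂cube n)
      = (∫ y, f (Fin.cons true y) ∂cube n + ∫ y, f (Fin.cons false y) ∂cube n) / 2 := by ring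
    rw [e]
    linarith [hb true, hb false]

/-! ### Bobkov's inequality in Gauss space, via the central limit theorem -/

/-- The sign of a coin toss. -/
noncomputable def coinSign (b : Bool) : ℝ := if b then 1 else -1

/-- The axis along which the `j`-th coin toss moves the random walk. -/
def axis {d m : ℕ} (j : Fin (d * m)) : Fin d := (finProdFinEquiv.symm j).1

/-- The rescaled random walk: `m` independent steps along each of the `d` axes. -/
noncomputable def walk (d m : ℕ) (x : Fin (d * m) → Bool) : EuclideanSpace ℝ (Fin d) :=
  ∑ j, ((√m)⁻¹ * coinSign (x j)) • EuclideanSpace.single (axis j) (1 : ℝ)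

lemma prod_axis {M : Type*} [CommMonoid M] {d m : ℕ} (f : Fin d → M) :
    ∏ j : Fin (d * m), f (axis j) = ∏ i, f i ^ m := by
  rw [← Equiv.prod_comp finProdFinEquiv, Fintype.prod_prod_type]
  simp [axis]

lemma sum_axis {d m : ℕ} (f : Fin d → ℝ) :
    ∑ j : Fin (d * m), f (axis j) = m * ∑ i, f i := by
  rw [← Equiv.sum_comp finProdFinEquiv, Fintype.sum_prod_type]
  simp [axis, Finset.mul_sum]

lemma charFun_walk (d m : ℕ) (t : EuclideanSpace ℝ (Fin d)) :
    charFun ((cube (d * m)).map (walk d m)) t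
      = ∏ i, charFun (coin.map coinSign) ((√m)⁻¹ * t i) ^ m := by
  rw [charFun_apply, integral_map (measurable_of_finite _).aemeasurable
    (Measurable.aestronglyMeasurable (by fun_prop)), ← prod_axis
      (fun i => charFun (coin.map coinSign) ((√m)⁻¹ * t i))]
  have h : ∀ j : Fin (d * m), charFun (coin.map coinSign) ((√m)⁻¹ * t (axis j))
      = ∫ b, Complex.exp (((√m)⁻¹ * t (axis j) : ℝ) * coinSign b * Complex.I) ∂coin := by
    intro j
    rw [charFun_apply_real, integral_map (measurable_of_finite _).aemeasurable
      (Measurable.aestronglyMeasurable (by fun_prop))]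
  simp_rw [h]
  rw [← integral_fintype_prod_eq_prod (f := fun (j : Fin (d * m)) b =>
    Complex.exp (((√m)⁻¹ * t (axis j) : ℝ) * coinSign b * Complex.I))]
  congr 1 with x
  rw [← Complex.exp_sum, ← Finset.sum_mul, walk, sum_inner]
  congr 2
  push_cast
  refine Finset.sum_congr rfl fun j _ => ?_
  rw [inner_smul_left, EuclideanSpace.inner_single_left]
  simp
  ring

/-- The law of the rescaled random walk. -/
noncomputable def walkLaw (d m : ℕ) : ProbabilityMeasure (EuclideanSpace ℝ (Fin d)) :=
  ⟨(cube (d * m)).map (walk d m),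
    Measure.isProbabilityMeasure_map (measurable_of_finite _).aemeasurable⟩

/-- The standard Gaussian measure as a bundled probability measure. -/
noncomputable def gaussLaw (d : ℕ) : ProbabilityMeasure (EuclideanSpace ℝ (Fin d)) :=
  ⟨ProbabilityTheory.stdGaussian (EuclideanSpace ℝ (Fin d)), inferInstance⟩

lemma tendsto_walkLaw (d : ℕ) :
    Filter.Tendsto (walkLaw d) Filter.atTop (nhds (gaussLaw d)) := by
  refine ProbabilityMeasure.tendsto_of_tendsto_charFun fun t => ?_
  have e : charFun (gaussLaw d : Measure (EuclideanSpace ℝ (Fin d))) t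
      = ∏ i, Complex.exp (-(t i) ^ 2 / 2) := by
    change charFun (ProbabilityTheory.stdGaussian _) t = _
    rw [charFun_stdGaussian, ← Complex.exp_sum, ← Complex.ofReal_pow,
      EuclideanSpace.real_norm_sq_eq]
    simp [Finset.sum_div, neg_div]
  rw [e]
  refine Filter.Tendsto.congr (fun m => (charFun_walk d m t).symm) ?_
  refine tendsto_finsetProd _ fun i _ => ?_
  refine tendsto_charFun_inv_sqrt_mul_pow (measurable_of_finite _).aemeasurable ?_ ?_ (t i)
  · rw [integral_coin]; simp [coinSign]
  · rw [integral_coin]; simp [coinSign]; norm_num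

lemma tendsto_integral_walk {d : ℕ} {f : EuclideanSpace ℝ (Fin d) → ℝ} (hf : Continuous f)
    {C : ℝ} (hC : ∀ x, |f x| ≤ C) :
    Filter.Tendsto (fun m => ∫ x, f (walk d m x) ∂cube (d * m)) Filter.atTop
      (nhds (∫ x, f x ∂ProbabilityTheory.stdGaussian (EuclideanSpace ℝ (Fin d)))) := by
  have h := ProbabilityMeasure.tendsto_iff_forall_integral_tendsto.1 (tendsto_walkLaw d)
    (BoundedContinuousFunction.ofNormedAddCommGroup f hf C hC)
  refine h.congr fun m => ?_
  exact integral_map (measurable_of_finite _).aemeasurable hf.aestronglyMeasurable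

lemma walk_update {d m : ℕ} (x : Fin (d * m) → Bool) (j : Fin (d * m)) (b : Bool) :
    walk d m (Function.update x j b) = walk d m x
      + ((√m)⁻¹ * (coinSign b - coinSign (x j))) • EuclideanSpace.single (axis j) (1 : ℝ) := by
  rw [walk, walk, ← Finset.add_sum_erase _ _ (Finset.mem_univ j),
    ← Finset.add_sum_erase _ _ (Finset.mem_univ j), Function.update_self]
  rw [Finset.sum_congr rfl (g := fun i => ((√m)⁻¹ * coinSign (x i)) •
    EuclideanSpace.single (axis i) (1 : ℝ))]
  · module
  · intro i hi
    rw [Function.update_of_ne (Finset.ne_of_mem_erase hi)]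

lemma sqrt_sq_add_sum_sq_le {ι : Type*} [Fintype ι] (A : ℝ) (D p : ι → ℝ) :
    √(A ^ 2 + ∑ i, D i ^ 2) ≤ √(A ^ 2 + ∑ i, p i ^ 2) + √(∑ i, (D i - p i) ^ 2) := by
  have hcs := Real.sum_mul_le_sqrt_mul_sqrt Finset.univ p fun i => D i - p i
  have hle : √(∑ i, p i ^ 2) ≤ √(A ^ 2 + ∑ i, p i ^ 2) :=
    Real.sqrt_le_sqrt (by nlinarith [sq_nonneg A])
  have h1 : √(A ^ 2 + ∑ i, p i ^ 2) ^ 2 = A ^ 2 + ∑ i, p i ^ 2 := Real.sq_sqrt (by positivity)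
  have h2 : √(∑ i, (D i - p i) ^ 2) ^ 2 = ∑ i, (D i - p i) ^ 2 := Real.sq_sqrt (by positivity)
  have h3 : ∑ i, D i ^ 2 = ∑ i, p i ^ 2 + 2 * ∑ i, p i * (D i - p i) + ∑ i, (D i - p i) ^ 2 := by
    rw [Finset.mul_sum, ← Finset.sum_add_distrib, ← Finset.sum_add_distrib]
    exact Finset.sum_congr rfl fun i _ => by ring
  refine Real.sqrt_le_iff.2 ⟨by positivity, ?_⟩
  have := mul_le_mul_of_nonneg_right hle (Real.sqrt_nonneg (∑ i, (D i - p i) ^ 2))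
  nlinarith

lemma abs_sub_sub_fderiv_le {E : Type*} [NormedAddCommGroup E] [NormedSpace ℝ E] {g : E → ℝ}
    (hg : Differentiable ℝ g) {x v : E} {a b r ε : ℝ} (hv : ‖v‖ ≤ 1)
    (ha : |a| ≤ r) (hb : |b| ≤ r)
    (hε : ∀ y, ‖y - x‖ ≤ r → ‖fderiv ℝ g y - fderiv ℝ g x‖ ≤ ε) :
    |g (x + a • v) - g (x + b • v) - (a - b) * fderiv ℝ g x v| ≤ ε * |a - b| := by
  have hmem : ∀ c : ℝ, |c| ≤ r → x + c • v ∈ Metric.closedBall x r := by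
    intro c hc
    rw [mem_closedBall_iff_norm, add_sub_cancel_left, norm_smul, Real.norm_eq_abs]
    nlinarith [norm_nonneg v, abs_nonneg c]
  have h := (convex_closedBall x r).norm_image_sub_le_of_norm_hasFDerivWithin_le'
    (f := g) (f' := fun y => fderiv ℝ g y) (φ := fderiv ℝ g x) (C := ε)
    (fun y _ => (hg y).hasFDerivAt.hasFDerivWithinAt)
    (fun y hy => hε y (mem_closedBall_iff_norm.1 hy)) (hmem b hb) (hmem a ha)
  have e : x + a • v - (x + b • v) = (a - b) • v := by module
  have hε0 : 0 ≤ ε := (norm_nonneg _).trans (hε x (by simpa using (abs_nonneg a).trans ha))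
  rw [e, map_smul, smul_eq_mul, norm_smul, Real.norm_eq_abs, Real.norm_eq_abs] at h
  refine h.trans (mul_le_mul_of_nonneg_left ?_ hε0)
  exact mul_le_of_le_one_right (abs_nonneg _) hv

/-- **Bobkov's functional isoperimetric inequality** for compactly supported `C¹` functions. -/
theorem bobkov_gauss {d : ℕ} {g : EuclideanSpace ℝ (Fin d) → ℝ} (hg : ContDiff ℝ 1 g)
    (hs : HasCompactSupport g) (h01 : ∀ x, g x ∈ Set.Icc (0 : ℝ) 1) :
    prof (∫ x, g x ∂ProbabilityTheory.stdGaussian (EuclideanSpace ℝ (Fin d))) ≤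
      ∫ x, √(prof (g x) ^ 2 + ‖fderiv ℝ g x‖ ^ 2)
        ∂ProbabilityTheory.stdGaussian (EuclideanSpace ℝ (Fin d)) := by
  have hgd : Differentiable ℝ g := hg.differentiable one_ne_zero
  have hgc : Continuous (fderiv ℝ g) := hg.continuous_fderiv one_ne_zero
  have huc : UniformContinuous (fderiv ℝ g) :=
    (hs.fderiv ℝ).uniformContinuous_of_continuous hgc
  obtain ⟨C, hC⟩ := (hs.fderiv ℝ).exists_bound_of_continuous hgc
  have hbound : ∀ x, |√(prof (g x) ^ 2 + ‖fderiv ℝ g x‖ ^ 2)| ≤ 1 + C := by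
    intro x
    rw [abs_of_nonneg (Real.sqrt_nonneg _)]
    have h1 := prof_nonneg (g x)
    have h2 := prof_le (g x)
    have h3 := norm_nonneg (fderiv ℝ g x)
    have h4 := hC x
    exact Real.sqrt_le_iff.2 ⟨by linarith, by nlinarith⟩
  have hp := continuous_prof
  have hgcont := hg.continuous
  have hcont : Continuous fun x => √(prof (g x) ^ 2 + ‖fderiv ℝ g x‖ ^ 2) := by fun_prop
  have hl := (hp.tendsto _).comp (tendsto_integral_walk hgcont (C := 1) fun x =>
    abs_le.2 ⟨by linarith [(h01 x).1], (h01 x).2⟩)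
  have hr := tendsto_integral_walk hcont hbound
  refine le_of_forall_pos_le_add fun η hη => ?_
  obtain ⟨ε, hε, hεη⟩ : ∃ ε > 0, √d * ε ≤ η := by
    refine ⟨η / (√d + 1), by positivity, ?_⟩
    rw [mul_div_assoc', div_le_iff₀ (by positivity)]
    nlinarith [Real.sqrt_nonneg d]
  obtain ⟨r, hr0, hrε⟩ := Metric.uniformContinuous_iff.1 huc ε hε
  have hsmall : ∀ᶠ m : ℕ in Filter.atTop, (√m)⁻¹ * 2 < r := by
    have : Filter.Tendsto (fun m : ℕ => (√m)⁻¹ * 2) Filter.atTop (nhds (0 * 2)) :=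
      (tendsto_inv_atTop_zero.comp <| Real.tendsto_sqrt_atTop.comp
        tendsto_natCast_atTop_atTop).mul_const 2
    rw [zero_mul] at this
    exact this.eventually_lt_const hr0
  refine le_of_tendsto_of_tendsto hl (hr.add_const η) ?_
  filter_upwards [hsmall, Filter.eventually_gt_atTop 0] with m hm hm0
  refine (bobkov_cube (fun x => g (walk d m x)) fun x => h01 _).trans ?_
  have e : ∫ x, √(prof (g (walk d m x)) ^ 2 + ‖fderiv ℝ g (walk d m x)‖ ^ 2) ∂cube (d * m) + η
      = ∫ x, (√(prof (g (walk d m x)) ^ 2 + ‖fderiv ℝ g (walk d m x)‖ ^ 2) + η) ∂cube (d * m) := by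
    rw [integral_add .of_finite .of_finite]; simp
  rw [e]
  refine integral_mono .of_finite .of_finite fun x => ?_
  have hmpos : (0 : ℝ) < m := by exact_mod_cast hm0
  have hsq : (√m)⁻¹ ^ 2 = (m : ℝ)⁻¹ := by rw [inv_pow, Real.sq_sqrt hmpos.le]
  set p : Fin (d * m) → ℝ := fun j =>
    (√m)⁻¹ * fderiv ℝ g (walk d m x) (EuclideanSpace.single (axis j) (1 : ℝ)) with hpdef
  have hpsum : ∑ j, p j ^ 2 = ‖fderiv ℝ g (walk d m x)‖ ^ 2 := by
    simp_rw [hpdef, mul_pow, hsq]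
    rw [← Finset.mul_sum, sum_axis (fun i => fderiv ℝ g (walk d m x)
      (EuclideanSpace.single i (1 : ℝ)) ^ 2), ← mul_assoc, inv_mul_cancel₀ hmpos.ne', one_mul,
      (EuclideanSpace.basisFun (Fin d) ℝ).norm_dual]
    simp
  have hD : ∀ j, |discreteDeriv (fun x => g (walk d m x)) j x - p j| ≤ (√m)⁻¹ * ε := by
    intro j
    have hcs : ∀ b : Bool, |(√m)⁻¹ * (coinSign b - coinSign (x j))| ≤ (√m)⁻¹ * 2 := by
      intro b
      rw [abs_mul, abs_of_nonneg (by positivity : 0 ≤ (√m)⁻¹)]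
      refine mul_le_mul_of_nonneg_left ?_ (by positivity)
      cases b <;> cases x j <;> norm_num [coinSign]
    have h := abs_sub_sub_fderiv_le (x := walk d m x)
      (v := EuclideanSpace.single (axis j) (1 : ℝ)) hgd (by simp) (hcs true) (hcs false)
      (ε := ε) (fun y hy => by
        have := hrε (a := y) (b := walk d m x) (by rw [dist_eq_norm]; exact hy.trans_lt hm)
        rw [dist_eq_norm] at this
        exact this.le)
    rw [← walk_update, ← walk_update] at h
    have e2 : (√m)⁻¹ * (coinSign true - coinSign (x j))
        - (√m)⁻¹ * (coinSign false - coinSign (x j)) = 2 * (√m)⁻¹ := by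
      simp [coinSign]; ring
    rw [e2, abs_of_nonneg (by positivity : 0 ≤ 2 * (√m)⁻¹)] at h
    simp only [discreteDeriv, hpdef]
    rw [abs_le] at h ⊢
    constructor <;> linarith [h.1, h.2]
  refine (sqrt_sq_add_sum_sq_le _ _ p).trans ?_
  rw [hpsum]
  refine add_le_add_right ?_ _
  have hsum : ∑ j, (discreteDeriv (fun x => g (walk d m x)) j x - p j) ^ 2 ≤ d * ε ^ 2 := by
    calc _ ≤ ∑ j : Fin (d * m), ((√m)⁻¹ * ε) ^ 2 := Finset.sum_le_sum fun j _ =>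
          sq_le_sq' (by linarith [(abs_le.1 (hD j)).1]) (abs_le.1 (hD j)).2
      _ = d * ε ^ 2 := by
        simp [mul_pow, hsq]
        field_simp
  calc _ ≤ √(d * ε ^ 2) := Real.sqrt_le_sqrt hsum
    _ = √d * ε := by rw [Real.sqrt_mul (by positivity), Real.sqrt_sq hε.le]
    _ ≤ η := hεη

/-! ### Isoperimetry for sets -/

open scoped Convolution

section Mollify

variable {E : Type*} [NormedAddCommGroup E] [InnerProductSpace ℝ E] [FiniteDimensional ℝ E]
  [MeasurableSpace E] [BorelSpace E]

lemma exists_mollification {f : E → ℝ} {L : NNReal} (hL : LipschitzWith L f)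
    (hs : HasCompactSupport f) (h01 : ∀ x, f x ∈ Set.Icc (0 : ℝ) 1) {η : ℝ} (hη : 0 < η) :
    ∃ g : E → ℝ, ContDiff ℝ 1 g ∧ HasCompactSupport g ∧ (∀ x, g x ∈ Set.Icc (0 : ℝ) 1) ∧
      LipschitzWith L g ∧ ∀ x, (∀ y ∈ Metric.ball x η, f y = f x) → g x = f x := by
  let φ : ContDiffBump (0 : E) := ⟨η / 2, η, by positivity, by linarith⟩
  have hfc := hL.continuous
  have hi : ∀ x, Integrable fun t => φ.normed volume t * f (x - t) := fun x =>
    (φ.continuous_normed.mul (hfc.comp (continuous_const.sub continuous_id))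
      ).integrable_of_hasCompactSupport φ.hasCompactSupport_normed.mul_right
  have hg : ∀ x, (φ.normed volume ⋆[ContinuousLinearMap.lsmul ℝ ℝ, volume] f) x
      = ∫ t, φ.normed volume t * f (x - t) := fun x => rfl
  refine ⟨φ.normed volume ⋆[ContinuousLinearMap.lsmul ℝ ℝ, volume] f,
    φ.hasCompactSupport_normed.contDiff_convolution_left (n := 1) _ φ.contDiff_normed
      hfc.locallyIntegrable, φ.hasCompactSupport_normed.convolution _ hs, ?_, ?_, ?_⟩
  · intro x
    rw [hg]
    refine ⟨integral_nonneg fun t => mul_nonneg (φ.nonneg_normed t) (h01 _).1, ?_⟩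
    calc _ ≤ ∫ t, φ.normed volume t := integral_mono (hi x) φ.integrable_normed fun t =>
          mul_le_of_le_one_right (φ.nonneg_normed t) (h01 _).2
      _ = 1 := φ.integral_normed
  · refine LipschitzWith.of_dist_le_mul fun x y => ?_
    rw [hg, hg, Real.dist_eq, ← integral_sub (hi x) (hi y)]
    refine abs_integral_le_integral_abs.trans ?_
    calc _ ≤ ∫ t, φ.normed volume t * (L * dist x y) := by
          refine integral_mono ((hi x).sub (hi y)).abs (φ.integrable_normed.mul_const _) fun t => ?_
          simp only
          rw [← mul_sub, abs_mul, abs_of_nonneg (φ.nonneg_normed t)]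
          refine mul_le_mul_of_nonneg_left ?_ (φ.nonneg_normed t)
          have := hL.dist_le_mul (x - t) (y - t)
          rwa [dist_sub_right, Real.dist_eq] at this
      _ = L * dist x y := by rw [integral_mul_const, φ.integral_normed, one_mul]
  · exact fun x hx => φ.normed_convolution_eq_right hx

end Mollify

variable {d : ℕ}

local notation "γE" => ProbabilityTheory.stdGaussian (EuclideanSpace ℝ (Fin d))

lemma isoperimetry_of_isBounded {A B : Set (EuclideanSpace ℝ (Fin d))} (hA : MeasurableSet A)
    (hB : MeasurableSet B) (hAb : Bornology.IsBounded A) (hne : A.Nonempty) {δ δ' : ℝ}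
    (hδ' : 0 < δ') (hδδ' : δ' < δ) (hsep : ∀ x ∈ A, ∀ y, dist y x < δ → y ∈ B) :
    ∃ m ∈ Set.Icc ((γE).real A) ((γE).real B),
      prof m ≤ (1 / δ' + 1) * ((γE).real B - (γE).real A) := by
  set η : ℝ := (δ - δ') / 2 with hη
  have hη0 : 0 < η := by linarith
  set f : EuclideanSpace ℝ (Fin d) → ℝ := fun x =>
    max 0 (min 1 (1 - (Metric.infDist x A - η) / δ')) with hf
  have hL : LipschitzWith (Real.toNNReal (1 / δ')) f := by
    have h1 : LipschitzWith (Real.toNNReal (1 / δ')) fun x : EuclideanSpace ℝ (Fin d) =>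
        1 - (Metric.infDist x A - η) / δ' := by
      refine LipschitzWith.of_dist_le_mul fun x y => ?_
      have := (Metric.lipschitz_infDist_pt A).dist_le_mul x y
      rw [Real.dist_eq] at this ⊢
      rw [Real.coe_toNNReal _ (by positivity)]
      have e : 1 - (Metric.infDist x A - η) / δ' - (1 - (Metric.infDist y A - η) / δ')
          = -((Metric.infDist x A - Metric.infDist y A) * (1 / δ')) := by ring
      rw [e, abs_neg, abs_mul, abs_of_nonneg (by positivity : 0 ≤ 1 / δ')]
      simp only [NNReal.coe_one, one_mul] at this
      rw [mul_comm]
      gcongr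
    exact (h1.const_min 1).const_max 0
  have h01 : ∀ x, f x ∈ Set.Icc (0 : ℝ) 1 := fun x =>
    ⟨le_max_left _ _, max_le zero_le_one (min_le_left _ _)⟩
  have hf1 : ∀ x, Metric.infDist x A ≤ η → f x = 1 := by
    intro x hx
    have : (Metric.infDist x A - η) / δ' ≤ 0 :=
      div_nonpos_of_nonpos_of_nonneg (by linarith) hδ'.le
    simp only [hf]
    rw [min_eq_left (by linarith), max_eq_right zero_le_one]
  have hf0 : ∀ x, δ - η ≤ Metric.infDist x A → f x = 0 := by
    intro x hx
    have : 1 ≤ (Metric.infDist x A - η) / δ' := by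
      rw [le_div_iff₀ hδ']; linarith
    simp only [hf]
    exact max_eq_left ((min_le_right _ _).trans (by linarith))
  have hs : HasCompactSupport f := by
    refine HasCompactSupport.intro (K := Metric.cthickening δ A)
      (Metric.isCompact_of_isClosed_isBounded Metric.isClosed_cthickening hAb.cthickening) ?_
    intro x hx
    refine hf0 x (le_of_not_gt fun h => hx (Metric.thickening_subset_cthickening _ _ ?_))
    rw [Metric.mem_thickening_iff_infDist_lt hne]; linarith
  obtain ⟨g, hg, hgs, hg01, hgL, hgf⟩ := exists_mollification hL hs h01 hη0
  have hball : ∀ x y, y ∈ Metric.ball x η →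
      |Metric.infDist y A - Metric.infDist x A| < η := by
    intro x y hy
    have := (Metric.lipschitz_infDist_pt A).dist_le_mul y x
    simp only [NNReal.coe_one, one_mul, Real.dist_eq] at this
    exact this.trans_lt hy
  have hgA : ∀ x ∈ A, g x = 1 := by
    intro x hx
    have h0 := Metric.infDist_zero_of_mem hx
    have h1 : f x = 1 := hf1 x (by linarith)
    rw [hgf x, h1]
    intro y hy
    have := abs_lt.1 (hball x y hy)
    rw [h1]
    exact hf1 y (by linarith [this.2])
  have hgB : ∀ x, x ∉ B → g x = 0 := by
    intro x hx
    have h0 : δ ≤ Metric.infDist x A := by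
      rw [Metric.le_infDist hne]
      intro y hy
      exact le_of_not_gt fun h => hx (hsep y hy x h)
    have h1 : f x = 0 := hf0 x (by linarith)
    rw [hgf x, h1]
    intro y hy
    have := abs_lt.1 (hball x y hy)
    rw [h1]
    exact hf0 y (by linarith [this.1])
  have hAB : A ⊆ B := fun x hx => hsep x hx x (by rw [dist_self]; linarith)
  have hgi : Integrable g (γE) := Integrable.of_mem_Icc 0 1 hg.continuous.aemeasurable
    (.of_forall hg01)
  refine ⟨∫ x, g x ∂(γE), ⟨?_, ?_⟩, ?_⟩
  · rw [← integral_indicator_one hA]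
    refine integral_mono ((integrable_const 1).indicator hA) hgi fun x => ?_
    by_cases hx : x ∈ A
    · simp [hx, hgA x hx]
    · simpa [hx] using (hg01 x).1
  · rw [← integral_indicator_one hB]
    refine integral_mono hgi ((integrable_const 1).indicator hB) fun x => ?_
    by_cases hx : x ∈ B
    · simpa [hx] using (hg01 x).2
    · simp [hx, hgB x hx]
  · refine (bobkov_gauss hg hgs hg01).trans ?_
    have hmeas : MeasurableSet (B \ A) := hB.diff hA
    calc _ ≤ ∫ x, (B \ A).indicator (fun _ => 1 / δ' + 1) x ∂(γE) := by
          refine integral_mono_of_nonneg (.of_forall fun x => Real.sqrt_nonneg _)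
            ((integrable_const _).indicator hmeas) (.of_forall fun x => ?_)
          by_cases hx : x ∈ B \ A
          · simp only [Set.indicator_of_mem hx]
            have h1 : ‖fderiv ℝ g x‖ ≤ 1 / δ' := by
              have := norm_fderiv_le_of_lipschitz ℝ hgL (x₀ := x)
              rwa [Real.coe_toNNReal _ (by positivity)] at this
            have h2 := prof_le (g x)
            have h3 := prof_nonneg (g x)
            have h4 := norm_nonneg (fderiv ℝ g x)
            exact Real.sqrt_le_iff.2 ⟨by positivity, by nlinarith⟩
          · simp only [Set.indicator_of_notMem hx]
            have hx' : g x = 1 ∨ g x = 0 := by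
              by_cases hxB : x ∈ B
              · exact Or.inl (hgA x (not_not.1 fun h => hx ⟨hxB, h⟩))
              · exact Or.inr (hgB x hxB)
            have hfd : fderiv ℝ g x = 0 := by
              rcases hx' with h | h
              · exact IsLocalMax.fderiv_eq_zero (.of_forall fun y => by rw [h]; exact (hg01 y).2)
              · exact IsLocalMin.fderiv_eq_zero (.of_forall fun y => by rw [h]; exact (hg01 y).1)
            have hp : prof (g x) = 0 := by
              rcases hx' with h | h <;> rw [h]
              exacts [prof_one, prof_zero]
            simp [hfd, hp]
      _ = _ := by
          rw [integral_indicator hmeas, setIntegral_const, smul_eq_mul,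
            measureReal_sdiff hAB hA, mul_comm]

/-- **Gaussian isoperimetry**: if `B` contains the open `δ`-neighbourhood of `A`, then the mass of
`B \ A` is controlled from below by the profile at some value between the masses of `A` and
`B`. -/
theorem isoperimetry {A B : Set (EuclideanSpace ℝ (Fin d))} (hA : MeasurableSet A)
    (hB : MeasurableSet B) {δ : ℝ} (hδ : 0 < δ) (hsep : ∀ x ∈ A, ∀ y, dist y x < δ → y ∈ B) :
    ∃ m ∈ Set.Icc ((γE).real A) ((γE).real B),
      prof m ≤ (1 / δ + 1) * ((γE).real B - (γE).real A) := by
  rcases A.eq_empty_or_nonempty with rfl | ⟨a, ha⟩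
  · exact ⟨0, by simp, by rw [prof_zero]; simp; positivity⟩
  let S : ℕ → Set (EuclideanSpace ℝ (Fin d)) := fun n => A ∩ Metric.closedBall a n
  have hS : ∀ n, S n ⊆ A := fun n => Set.inter_subset_left
  have hSlim : Filter.Tendsto (fun n => (γE).real (S n)) Filter.atTop (nhds ((γE).real A)) := by
    have hm : Monotone S := fun i j hij => Set.inter_subset_inter_right _
      (Metric.closedBall_subset_closedBall (by exact_mod_cast hij))
    have hU : ⋃ n, S n = A := by
      rw [← Set.inter_iUnion, Metric.iUnion_closedBall_nat, Set.inter_univ]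
    have := tendsto_measure_iUnion_atTop (μ := γE) hm
    rw [hU] at this
    exact (ENNReal.tendsto_toReal (measure_ne_top _ _)).comp this
  let δ' : ℕ → ℝ := fun n => δ * (1 - 1 / ((n : ℝ) + 2))
  have hδ'0 : ∀ n, 0 < δ' n := fun n => mul_pos hδ (by
    rw [sub_pos, div_lt_one (by positivity)]; linarith [(Nat.cast_nonneg n : (0 : ℝ) ≤ n)])
  have hδ'1 : ∀ n, δ' n < δ := fun n => by
    have : (0 : ℝ) < 1 / ((n : ℝ) + 2) := by positivity
    simp only [δ']; nlinarith
  have hδ'lim : Filter.Tendsto δ' Filter.atTop (nhds δ) := by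
    have h1 : Filter.Tendsto (fun n : ℕ => (1 : ℝ) / ((n : ℝ) + 2)) Filter.atTop (nhds 0) :=
      Filter.Tendsto.div_atTop tendsto_const_nhds
        (Filter.tendsto_atTop_add_const_right _ _ tendsto_natCast_atTop_atTop)
    have := (h1.const_sub 1).const_mul δ
    rwa [sub_zero, mul_one] at this
  have hex : ∀ n, ∃ m ∈ Set.Icc ((γE).real (S n)) ((γE).real B),
      prof m ≤ (1 / δ' n + 1) * ((γE).real B - (γE).real (S n)) := fun n =>
    isoperimetry_of_isBounded (hA.inter Metric.isClosed_closedBall.measurableSet) hB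
      (Metric.isBounded_closedBall.subset Set.inter_subset_right)
      ⟨a, ha, Metric.mem_closedBall_self (Nat.cast_nonneg n)⟩ (hδ'0 n) (hδ'1 n)
      fun x hx => hsep x (hS n hx)
  choose m hm hmp using hex
  obtain ⟨m₀, -, k, hk, hlim⟩ := (isCompact_Icc (a := (0 : ℝ)) (b := (γE).real B)).tendsto_subseq
    (x := m) fun n => ⟨measureReal_nonneg.trans (hm n).1, (hm n).2⟩
  have hSk := hSlim.comp hk.tendsto_atTop
  refine ⟨m₀, ⟨le_of_tendsto_of_tendsto' hSk hlim fun n => (hm _).1,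
    le_of_tendsto' hlim fun n => (hm _).2⟩, ?_⟩
  refine le_of_tendsto_of_tendsto' ((continuous_prof.tendsto _).comp hlim) ?_ fun n => hmp (k n)
  exact (((tendsto_const_nhds.div (hδ'lim.comp hk.tendsto_atTop) hδ.ne').add_const 1).mul
    (tendsto_const_nhds.sub hSk))

/-! ### Estimates for the normal tail -/

/-- The upper tail of the standard normal distribution. -/
noncomputable def tail (x : ℝ) : ℝ := ncdf (-x)

lemma tail_eq (x : ℝ) : tail x = 1 - ncdf x := ncdf_neg x

lemma tail_pos (x : ℝ) : 0 < tail x := ncdf_pos _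

lemma tail_zero : tail 0 = 1 / 2 := by rw [tail, neg_zero, ncdf_zero]

lemma prof_tail (x : ℝ) : prof (tail x) = dens x := by rw [tail, prof_ncdf, dens_neg]

lemma strictAnti_tail : StrictAnti tail := fun _ _ h => strictMono_ncdf (neg_lt_neg h)

lemma hasDerivAt_tail (x : ℝ) : HasDerivAt tail (-dens x) x := by
  have h : tail = fun y => 1 - ncdf y := funext tail_eq
  rw [h]
  exact (hasDerivAt_ncdf x).const_sub 1

lemma continuous_tail : Continuous tail := continuous_ncdf.comp continuous_neg

lemma tendsto_tail_atTop : Filter.Tendsto tail Filter.atTop (nhds 0) :=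
  tendsto_ncdf_atBot.comp Filter.tendsto_neg_atTop_atBot

lemma dens_eq_mul_exp (x y : ℝ) : dens y = dens x * Real.exp ((x ^ 2 - y ^ 2) / 2) := by
  rw [dens, dens, mul_assoc, ← Real.exp_add]; congr 2; ring

lemma dens_anti {x y : ℝ} (hx : 0 ≤ x) (hxy : x ≤ y) : dens y ≤ dens x := by
  unfold dens; gcongr

lemma prof_mono {x y : ℝ} (hx : 0 ≤ x) (hxy : x ≤ y) (hy : y ≤ 1 / 2) : prof x ≤ prof y := by
  rcases hx.eq_or_lt with rfl | hx
  · rw [prof_zero]; exact prof_nonneg y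
  rw [prof_of_mem hx (by linarith), prof_of_mem (by linarith) (by linarith),
    ← dens_neg (quant x), ← dens_neg (quant y)]
  have h1 := quant_mono hx hxy (by linarith)
  have h2 : quant y ≤ 0 := by
    have := quant_mono (hx.trans_le hxy) hy (by norm_num)
    rwa [← ncdf_zero, quant_ncdf] at this
  exact dens_anti (by linarith) (by linarith)

lemma nonneg_of_hasDerivAt_nonpos_of_tendsto {f f' : ℝ → ℝ} {a : ℝ}
    (hf : ∀ x, a ≤ x → HasDerivAt f (f' x) x) (hf' : ∀ x, a ≤ x → f' x ≤ 0)
    (hlim : Filter.Tendsto f Filter.atTop (nhds 0)) {x : ℝ} (hx : a ≤ x) : 0 ≤ f x := by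
  have hm : AntitoneOn f (Set.Ici a) := by
    refine antitoneOn_of_deriv_nonpos (convex_Ici a)
      (fun s hs => (hf s hs).continuousAt.continuousWithinAt)
      (fun s hs => (hf s (interior_subset hs)).differentiableAt.differentiableWithinAt) ?_
    intro s hs
    rw [(hf s (interior_subset hs)).deriv]
    exact hf' s (interior_subset hs)
  refine le_of_tendsto hlim ?_
  filter_upwards [Filter.eventually_ge_atTop x] with y hy
  exact hm hx (hx.trans hy) hy

lemma le_exp_neg {u : ℝ} (hu : 0 ≤ u) : 1 - u + u ^ 2 / 2 - u ^ 3 / 6 ≤ Real.exp (-u) := by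
  have he : ∀ s : ℝ, HasDerivAt (fun s : ℝ => Real.exp (-s)) (-Real.exp (-s)) s := fun s => by
    simpa using (hasDerivAt_neg s).exp
  have h1 : ∀ s : ℝ, 0 ≤ s → Real.exp (-s) ≤ 1 - s + s ^ 2 / 2 := by
    intro s hs
    have key := le_of_hasDerivAt_nonneg (f := fun s => 1 - s + s ^ 2 / 2 - Real.exp (-s))
      (f' := fun s => -1 + s + Real.exp (-s)) hs ?_ ?_
    · norm_num at key; linarith
    · intro r _
      convert! ((((hasDerivAt_id r).const_sub 1).add ((hasDerivAt_pow 2 r).div_const 2)).sub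
        (he r)) using 1
      simp
    · intro r _
      linarith [Real.add_one_le_exp (-r)]
  have key := le_of_hasDerivAt_nonneg
    (f := fun s => Real.exp (-s) - (1 - s + s ^ 2 / 2 - s ^ 3 / 6))
    (f' := fun s => -Real.exp (-s) - (-1 + s - s ^ 2 / 2)) hu ?_ ?_
  · norm_num at key; linarith
  · intro r _
    convert! (he r).sub ((((hasDerivAt_id r).const_sub 1).add
      ((hasDerivAt_pow 2 r).div_const 2)).sub ((hasDerivAt_pow 3 r).div_const 6)) using 1
    simp; ring
  · intro r hr
    linarith [h1 r hr.1]

lemma le_half_sub_tail {x : ℝ} (hx : 0 ≤ x)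
    (h : 0 ≤ x - x ^ 3 / 6 + x ^ 5 / 40 - x ^ 7 / 336) :
    (x - x ^ 3 / 6 + x ^ 5 / 40 - x ^ 7 / 336) / 2.5067 ≤ 1 / 2 - tail x := by
  have key := le_of_hasDerivAt_nonneg (f := fun x => -tail x - (√(2 * Real.pi))⁻¹ *
      (x - x ^ 3 / 6 + x ^ 5 / 40 - x ^ 7 / 336))
    (f' := fun x => dens x - (√(2 * Real.pi))⁻¹ *
      (1 - x ^ 2 / 2 + (x ^ 2 / 2) ^ 2 / 2 - (x ^ 2 / 2) ^ 3 / 6)) hx ?_ ?_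
  · have hpi : √(2 * Real.pi) ≤ 2.5067 := by
      refine Real.sqrt_le_iff.2 ⟨by norm_num, ?_⟩
      have := Real.pi_lt_d4
      norm_num at this ⊢
      linarith
    have hinv : (2.5067 : ℝ)⁻¹ ≤ (√(2 * Real.pi))⁻¹ := inv_anti₀ (by positivity) hpi
    have := mul_le_mul_of_nonneg_right hinv h
    rw [div_eq_inv_mul]
    norm_num [tail_zero] at key this ⊢
    linarith
  · intro r _
    have hp := ((((hasDerivAt_id r).sub ((hasDerivAt_pow 3 r).div_const 6)).add
      ((hasDerivAt_pow 5 r).div_const 40)).sub ((hasDerivAt_pow 7 r).div_const 336)).const_mul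
      (√(2 * Real.pi))⁻¹
    convert! (hasDerivAt_tail r).neg.sub hp using 1
    push_cast; ring
  · intro r _
    have := le_exp_neg (u := r ^ 2 / 2) (by positivity)
    rw [sub_nonneg, dens, neg_div]
    gcongr

lemma tail_one_le : tail 1 ≤ 1 / 5 := by
  have := le_half_sub_tail (x := 1) (by norm_num) (by norm_num)
  norm_num at this
  linarith

lemma exp_neg_three_quarters_mem : Real.exp (-(3 / 4)) ∈ Set.Icc (0.472 : ℝ) 0.48 := by
  have h0 : Real.exp (-(3 / 4)) ^ 4 * Real.exp 1 ^ 3 = 1 := by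
    rw [← Real.exp_nat_mul, ← Real.exp_nat_mul, ← Real.exp_add]; norm_num
  have h1 := Real.exp_one_gt_d9
  have h2 := Real.exp_one_lt_d9
  have hp := Real.exp_pos (-(3 / 4))
  have h3 : (2.718 : ℝ) ^ 3 ≤ Real.exp 1 ^ 3 := by gcongr; linarith
  have h4 : Real.exp 1 ^ 3 ≤ (2.7183 : ℝ) ^ 3 := by gcongr; linarith
  constructor
  · by_contra! hlt
    have : Real.exp (-(3 / 4)) ^ 4 ≤ 0.472 ^ 4 := by gcongr
    have : Real.exp (-(3 / 4)) ^ 4 * Real.exp 1 ^ 3 ≤ 0.472 ^ 4 * 2.7183 ^ 3 := by gcongr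
    rw [h0] at this
    norm_num at this
  · by_contra! hlt
    have : (0.48 : ℝ) ^ 4 ≤ Real.exp (-(3 / 4)) ^ 4 := by gcongr
    have : (0.48 : ℝ) ^ 4 * 2.718 ^ 3 ≤ Real.exp (-(3 / 4)) ^ 4 * Real.exp 1 ^ 3 := by gcongr
    rw [h0] at this
    norm_num at this

lemma exp_neg_fifth_mem : Real.exp (-(1 / 5)) ∈ Set.Icc (0.8 : ℝ) 0.8189 := by
  have h0 : Real.exp (-(1 / 5)) ^ 5 * Real.exp 1 = 1 := by
    rw [← Real.exp_nat_mul, ← Real.exp_add]; norm_num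
  have h1 := Real.exp_one_gt_d9
  have hp := Real.exp_pos (-(1 / 5))
  constructor
  · linarith [Real.add_one_le_exp (-(1 / 5) : ℝ)]
  · by_contra! hlt
    have : (0.8189 : ℝ) ^ 5 ≤ Real.exp (-(1 / 5)) ^ 5 := by gcongr
    have : (0.8189 : ℝ) ^ 5 * 2.7182 ≤ Real.exp (-(1 / 5)) ^ 5 * Real.exp 1 := by
      gcongr; linarith
    rw [h0] at this
    norm_num at this

/-- The constant comparing the mass of a thin layer with a tail. -/
noncomputable def layerConst : ℝ := (1 - Real.exp (-(3 / 4))) * Real.exp (-(1 / 5))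

lemma layerConst_mem : layerConst ∈ Set.Icc (0.4 : ℝ) 0.4325 := by
  obtain ⟨h1, h2⟩ := exp_neg_three_quarters_mem
  obtain ⟨h3, h4⟩ := exp_neg_fifth_mem
  constructor <;> unfold layerConst <;> nlinarith

/-- The width beyond which the isoperimetric inequality alone suffices. -/
noncomputable def critWidth (p : ℝ) : ℝ := √(p ^ 2 + 3 / 2)

lemma critWidth_sq (p : ℝ) : critWidth p ^ 2 = p ^ 2 + 3 / 2 := Real.sq_sqrt (by positivity)

lemma critWidth_pos (p : ℝ) : 0 < critWidth p := Real.sqrt_pos.2 (by positivity)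

lemma le_critWidth {p : ℝ} : p ≤ critWidth p :=
  Real.le_sqrt_of_sq_le (by linarith)

lemma hasDerivAt_critWidth (p : ℝ) : HasDerivAt critWidth (p / critWidth p) p := by
  have h : HasDerivAt (fun p : ℝ => p ^ 2 + 3 / 2) (2 * p) p := by
    simpa using (hasDerivAt_pow 2 p).add_const (3 / 2)
  convert! h.sqrt (by positivity) using 1
  rw [critWidth]; field_simp

lemma tendsto_critWidth : Filter.Tendsto critWidth Filter.atTop Filter.atTop :=
  Filter.tendsto_atTop_mono (fun _ => le_critWidth) Filter.tendsto_id

lemma layerConst_le {p : ℝ} (hp : 1 ≤ p) : layerConst ≤ 1 / 2 - tail (critWidth p) := by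
  have h1 : (1.58 : ℝ) ≤ critWidth p := Real.le_sqrt_of_sq_le (by nlinarith)
  have h2 := strictAnti_tail.antitone h1
  have h3 := le_half_sub_tail (x := 1.58) (by norm_num) (by norm_num)
  have h4 := layerConst_mem.2
  norm_num at h3 h4
  linarith

lemma dens_critWidth (p : ℝ) : dens (critWidth p) = dens p * Real.exp (-(3 / 4)) := by
  rw [dens_eq_mul_exp p, critWidth_sq]; congr 2; ring

lemma layer_mass_ge {p : ℝ} (hp : 1 ≤ p) :
    layerConst * tail (√(p ^ 2 - 2 / 5)) ≤ tail p - tail (critWidth p) := by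
  have key := nonneg_of_hasDerivAt_nonpos_of_tendsto
    (f := fun p => tail p - tail (critWidth p) - layerConst * tail (√(p ^ 2 - 2 / 5)))
    (f' := fun p => dens p * (-1 + Real.exp (-(3 / 4)) * (p / critWidth p)
      + (1 - Real.exp (-(3 / 4))) * (p / √(p ^ 2 - 2 / 5)))) (a := 1) ?_ ?_ ?_ hp
  · linarith
  · intro x hx
    have hpos : (0 : ℝ) < x ^ 2 - 2 / 5 := by nlinarith
    have h : HasDerivAt (fun p : ℝ => p ^ 2 - 2 / 5) (2 * x) x := by
      simpa using (hasDerivAt_pow 2 x).sub_const (2 / 5)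
    have h1 := ((hasDerivAt_tail _).comp x (h.sqrt hpos.ne')).const_mul layerConst
    have h2 := (hasDerivAt_tail _).comp x (hasDerivAt_critWidth x)
    convert! ((hasDerivAt_tail x).sub h2).sub h1 using 1
    have e : layerConst * dens (√(x ^ 2 - 2 / 5)) = dens x * (1 - Real.exp (-(3 / 4))) := by
      rw [dens_eq_mul_exp x, Real.sq_sqrt hpos.le, layerConst,
        show (x ^ 2 - (x ^ 2 - 2 / 5)) / 2 = 1 / 5 by ring, Real.exp_neg (1 / 5)]
      field_simp
    rw [dens_critWidth]
    have e' : layerConst * (-dens (√(x ^ 2 - 2 / 5)) * (2 * x / (2 * √(x ^ 2 - 2 / 5))))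
        = -(layerConst * dens (√(x ^ 2 - 2 / 5))) * (x / √(x ^ 2 - 2 / 5)) := by
      rw [mul_div_mul_left _ _ two_ne_zero]; ring
    rw [e', e]; ring
  · intro x hx
    refine mul_nonpos_of_nonneg_of_nonpos (dens_pos x).le ?_
    have hpos : (0 : ℝ) < x ^ 2 - 2 / 5 := by nlinarith
    have hx0 : 0 < x := by linarith
    set s : ℝ := 1 / x ^ 2 with hs
    have hs0 : 0 < s := by positivity
    have hs1 : s ≤ 1 := by rw [hs, div_le_one (by positivity)]; nlinarith
    have ha2 : (x / critWidth x) ^ 2 * (1 + 3 / 2 * s) = 1 := by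
      rw [div_pow, critWidth_sq, hs]; field_simp
    have hb2 : (x / √(x ^ 2 - 2 / 5)) ^ 2 * (1 - 2 / 5 * s) = 1 := by
      have : x ^ 2 * 5 - 2 ≠ 0 := by linarith
      rw [div_pow, Real.sq_sqrt hpos.le, hs]; field_simp
    set a := x / critWidth x
    set b := x / √(x ^ 2 - 2 / 5)
    have ha : a ≤ 1 - 0.367 * s := by
      by_contra! hlt
      have h1 : (1 - 0.367 * s) ^ 2 < a ^ 2 := pow_lt_pow_left₀ hlt (by linarith) two_ne_zero
      have h2 : (1 - 0.367 * s) ^ 2 * (1 + 3 / 2 * s) < 1 :=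
        (mul_lt_mul_of_pos_right h1 (by linarith)).trans_eq ha2
      nlinarith [mul_nonneg hs0.le (sub_nonneg.2 hs1), mul_nonneg (mul_nonneg hs0.le hs0.le) (sub_nonneg.2 hs1)]
    have hb : b ≤ 1 + 0.292 * s := by
      by_contra! hlt
      have h1 : (1 + 0.292 * s) ^ 2 < b ^ 2 := pow_lt_pow_left₀ hlt (by linarith) two_ne_zero
      have h2 : (1 + 0.292 * s) ^ 2 * (1 - 2 / 5 * s) < 1 :=
        (mul_lt_mul_of_pos_right h1 (by linarith)).trans_eq hb2
      nlinarith [mul_nonneg hs0.le (sub_nonneg.2 hs1), mul_nonneg (mul_nonneg hs0.le hs0.le) (sub_nonneg.2 hs1)]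
    obtain ⟨hE, hE'⟩ := exp_neg_three_quarters_mem
    have h1 := mul_le_mul_of_nonneg_left ha (by linarith : 0 ≤ Real.exp (-(3 / 4)))
    have h2 := mul_le_mul_of_nonneg_left hb (by linarith : 0 ≤ 1 - Real.exp (-(3 / 4)))
    nlinarith
  · have h1 : Filter.Tendsto (fun p : ℝ => √(p ^ 2 - 2 / 5)) Filter.atTop Filter.atTop :=
      Real.tendsto_sqrt_atTop.comp (Filter.tendsto_atTop_add_const_right _ (-(2 / 5) : ℝ)
        (Filter.tendsto_pow_atTop two_ne_zero))
    simpa using (tendsto_tail_atTop.sub (tendsto_tail_atTop.comp tendsto_critWidth)).sub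
      ((tendsto_tail_atTop.comp h1).const_mul layerConst)

/-- The comparison point in the wide case. -/
noncomputable def widePoint (p : ℝ) : ℝ :=
  √(p ^ 2 - 2 * Real.log 2 + Real.log (1 + 3 / 2 / p ^ 2))

lemma widePoint_aux {p : ℝ} (hp : 1 ≤ p) :
    0 < p ^ 2 - 2 * Real.log 2 + Real.log (1 + 3 / 2 / p ^ 2) ∧
    (p - 3 / 2 / (p * (p ^ 2 + 3 / 2))) ^ 2 ≤
      (1 + 3 / 2 / p ^ 2) * (p ^ 2 - 2 * Real.log 2 + Real.log (1 + 3 / 2 / p ^ 2)) := by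
  have hp0 : 0 < p := by linarith
  set y : ℝ := 3 / 2 / p ^ 2 with hy
  have hy0 : 0 < y := by positivity
  have hy1 : y ≤ 3 / 2 := by
    rw [hy, div_le_iff₀ (by positivity)]; nlinarith
  have hyp : y * p ^ 2 = 3 / 2 := by rw [hy]; field_simp
  have hlog : y ≤ (1 + y) * Real.log (1 + y) := by
    have := Real.one_sub_inv_le_log_of_pos (by linarith : 0 < 1 + y)
    calc y = (1 + y) * (1 - (1 + y)⁻¹) := by field_simp; ring
      _ ≤ _ := by gcongr
  have hl2 := Real.log_two_lt_d9
  norm_num at hl2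
  have hlow : p ^ 2 + 3 / 2 - 1.3863 * (1 + y) + y ≤
      (1 + y) * (p ^ 2 - 2 * Real.log 2 + Real.log (1 + y)) := by nlinarith
  have hp2 : 1 ≤ p ^ 2 := by nlinarith
  refine ⟨?_, le_trans ?_ hlow⟩
  · have : 0 < (1 + y) * (p ^ 2 - 2 * Real.log 2 + Real.log (1 + y)) := by nlinarith
    exact (mul_pos_iff_of_pos_left (by linarith)).1 this
  · have e : (p - 3 / 2 / (p * (p ^ 2 + 3 / 2))) ^ 2
        = p ^ 2 - 2 * y / (1 + y) + 2 / 3 * y ^ 3 / (1 + y) ^ 2 := by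
      rw [hy]; field_simp; ring
    rw [e]
    have h1 : 0 ≤ (0.1137 - 0.3863 * y) * (1 + y) ^ 2 + 2 * y * (1 + y) - 2 / 3 * y ^ 3 := by
      nlinarith [mul_nonneg hy0.le (sub_nonneg.2 hy1),
        mul_nonneg (mul_nonneg hy0.le hy0.le) (sub_nonneg.2 hy1)]
    have h2 : 0 ≤ 0.1137 - 0.3863 * y + 2 * y / (1 + y) - 2 / 3 * y ^ 3 / (1 + y) ^ 2 := by
      have e2 : 0.1137 - 0.3863 * y + 2 * y / (1 + y) - 2 / 3 * y ^ 3 / (1 + y) ^ 2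
          = ((0.1137 - 0.3863 * y) * (1 + y) ^ 2 + 2 * y * (1 + y) - 2 / 3 * y ^ 3)
            / (1 + y) ^ 2 := by field_simp
      rw [e2]; positivity
    linarith

lemma critWidth_eq {p : ℝ} (hp : 0 < p) : critWidth p = p * √(1 + 3 / 2 / p ^ 2) := by
  rw [critWidth, ← Real.sqrt_sq hp.le, ← Real.sqrt_mul (by positivity), Real.sqrt_sq hp.le]
  congr 1; field_simp

lemma dens_widePoint {p : ℝ} (hp : 1 ≤ p) :
    critWidth p * dens (widePoint p) = 2 * p * dens p := by
  have hp0 : 0 < p := by linarith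
  have hq : (0 : ℝ) < 1 + 3 / 2 / p ^ 2 := by positivity
  rw [dens_eq_mul_exp p, widePoint, Real.sq_sqrt (widePoint_aux hp).1.le, critWidth_eq hp0,
    show (p ^ 2 - (p ^ 2 - 2 * Real.log 2 + Real.log (1 + 3 / 2 / p ^ 2))) / 2
      = Real.log 2 - Real.log (1 + 3 / 2 / p ^ 2) / 2 by ring, Real.exp_sub,
    Real.exp_log two_pos, ← Real.log_sqrt hq.le, Real.exp_log (Real.sqrt_pos.2 hq)]
  have := (Real.sqrt_pos.2 hq).ne'
  field_simp

lemma tail_widePoint_le {p : ℝ} (hp : 1 ≤ p) : tail (widePoint p) ≤ 2 * tail p := by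
  have key := nonneg_of_hasDerivAt_nonpos_of_tendsto
    (f := fun p => 2 * tail p - tail (widePoint p))
    (f' := fun p => -(2 * dens p) + dens (widePoint p) *
      ((p - 3 / 2 / (p * (p ^ 2 + 3 / 2))) / widePoint p)) (a := 1) ?_ ?_ ?_ hp
  · linarith
  · intro x hx
    have hx0 : 0 < x := by linarith
    have h0 : HasDerivAt (fun p : ℝ => 1 + 3 / 2 / p ^ 2) (-3 / x ^ 3) x := by
      have := (((hasDerivAt_pow 2 x).inv (by positivity)).const_mul (3 / 2)).const_add 1
      convert! this using 1
      simp; field_simp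
    have h1 : HasDerivAt (fun p : ℝ => p ^ 2 - 2 * Real.log 2 + Real.log (1 + 3 / 2 / p ^ 2))
        (2 * (x - 3 / 2 / (x * (x ^ 2 + 3 / 2)))) x := by
      convert! ((hasDerivAt_pow 2 x).sub_const (2 * Real.log 2)).add (h0.log (by positivity)) using 1
      simp; field_simp; ring
    have h2 := h1.sqrt (widePoint_aux hx).1.ne'
    convert! ((hasDerivAt_tail x).const_mul 2).sub ((hasDerivAt_tail _).comp x h2) using 1
    rw [mul_div_mul_left _ _ two_ne_zero, widePoint]; ring
  · intro x hx
    have hx0 : 0 < x := by linarith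
    obtain ⟨h1, h2⟩ := widePoint_aux hx
    have hz : 0 < widePoint x := Real.sqrt_pos.2 h1
    have hw := critWidth_pos x
    have hle : (x - 3 / 2 / (x * (x ^ 2 + 3 / 2))) ≤ critWidth x / x * widePoint x := by
      refine le_of_sq_le_sq ?_ (by positivity)
      refine h2.trans (le_of_eq ?_)
      rw [mul_pow, div_pow, critWidth_sq, widePoint, Real.sq_sqrt h1.le]
      congr 1; field_simp
    have h3 : (x - 3 / 2 / (x * (x ^ 2 + 3 / 2))) / widePoint x ≤ critWidth x / x := by
      rwa [div_le_iff₀ hz]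
    have h4 := mul_le_mul_of_nonneg_left h3 (dens_pos (widePoint x)).le
    have h5 : dens (widePoint x) * (critWidth x / x) = 2 * dens x := by
      have := dens_widePoint hx
      field_simp
      linarith
    linarith
  · have h1 : Filter.Tendsto widePoint Filter.atTop Filter.atTop := by
      refine Filter.tendsto_atTop_mono' _ ?_ (Real.tendsto_sqrt_atTop.comp
        (Filter.tendsto_atTop_add_const_right _ (-(2 * Real.log 2))
          (Filter.tendsto_pow_atTop (α := ℝ) two_ne_zero)))
      filter_upwards [Filter.eventually_gt_atTop 0] with x hx
      refine Real.sqrt_le_sqrt ?_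
      have : 0 ≤ Real.log (1 + 3 / 2 / x ^ 2) :=
        Real.log_nonneg (by have : 0 < 3 / 2 / x ^ 2 := by positivity
                            linarith)
      linarith
    simpa using (tendsto_tail_atTop.const_mul 2).sub (tendsto_tail_atTop.comp h1)

lemma critWidth_mul_prof_ge {p : ℝ} (hp : 1 ≤ p) :
    2 * p * dens p ≤ critWidth p * prof (2 * tail p) := by
  have h1 := strictAnti_tail.antitone hp
  have h2 := tail_one_le
  have h3 := prof_mono (tail_pos _).le (tail_widePoint_le hp) (by linarith)
  rw [prof_tail] at h3
  rw [← dens_widePoint hp]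
  exact mul_le_mul_of_nonneg_left h3 (critWidth_pos p).le

/-- The profile at the relative mass of the layer `[p, critWidth p]`. -/
lemma dens_sub_le_layerConst_mul_prof {p : ℝ} (hp : 1 ≤ p) :
    dens p - dens (critWidth p) ≤
      layerConst * prof ((tail p - tail (critWidth p)) / layerConst) := by
  have hc := layerConst_mem
  have hc0 : 0 < layerConst := by linarith [hc.1]
  have hpos : (0 : ℝ) < p ^ 2 - 2 / 5 := by nlinarith
  have h1 : tail (√(p ^ 2 - 2 / 5)) ≤ (tail p - tail (critWidth p)) / layerConst := by
    rw [le_div_iff₀ hc0, mul_comm]; exact layer_mass_ge hp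
  have h2 : (tail p - tail (critWidth p)) / layerConst ≤ 1 / 2 := by
    rw [div_le_iff₀ hc0]
    have := strictAnti_tail.antitone hp
    have := tail_one_le
    have := tail_pos (critWidth p)
    linarith [hc.1]
  have h3 := prof_mono (tail_pos _).le h1 h2
  rw [prof_tail] at h3
  refine le_trans (le_of_eq ?_) (mul_le_mul_of_nonneg_left h3 hc0.le)
  rw [dens_critWidth, dens_eq_mul_exp p (√(p ^ 2 - 2 / 5)), Real.sq_sqrt hpos.le, layerConst,
    show (p ^ 2 - (p ^ 2 - 2 / 5)) / 2 = 1 / 5 by ring, Real.exp_neg (1 / 5)]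
  field_simp

/-! ### Isoperimetry in a symmetric slab -/

lemma measureReal_Ioc {a b : ℝ} (hab : a ≤ b) :
    (gaussianReal 0 1).real (Set.Ioc a b) = ncdf b - ncdf a := by
  rw [ncdf, ncdf, ← measureReal_sdiff (Set.Iic_subset_Iic.2 hab) measurableSet_Iic]
  congr 1
  ext x
  simp [and_comm]

lemma measureReal_Ioo {a b : ℝ} (hab : a ≤ b) :
    (gaussianReal 0 1).real (Set.Ioo a b) = ncdf b - ncdf a := by
  have := nullSingletonClass_gaussianReal (μ := 0) (v := 1) one_ne_zero
  rw [← measureReal_Ioc hab]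
  exact measureReal_congr Ioo_ae_eq_Ioc

lemma measureReal_Ioo_neg {b : ℝ} (hb : 0 ≤ b) :
    (gaussianReal 0 1).real (Set.Ioo (-b) b) = 1 - 2 * tail b := by
  rw [measureReal_Ioo (by linarith), ncdf_neg, tail_eq]; ring

/-- The transport of the standard normal law to its restriction to `(-b, b)`. -/
noncomputable def slabMap (b x : ℝ) : ℝ := quant (tail b + (1 - 2 * tail b) * ncdf x)

section

variable {b : ℝ} (hb : 0 < b)
include hb

lemma tail_lt_half : tail b < 1 / 2 := tail_zero ▸ strictAnti_tail hb

lemma slabMap_arg_mem (x : ℝ) :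
    tail b < tail b + (1 - 2 * tail b) * ncdf x ∧
      tail b + (1 - 2 * tail b) * ncdf x < 1 - tail b := by
  have h := tail_lt_half hb
  have h1 := ncdf_pos x
  have h2 := ncdf_lt_one x
  constructor <;> nlinarith

lemma ncdf_slabMap (x : ℝ) : ncdf (slabMap b x) = tail b + (1 - 2 * tail b) * ncdf x := by
  have h := slabMap_arg_mem hb x
  have h3 := tail_pos b
  exact ncdf_quant (by linarith) (by linarith)

lemma hasDerivAt_slabMap (x : ℝ) :
    HasDerivAt (slabMap b) ((1 - 2 * tail b) * dens x / dens (slabMap b x)) x := by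
  have h := slabMap_arg_mem hb x
  have h3 := tail_pos b
  convert! (hasDerivAt_quant (by linarith) (by linarith)).comp x
    (((hasDerivAt_ncdf x).const_mul (1 - 2 * tail b)).const_add (tail b)) using 1
  rw [slabMap, div_eq_inv_mul]

lemma lipschitzWith_slabMap : LipschitzWith 1 (slabMap b) := by
  refine lipschitzWith_of_nnnorm_deriv_le
    (fun x => (hasDerivAt_slabMap hb x).differentiableAt) fun x => ?_
  rw [(hasDerivAt_slabMap hb x).deriv, ← NNReal.coe_le_coe, coe_nnnorm, NNReal.coe_one,
    Real.norm_eq_abs]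
  have h := tail_lt_half hb
  have h0 := tail_pos b
  rw [abs_of_nonneg (div_nonneg (mul_nonneg (by linarith) (dens_pos x).le) (dens_pos _).le),
    div_le_one (dens_pos _), ← prof_ncdf, ← prof_ncdf (slabMap b x), ncdf_slabMap hb]
  have hc := concaveOn_prof.2 (⟨(ncdf_pos x).le, (ncdf_lt_one x).le⟩ : ncdf x ∈ Set.Icc (0 : ℝ) 1)
    (⟨by norm_num, by norm_num⟩ : (1 / 2 : ℝ) ∈ Set.Icc (0 : ℝ) 1)
    (by linarith : 0 ≤ 1 - 2 * tail b) (by linarith : 0 ≤ 2 * tail b) (by ring)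
  simp only [smul_eq_mul] at hc
  rw [show (1 - 2 * tail b) * ncdf x + 2 * tail b * (1 / 2)
    = tail b + (1 - 2 * tail b) * ncdf x by ring] at hc
  nlinarith [prof_nonneg (1 / 2)]

lemma map_slabMap : ENNReal.ofReal (1 - 2 * tail b) • (gaussianReal 0 1).map (slabMap b)
    = (gaussianReal 0 1).restrict (Set.Ioo (-b) b) := by
  have h := tail_lt_half hb
  have hm : Measurable (slabMap b) := (lipschitzWith_slabMap hb).continuous.measurable
  have hcoe : ncdf (-b) = tail b := rfl
  have : IsFiniteMeasure (ENNReal.ofReal (1 - 2 * tail b) • (gaussianReal 0 1).map (slabMap b)) :=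
    Measure.smul_finite _ ENNReal.ofReal_ne_top
  refine Measure.ext_of_Iic _ _ fun a => ?_
  rw [Measure.smul_apply, Measure.map_apply hm measurableSet_Iic,
    Measure.restrict_apply measurableSet_Iic, smul_eq_mul]
  rw [← ENNReal.toReal_eq_toReal_iff' (by finiteness) (by finiteness), ENNReal.toReal_mul,
    ENNReal.toReal_ofReal (by linarith), ← measureReal_def, ← measureReal_def]
  have hpre : ∀ x, slabMap b x ≤ a ↔ tail b + (1 - 2 * tail b) * ncdf x ≤ ncdf a := fun x => by
    rw [← strictMono_ncdf.le_iff_le, ncdf_slabMap hb]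
  rcases le_or_gt a (-b) with ha | ha
  · have e1 : slabMap b ⁻¹' Set.Iic a = ∅ := by
      ext x
      have h1 := strictMono_ncdf.monotone ha
      have h2 := slabMap_arg_mem hb x
      simp only [Set.mem_preimage, Set.mem_Iic, hpre, Set.mem_empty_iff_false, iff_false]
      linarith
    have e2 : Set.Iic a ∩ Set.Ioo (-b) b = ∅ := by
      ext x; simp; intros; linarith
    rw [e1, e2]; simp
  rcases le_or_gt b a with hba | hba
  · have e1 : slabMap b ⁻¹' Set.Iic a = Set.univ := by
      ext x
      have h1 := strictMono_ncdf.monotone hba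
      have h2 := slabMap_arg_mem hb x
      simp only [Set.mem_preimage, Set.mem_Iic, hpre, Set.mem_univ, iff_true]
      linarith [tail_eq b]
    have e2 : Set.Iic a ∩ Set.Ioo (-b) b = Set.Ioo (-b) b :=
      Set.inter_eq_right.2 fun x hx => hx.2.le.trans hba
    rw [e1, e2, measureReal_Ioo_neg hb.le, probReal_univ, mul_one]
  · have h1 := strictMono_ncdf ha
    have h2 := strictMono_ncdf hba
    have hc : 0 < 1 - 2 * tail b := by linarith
    obtain ⟨y, hy⟩ := exists_ncdf_eq (y := (ncdf a - tail b) / (1 - 2 * tail b))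
      (div_pos (by linarith) hc) (by rw [div_lt_one hc]; linarith [tail_eq b])
    have e1 : slabMap b ⁻¹' Set.Iic a = Set.Iic y := by
      ext x
      simp only [Set.mem_preimage, Set.mem_Iic, hpre]
      rw [← strictMono_ncdf.le_iff_le (b := y), hy, le_div_iff₀ hc]
      constructor <;> intro <;> linarith
    have e2 : Set.Iic a ∩ Set.Ioo (-b) b = Set.Ioc (-b) a := by
      ext x; simp only [Set.mem_inter_iff, Set.mem_Iic, Set.mem_Ioo, Set.mem_Ioc]
      exact ⟨fun h => ⟨h.2.1, h.1⟩, fun h => ⟨h.2, h.1, by linarith [h.2]⟩⟩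
    rw [e1, e2, measureReal_Ioc ha.le, ← ncdf, hy, hcoe]
    field_simp

end

lemma stdGaussian_real_eq (A : Set (EuclideanSpace ℝ (Fin d))) :
    (γE).real A = (Measure.pi fun _ : Fin d => gaussianReal 0 1).real (WithLp.toLp 2 ⁻¹' A) := by
  rw [← map_pi_eq_stdGaussian]
  rw [measureReal_def, measureReal_def]
  exact congrArg _ ((MeasurableEquiv.toLp 2 (Fin d → ℝ)).map_apply A)

/-- The transport of the Gaussian measure to its restriction to a slab. -/
noncomputable def coordMap (b : ℝ) (i : Fin d) (x : EuclideanSpace ℝ (Fin d)) :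
    EuclideanSpace ℝ (Fin d) :=
  WithLp.toLp 2 fun j => (if j = i then slabMap b else id) (x j)

lemma dist_coordMap_le {b : ℝ} (hb : 0 < b) (i : Fin d) (x y : EuclideanSpace ℝ (Fin d)) :
    dist (coordMap b i x) (coordMap b i y) ≤ dist x y := by
  rw [EuclideanSpace.dist_eq, EuclideanSpace.dist_eq]
  gcongr with j
  simp only [coordMap]
  split_ifs
  · simpa using (lipschitzWith_slabMap hb).dist_le_mul (x j) (y j)
  · exact le_rfl

lemma continuous_coordMap {b : ℝ} (hb : 0 < b) (i : Fin d) : Continuous (coordMap b i) :=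
  (LipschitzWith.of_dist_le_mul (K := 1) fun x y => by
    simpa using dist_coordMap_le hb i x y).continuous

lemma measureReal_coordMap {b : ℝ} (hb : 0 < b) (i : Fin d) {A : Set (EuclideanSpace ℝ (Fin d))}
    (hA : MeasurableSet A) :
    (1 - 2 * tail b) * (γE).real (coordMap b i ⁻¹' A)
      = (γE).real (A ∩ {x | x i ∈ Set.Ioo (-b) b}) := by
  have h := tail_lt_half hb
  let f : Fin d → ℝ → ℝ := fun j => if j = i then slabMap b else id
  let S : Fin d → Set ℝ := fun j => if j = i then Set.Ioo (-b) b else Set.univ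
  have hf : ∀ j, Measurable (f j) := fun j => by
    by_cases hj : j = i
    · simp only [f, if_pos hj]; exact (lipschitzWith_slabMap hb).continuous.measurable
    · simp only [f, if_neg hj]; exact measurable_id
  have hprob : ∀ j, IsProbabilityMeasure ((gaussianReal 0 1).map (f j)) := fun j =>
    Measure.isProbabilityMeasure_map (hf j).aemeasurable
  have hres : ∀ j, (gaussianReal 0 1).restrict (S j)
      = (if j = i then ENNReal.ofReal (1 - 2 * tail b) else 1) • (gaussianReal 0 1).map (f j) := by
    intro j
    by_cases hj : j = i
    · simp only [S, f, if_pos hj, map_slabMap hb]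
    · simp only [S, f, if_neg hj, Measure.map_id, Measure.restrict_univ, one_smul]
  have key : (Measure.pi fun _ : Fin d => gaussianReal 0 1).restrict (Set.univ.pi S)
      = ENNReal.ofReal (1 - 2 * tail b) •
        (Measure.pi fun _ : Fin d => gaussianReal 0 1).map (fun x j => f j (x j)) := by
    rw [Measure.restrict_pi_pi, Measure.pi_map_pi fun j => (hf j).aemeasurable]
    refine Measure.pi_eq fun s hs => ?_
    change _ = ∏ j, ((gaussianReal 0 1).restrict (S j)) (s j)
    simp only [hres, Measure.smul_apply, smul_eq_mul, Measure.pi_pi, Finset.prod_mul_distrib,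
      Finset.prod_ite_eq', Finset.mem_univ, if_true]
  have hA' : MeasurableSet (WithLp.toLp 2 ⁻¹' A : Set (Fin d → ℝ)) :=
    (WithLp.measurable_toLp 2 _) hA
  have hfm : Measurable fun (x : Fin d → ℝ) j => f j (x j) :=
    measurable_pi_lambda _ fun j => (hf j).comp (measurable_pi_apply j)
  have hS : (Set.univ.pi S) = {x : Fin d → ℝ | x i ∈ Set.Ioo (-b) b} := by
    ext x
    simp only [Set.mem_pi, S, Set.mem_univ, true_imp_iff, Set.mem_ofPred_eq]
    refine ⟨fun hx => by simpa using hx i, fun hx j => ?_⟩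
    by_cases hj : j = i
    · subst hj; simpa using hx
    · simp [hj]
  have key2 := congrArg (fun μ => (μ (WithLp.toLp 2 ⁻¹' A)).toReal) key
  simp only [Measure.smul_apply, Measure.map_apply hfm hA', Measure.restrict_apply hA',
    smul_eq_mul, ENNReal.toReal_mul, ENNReal.toReal_ofReal (by linarith : 0 ≤ 1 - 2 * tail b),
    hS] at key2
  rw [stdGaussian_real_eq, stdGaussian_real_eq]
  exact key2.symm

/-- The isoperimetric inequality for the Gaussian measure conditioned to a slab. -/
lemma isoperimetry_slab {A B : Set (EuclideanSpace ℝ (Fin d))} (hA : MeasurableSet A)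
    (hB : MeasurableSet B) {δ b : ℝ} (hδ : 0 < δ) (hb : 0 < b) (i : Fin d)
    (hsep : ∀ x ∈ A, x i ∈ Set.Ioo (-b) b → ∀ y, y i ∈ Set.Ioo (-b) b → dist y x < δ → y ∈ B) :
    ∃ m, (γE).real (A ∩ {x | x i ∈ Set.Ioo (-b) b}) ≤ (1 - 2 * tail b) * m ∧
      (1 - 2 * tail b) * m ≤ (γE).real (B ∩ {x | x i ∈ Set.Ioo (-b) b}) ∧
      (1 - 2 * tail b) * prof m ≤ (1 / δ + 1) *
        ((γE).real (B ∩ {x | x i ∈ Set.Ioo (-b) b}) - (γE).real (A ∩ {x | x i ∈ Set.Ioo (-b) b})) := by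
  have hc : 0 ≤ 1 - 2 * tail b := by linarith [tail_lt_half hb]
  have hT := (continuous_coordMap hb i).measurable
  have hmem : ∀ x, coordMap b i x i ∈ Set.Ioo (-b) b := fun x => by
    have e : coordMap b i x i = slabMap b (x i) := by simp [coordMap]
    have h := slabMap_arg_mem hb (x i)
    rw [e, Set.mem_Ioo, ← strictMono_ncdf.lt_iff_lt, ← strictMono_ncdf.lt_iff_lt (b := b),
      ncdf_slabMap hb]
    refine ⟨h.1, by linarith [tail_eq b]⟩
  obtain ⟨m, hm, hI⟩ := isoperimetry (hT hA) (hT hB) hδ fun x hx y hyx =>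
    hsep _ hx (hmem x) _ (hmem y) ((dist_coordMap_le hb i y x).trans_lt hyx)
  rw [← measureReal_coordMap hb i hA, ← measureReal_coordMap hb i hB]
  refine ⟨m, mul_le_mul_of_nonneg_left hm.1 hc, mul_le_mul_of_nonneg_left hm.2 hc, ?_⟩
  have := mul_le_mul_of_nonneg_left hI hc
  linarith

/-! ### Geometry of symmetric convex sets -/

section Geometry

variable {E : Type*} [NormedAddCommGroup E] [InnerProductSpace ℝ E] [FiniteDimensional ℝ E]

open scoped RealInnerProductSpace in
/-- A symmetric closed convex set lies in a symmetric slab whose half-width is its inradius. -/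
lemma exists_supporting_slab {K : Set E} (hconv : Convex ℝ K) (hclosed : IsClosed K)
    (hsymm : ∀ x ∈ K, -x ∈ K) (h0 : (0 : E) ∈ K) (hne : K ≠ Set.univ) :
    ∃ w : ℝ, ∃ e : E, ‖e‖ = 1 ∧ (∀ x ∈ K, |⟪e, x⟫| ≤ w) ∧ Metric.ball 0 w ⊆ K := by
  obtain ⟨u, hu⟩ := (Set.ne_univ_iff_exists_notMem K).1 hne
  have hcne : (closure Kᶜ).Nonempty := ⟨u, subset_closure hu⟩
  obtain ⟨z, hz, hdist⟩ := isClosed_closure.exists_infDist_eq_dist hcne 0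
  obtain ⟨y, hyK, hy⟩ := mem_closure_iff_seq_limit.1 hz
  have hsep : ∀ n, ∃ e : E, ‖e‖ = 1 ∧ ∀ x ∈ K, ⟪e, x⟫ ≤ ⟪e, y n⟫ := by
    intro n
    obtain ⟨f, c, hf, hc⟩ := geometric_hahn_banach_closed_point hconv hclosed (hyK n)
    set v := (InnerProductSpace.toDual ℝ E).symm f with hv
    have hfv : ∀ x, f x = ⟪v, x⟫ := fun x => by
      rw [hv, InnerProductSpace.toDual_symm_apply]
    have hv0 : v ≠ 0 := by
      rintro h
      have h1 := hf 0 h0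
      rw [hfv, h, inner_zero_left] at h1 hc
      linarith
    have hv1 : 0 < ‖v‖ := norm_pos_iff.2 hv0
    refine ⟨‖v‖⁻¹ • v, by rw [norm_smul, norm_inv, norm_norm, inv_mul_cancel₀ hv1.ne'],
      fun x hx => ?_⟩
    rw [real_inner_smul_left, real_inner_smul_left, ← hfv, ← hfv]
    exact mul_le_mul_of_nonneg_left ((hf x hx).trans hc).le (by positivity)
  choose e he hle using hsep
  obtain ⟨e₀, he₀, k, hk, hlim⟩ := (isCompact_sphere (0 : E) 1).tendsto_subseq (x := e)
    fun n => by simp [he n]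
  have he1 : ‖e₀‖ = 1 := by simpa using he₀
  have hbound : ∀ x ∈ K, ⟪e₀, x⟫ ≤ ‖z‖ := fun x hx => by
    have h1 : ⟪e₀, x⟫ ≤ ⟪e₀, z⟫ :=
      le_of_tendsto_of_tendsto' (hlim.inner tendsto_const_nhds)
        (hlim.inner (hy.comp hk.tendsto_atTop)) fun n => hle (k n) x hx
    have h2 := real_inner_le_norm e₀ z
    rw [he1, one_mul] at h2
    exact h1.trans h2
  refine ⟨‖z‖, e₀, he1, fun x hx => abs_le.2 ⟨?_, hbound x hx⟩, fun x hx => ?_⟩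
  · have := hbound _ (hsymm x hx)
    rw [inner_neg_right] at this
    linarith
  · by_contra hxK
    have := Metric.infDist_le_dist_of_mem (x := (0 : E)) (subset_closure hxK : x ∈ closure Kᶜ)
    rw [hdist, dist_zero_left, dist_zero_left] at this
    exact absurd (mem_ball_zero_iff.1 hx) (not_lt.2 this)

omit [FiniteDimensional ℝ E] in
lemma notMem_of_dist_lt {K : Set E} (hconv : Convex ℝ K) {w : ℝ} (hball : Metric.ball 0 w ⊆ K)
    {t : ℝ} (ht : 1 < t) {x y : E} (hx : x ∉ t • K) (hxy : dist y x < (t - 1) * w) : y ∉ K := by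
  intro hy
  have ht0 : 0 < t - 1 := by linarith
  have hu : (t - 1)⁻¹ • (x - y) ∈ K := by
    refine hball ?_
    rw [mem_ball_zero_iff, norm_smul, norm_inv, Real.norm_of_nonneg ht0.le, ← dist_eq_norm,
      dist_comm, inv_mul_lt_iff₀ ht0]
    exact hxy
  refine hx ⟨_, hconv hy hu (a := t⁻¹) (b := t⁻¹ * (t - 1)) (by positivity) (by positivity)
    (by field_simp; ring), ?_⟩
  simp only [smul_add, smul_smul]
  rw [mul_inv_cancel₀ (by positivity), show t * (t⁻¹ * (t - 1) * (t - 1)⁻¹) = 1 by field_simp,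
    one_smul, one_smul]
  abel

omit [FiniteDimensional ℝ E] in
lemma compl_smul_subset_compl {K : Set E} (hconv : Convex ℝ K) {w : ℝ} (hw : 0 < w)
    (hball : Metric.ball 0 w ⊆ K) {t : ℝ} (ht : 1 < t) : (t • K)ᶜ ⊆ Kᶜ := fun x hx =>
  notMem_of_dist_lt hconv hball ht hx (by rw [dist_self]; exact mul_pos (by linarith) hw)

end Geometry

/-! ### Coordinate slices of Gauss space -/

lemma measureReal_coord (i : Fin d) {S : Set ℝ} (hS : MeasurableSet S) :
    (γE).real {x | x i ∈ S} = (gaussianReal 0 1).real S := by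
  rw [stdGaussian_real_eq, measureReal_def, measureReal_def]
  exact congrArg _ ((measurePreserving_eval (fun _ : Fin d => gaussianReal 0 1) i).measure_preimage
    hS.nullMeasurableSet)

lemma measurableSet_coord (i : Fin d) {S : Set ℝ} (hS : MeasurableSet S) :
    MeasurableSet {x : EuclideanSpace ℝ (Fin d) | x i ∈ S} :=
  (by fun_prop : Measurable fun x : EuclideanSpace ℝ (Fin d) => x i) hS

lemma measureReal_neg (A : Set (EuclideanSpace ℝ (Fin d))) : (γE).real (-A) = (γE).real A := by
  have h := stdGaussian_map (LinearIsometryEquiv.neg ℝ : EuclideanSpace ℝ (Fin d) ≃ₗᵢ[ℝ] _)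
  conv_rhs => rw [← h]
  rw [measureReal_def, measureReal_def]
  exact congrArg _
    ((LinearIsometryEquiv.neg ℝ : EuclideanSpace ℝ (Fin d) ≃ₗᵢ[ℝ] _
      ).toHomeomorph.toMeasurableEquiv.map_apply A).symm

lemma measureReal_inter_coord_congr (i : Fin d) (B : Set (EuclideanSpace ℝ (Fin d))) {S S' : Set ℝ}
    (hd : ∃ a, S \ S' ⊆ {a}) (hSS : S' ⊆ S) :
    (γE).real (B ∩ {x | x i ∈ S}) = (γE).real (B ∩ {x | x i ∈ S'}) := by
  obtain ⟨a, ha⟩ := hd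
  refine le_antisymm ?_ (measureReal_mono fun x hx => ⟨hx.1, hSS hx.2⟩)
  have hz : (γE).real {x | x i ∈ ({a} : Set ℝ)} = 0 := by
    have := nullSingletonClass_gaussianReal (μ := 0) (v := 1) one_ne_zero
    rw [measureReal_coord i (measurableSet_singleton a), measureReal_def, measure_singleton]; rfl
  refine (measureReal_mono (s₂ := B ∩ {x | x i ∈ S'} ∪ {x | x i ∈ ({a} : Set ℝ)}) ?_).trans
    ((measureReal_union_le _ _).trans (by rw [hz, add_zero]))
  intro x hx
  by_cases h : x i ∈ S'
  · exact Or.inl ⟨hx.1, h⟩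
  · exact Or.inr (ha ⟨hx.2, h⟩)

lemma measureReal_inter_Ici_eq (i : Fin d) (B : Set (EuclideanSpace ℝ (Fin d))) (b : ℝ) :
    (γE).real (B ∩ {x | x i ∈ Set.Ici b}) = (γE).real (B ∩ {x | x i ∈ Set.Ioi b}) :=
  measureReal_inter_coord_congr i B
    ⟨b, fun _ hx => le_antisymm (not_lt.1 hx.2) hx.1⟩ Set.Ioi_subset_Ici_self

lemma measureReal_Ioi (b : ℝ) : (gaussianReal 0 1).real (Set.Ioi b) = tail b := by
  rw [← Set.compl_Iic, probReal_compl_eq_one_sub measurableSet_Iic, tail_eq]; rfl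

lemma measureReal_symm_decomp (i : Fin d) {B : Set (EuclideanSpace ℝ (Fin d))}
    (hsymm : -B = B) {b : ℝ} (hb : 0 ≤ b) :
    (γE).real B = 2 * (γE).real (B ∩ {x | x i ∈ Set.Ici b})
      + (γE).real (B ∩ {x | x i ∈ Set.Ioo (-b) b}) := by
  have h1 := measureReal_inter_add_sdiff (μ := γE) (s := B)
    (measurableSet_coord i (measurableSet_Ici (a := b)))
  have h2 := measureReal_inter_add_sdiff (μ := γE) (s := B \ {x | x i ∈ Set.Ici b})
    (measurableSet_coord i (measurableSet_Ici (a := -b)))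
  have e1 : (B \ {x | x i ∈ Set.Ici b}) ∩ {x | x i ∈ Set.Ici (-b)}
      = B ∩ {x | x i ∈ Set.Ico (-b) b} := by
    ext x; simp; tauto
  have e2 : (B \ {x | x i ∈ Set.Ici b}) \ {x | x i ∈ Set.Ici (-b)}
      = -(B ∩ {x | x i ∈ Set.Ioi b}) := by
    ext x
    have : -x ∈ B ↔ x ∈ B := by
      conv_rhs => rw [← hsymm]
      rfl
    simp [this]
    constructor
    · rintro ⟨⟨h, h'⟩, h''⟩; exact ⟨h, by linarith⟩
    · rintro ⟨h, h'⟩; exact ⟨⟨h, by linarith⟩, by linarith⟩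
  have e3 : (γE).real (B ∩ {x | x i ∈ Set.Ico (-b) b})
      = (γE).real (B ∩ {x | x i ∈ Set.Ioo (-b) b}) := by
    refine measureReal_inter_coord_congr i B ⟨-b, fun x hx => ?_⟩ Set.Ioo_subset_Ico_self
    have h1 := hx.1.1
    have h2 := hx.2
    simp only [Set.mem_Ioo, not_and, not_lt] at h2
    by_contra hne
    exact absurd (h2 (lt_of_le_of_ne h1 fun h => hne h.symm)) (not_le.2 hx.1.2)
  rw [e1, e2, measureReal_neg, e3, ← measureReal_inter_Ici_eq] at h2
  linarith

/-! ### Growth of the measure under dilation -/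

lemma concaveOn_neg_tail : ConcaveOn ℝ (Set.Ici 0) fun x => 1 / 2 - tail x := by
  have hd : ∀ x, HasDerivAt (fun x => 1 / 2 - tail x) (dens x) x := fun x => by
    simpa only [neg_neg] using (hasDerivAt_tail x).const_sub (1 / 2)
  refine AntitoneOn.concaveOn_of_deriv (convex_Ici 0)
    (fun x _ => (hd x).continuousAt.continuousWithinAt)
    (fun x _ => (hd x).differentiableAt.differentiableWithinAt) ?_
  intro x hx y _ hxy
  rw [(hd x).deriv, (hd y).deriv]
  exact dens_anti (interior_subset hx) hxy

lemma tail_sub_tail_le {p w : ℝ} (hp : 0 ≤ p) (hpw : p ≤ w) :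
    tail p - tail w ≤ (w - p) * dens p := by
  have h := le_of_hasDerivAt_nonneg (f := fun s => s * dens p + tail (p + s))
    (f' := fun s => dens p - dens (p + s)) (x := w - p) (by linarith) ?_ ?_
  · simp only [zero_mul, zero_add, add_zero] at h
    rw [show p + (w - p) = w by ring] at h
    linarith
  · intro s _
    convert! ((hasDerivAt_id s).mul_const (dens p)).add
      ((hasDerivAt_tail (p + s)).comp s ((hasDerivAt_id s).const_add p)) using 1
    simp; ring
  · intro s hs
    have := dens_anti hp (by linarith [hs.1] : p ≤ p + s)
    linarith

/-- Isoperimetric comparison for splitting the mass between a half-space and a slab. -/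
lemma dens_le_prof_add {p w b r : ℝ} (hp : 1 ≤ p) (hpw : p ≤ w) (hw : w ≤ critWidth p)
    (hb : 0 < b) (hbw : b ≤ w) (hr : 0 ≤ r) (hrb : r ≤ b * ((tail p - tail w) / w)) :
    dens p ≤ prof (tail p - r) + (1 / 2 - tail b) * prof (r / (1 / 2 - tail b)) := by
  have hw0 : 0 < w := hb.trans_le hbw
  rcases hr.eq_or_lt with rfl | hr
  · simp [prof_zero, prof_tail]
  have hc := layerConst_mem
  have hc0 : 0 < layerConst := by linarith [hc.1]
  have hq : tail p ≤ 1 / 5 := (strictAnti_tail.antitone hp).trans tail_one_le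
  have hX := strictAnti_tail.antitone hw
  have hXw := strictAnti_tail.antitone hpw
  have hX0 := tail_pos (critWidth p)
  have hcw0 := layerConst_le hp
  have hC1 := dens_sub_le_layerConst_mul_prof hp
  have hprof0 := prof_tail (critWidth p)
  have hprofp := prof_tail p
  set q := tail p
  set X := tail w
  set X₀ := tail (critWidth p)
  set cb := 1 / 2 - tail b with hcb
  have hcbpos : 0 < cb := by linarith [tail_lt_half hb]
  set R₀ := q - X₀ with hR₀
  have hrR : r ≤ q - X := by
    refine hrb.trans ?_
    rw [mul_div_assoc', div_le_iff₀ hw0]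
    nlinarith
  have hR₀pos : 0 < R₀ := by linarith
  have hcbw : b * ((1 / 2 - X) / w) ≤ cb := by
    have h := concaveOn_neg_tail.2 (Set.mem_Ici.2 hw0.le) (Set.mem_Ici.2 le_rfl)
      (by positivity : 0 ≤ b / w) (by rw [sub_nonneg, div_le_one hw0]; exact hbw : 0 ≤ 1 - b / w)
      (by ring)
    simp only [smul_eq_mul, mul_zero, add_zero, tail_zero, sub_self] at h
    rw [div_mul_cancel₀ _ hw0.ne'] at h
    calc b * ((1 / 2 - X) / w) = b / w * (1 / 2 - X) := by ring
      _ ≤ cb := h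
  have hκ : r / cb ≤ R₀ / layerConst := by
    rw [div_le_div_iff₀ hcbpos hc0]
    have h1 : (q - X) * (1 / 2 - X₀) ≤ R₀ * (1 / 2 - X) := by nlinarith
    have h2 : (q - X) * layerConst ≤ R₀ * (1 / 2 - X) :=
      le_trans (mul_le_mul_of_nonneg_left hcw0 (by linarith)) h1
    calc r * layerConst ≤ b * ((q - X) / w) * layerConst := by gcongr
      _ = b / w * ((q - X) * layerConst) := by ring
      _ ≤ b / w * (R₀ * (1 / 2 - X)) := by gcongr
      _ = R₀ * (b * ((1 / 2 - X) / w)) := by ring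
      _ ≤ R₀ * cb := by gcongr
  set κ := R₀ / layerConst with hκdef
  have hκpos : 0 < κ := by positivity
  have hκ1 : κ ≤ 1 := by rw [hκdef, div_le_one hc0]; linarith [hc.1]
  have h1 : r * (prof κ / κ) ≤ cb * prof (r / cb) := by
    have h := concaveOn_prof.2 (⟨hκpos.le, hκ1⟩ : κ ∈ Set.Icc (0 : ℝ) 1)
      (⟨le_rfl, zero_le_one⟩ : (0 : ℝ) ∈ Set.Icc (0 : ℝ) 1)
      (by positivity : 0 ≤ r / cb / κ)
      (by rw [sub_nonneg, div_le_one hκpos]; exact hκ : 0 ≤ 1 - r / cb / κ) (by ring)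
    simp only [smul_eq_mul, mul_zero, add_zero, prof_zero] at h
    rw [div_mul_cancel₀ _ hκpos.ne'] at h
    calc r * (prof κ / κ) = cb * (r / cb / κ * prof κ) := by field_simp
      _ ≤ _ := by gcongr
  have h2 : (dens p - dens (critWidth p)) / R₀ ≤ prof κ / κ := by
    rw [div_le_div_iff₀ hR₀pos hκpos]
    calc _ ≤ layerConst * prof κ * κ := by gcongr
      _ = prof κ * R₀ := by rw [hκdef]; field_simp
  have h3 : dens p - r * ((dens p - dens (critWidth p)) / R₀) ≤ prof (q - r) := by
    have h := concaveOn_prof.2 (⟨by linarith, by linarith⟩ : q ∈ Set.Icc (0 : ℝ) 1)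
      (⟨hX0.le, by linarith⟩ : X₀ ∈ Set.Icc (0 : ℝ) 1)
      (by rw [sub_nonneg, div_le_one hR₀pos]; linarith : 0 ≤ 1 - r / R₀)
      (by positivity : 0 ≤ r / R₀) (by ring)
    simp only [smul_eq_mul] at h
    rw [show (1 - r / R₀) * q + r / R₀ * X₀ = q - r by
      rw [show X₀ = q - R₀ by rw [hR₀]; ring]; field_simp; ring, hprof0, hprofp] at h
    refine le_trans (le_of_eq ?_) h
    ring
  have h4 := mul_le_mul_of_nonneg_left h2 hr.le
  linarith

section Growth

variable {K : Set (EuclideanSpace ℝ (Fin d))} (hconv : Convex ℝ K) (hclosed : IsClosed K)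
  (hsymm : ∀ x ∈ K, -x ∈ K) {w : ℝ} (hball : Metric.ball 0 w ⊆ K) {p : ℝ} (hp : 1 ≤ p)
  {ρ : ℝ} (hρ0 : 0 < ρ) (hρ : ρ < 2 * p * dens p)

include hconv hclosed hball hp hρ0 hρ in
lemma growth_of_wide (hγ : (γE).real Kᶜ = 2 * tail p) (hw : critWidth p ≤ w) :
    ∀ᶠ t in nhdsWithin 1 (Set.Ioi (1 : ℝ)),
      ρ * (t - 1) ≤ (γE).real Kᶜ - (γE).real (t • K)ᶜ := by
  have hw0 : 0 < w := (critWidth_pos p).trans_le hw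
  set ε := (2 * p * dens p - ρ) / w / 2 with hε
  have hε0 : 0 < ε := by
    have : 0 < 2 * p * dens p - ρ := by linarith
    positivity
  have hI : ρ / w + 2 * ε ≤ prof (2 * tail p) := by
    have h1 := critWidth_mul_prof_ge hp
    have h2 := mul_le_mul_of_nonneg_right hw (prof_nonneg (2 * tail p))
    have h3 : ρ / w + 2 * ε = 2 * p * dens p / w := by rw [hε]; field_simp; ring
    rw [h3, div_le_iff₀ hw0]
    linarith
  obtain ⟨η, hη, hcont⟩ := Metric.continuous_iff.1 continuous_prof (2 * tail p) ε hε0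
  have hmin : 0 < min η ε / ρ := div_pos (lt_min hη hε0) hρ0
  filter_upwards [Ioo_mem_nhdsGT (by linarith : (1 : ℝ) < 1 + min η ε / ρ)] with t ht
  have ht1 : 0 < t - 1 := by linarith [ht.1]
  have htρ : ρ * (t - 1) < min η ε := by
    have : t - 1 < min η ε / ρ := by linarith [ht.2]
    rwa [lt_div_iff₀' hρ0] at this
  by_contra! hlt
  obtain ⟨m, hm, hpm⟩ := isoperimetry (A := (t • K)ᶜ) (B := Kᶜ)
    (hclosed.measurableSet.const_smul₀ t).compl hclosed.measurableSet.compl (mul_pos ht1 hw0)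
    fun x hx y hy => notMem_of_dist_lt hconv hball ht.1 hx hy
  rw [hγ] at hm hpm hlt
  have hm' : dist m (2 * tail p) < η := by
    rw [Real.dist_eq, abs_lt]
    constructor <;> linarith [hm.1, hm.2, min_le_left η ε]
  have h1 := hcont m hm'
  rw [Real.dist_eq, abs_lt] at h1
  have h2 : (1 / ((t - 1) * w) + 1) * (2 * tail p - (γE).real (t • K)ᶜ) ≤ ρ / w + ε := by
    calc _ ≤ (1 / ((t - 1) * w) + 1) * (ρ * (t - 1)) := by gcongr
      _ = ρ / w + ρ * (t - 1) := by field_simp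
      _ ≤ _ := by linarith [min_le_right η ε]
  linarith [h1.1]

include hconv hclosed hsymm hball hp hρ0 hρ in
lemma growth_of_narrow (hγ : (γE).real Kᶜ = 2 * tail p) (i : Fin d)
    (hslab : ∀ x ∈ K, |x i| ≤ w) (hpw : p ≤ w)
    (hw : w ≤ critWidth p) :
    ∀ᶠ t in nhdsWithin 1 (Set.Ioi (1 : ℝ)),
      ρ * (t - 1) ≤ (γE).real Kᶜ - (γE).real (t • K)ᶜ := by
  have hw0 : 0 < w := by linarith
  have hBm : MeasurableSet Kᶜ := hclosed.measurableSet.compl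
  have hneg : ∀ t : ℝ, -(t • K)ᶜ = (t • K)ᶜ := by
    intro t
    have hK : -K = K := by
      ext x
      exact ⟨fun h => by simpa using hsymm _ h, fun h => hsymm x h⟩
    rw [Set.compl_neg, ← Set.smul_set_neg, hK]
  have hnegK : -Kᶜ = Kᶜ := by simpa using hneg 1
  -- the mass of the complement to the right of a hyperplane
  set f : ℝ → ℝ := fun b => (γE).real (Kᶜ ∩ {x | x i ∈ Set.Ici b}) with hf
  have hfanti : Antitone f := fun a b hab =>
    measureReal_mono fun x hx => ⟨hx.1, hab.trans hx.2⟩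
  have hflip : ∀ a b, a ≤ b → f a - f b ≤ tail a - tail b := by
    intro a b hab
    have h1 : f a ≤ f b + (γE).real {x | x i ∈ Set.Ioc a b} := by
      have e : f a = (γE).real (Kᶜ ∩ {x | x i ∈ Set.Ioi a}) := measureReal_inter_Ici_eq i _ a
      rw [e]
      refine (measureReal_mono ?_).trans (measureReal_union_le _ _)
      intro x hx
      rcases le_or_gt b (x i) with h | h
      · exact Or.inl ⟨hx.1, h⟩
      · exact Or.inr ⟨hx.2, h.le⟩
    rw [measureReal_coord i measurableSet_Ioc, measureReal_Ioc hab] at h1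
    linarith [tail_eq a, tail_eq b]
  have hfcont : Continuous f := by
    rw [Metric.continuous_iff]
    intro b ε hε
    obtain ⟨δ, hδ, h⟩ := Metric.continuous_iff.1 continuous_tail b ε hε
    refine ⟨δ, hδ, fun a ha => lt_of_le_of_lt ?_ (h a ha)⟩
    rw [Real.dist_eq, Real.dist_eq]
    rcases le_total a b with hab | hab
    · rw [abs_of_nonneg (sub_nonneg.2 (hfanti hab)),
        abs_of_nonneg (sub_nonneg.2 (strictAnti_tail.antitone hab))]
      exact hflip a b hab
    · rw [abs_sub_comm, abs_sub_comm (tail a), abs_of_nonneg (sub_nonneg.2 (hfanti hab)),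
        abs_of_nonneg (sub_nonneg.2 (strictAnti_tail.antitone hab))]
      exact hflip b a hab
  have hf0 : f 0 = tail p := by
    have := measureReal_symm_decomp i hnegK (le_refl 0)
    simp only [neg_zero, Set.Ioo_self, Set.mem_empty_iff_false, Set.ofPred_false, Set.inter_empty,
      measureReal_empty, add_zero] at this
    simp only [hf]; linarith
  have hfw : f w = tail w := by
    have e : f w = (γE).real (Kᶜ ∩ {x | x i ∈ Set.Ioi w}) := measureReal_inter_Ici_eq i _ w
    rw [e, Set.inter_eq_right.2, measureReal_coord i measurableSet_Ioi, measureReal_Ioi]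
    intro x hx hxK
    exact absurd ((le_abs_self _).trans (hslab x hxK)) (not_le.2 hx)
  set R := tail p - tail w with hR
  have hR0 : 0 ≤ R := sub_nonneg.2 (strictAnti_tail.antitone hpw)
  obtain ⟨b, hb0, hbw, hbmin⟩ : ∃ b, 0 < b ∧ b ≤ w ∧
      ∀ a ∈ Set.Icc 0 w, -f b - b * (R / w) ≤ -f a - a * (R / w) := by
    obtain ⟨b, hb, hmin⟩ := (isCompact_Icc (a := (0 : ℝ)) (b := w)).exists_isMinOn
      ⟨0, le_rfl, hw0.le⟩ (f := fun a => -f a - a * (R / w)) (by fun_prop)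
    rcases hb.1.eq_or_lt with rfl | hb0
    · refine ⟨w, hw0, le_rfl, fun a ha => ?_⟩
      have := hmin ha
      simp only [Set.mem_ofPred_eq, zero_mul, sub_zero] at this
      rw [mul_div_cancel₀ _ hw0.ne']
      linarith
    · exact ⟨b, hb0, hb.2, fun a ha => hmin ha⟩
  set r := tail p - f b with hr
  have hr0 : 0 ≤ r := by rw [hr, ← hf0, sub_nonneg]; exact hfanti hb0.le
  have hrb : r ≤ b * (R / w) := by
    have := hbmin 0 ⟨le_rfl, hw0.le⟩
    rw [zero_mul, hf0] at this
    linarith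
  have hsum := dens_le_prof_add hp hpw hw hb0 hbw hr0 hrb
  have hRle := tail_sub_tail_le (by linarith : 0 ≤ p) hpw
  have hcb : 0 < 1 - 2 * tail b := by linarith [tail_lt_half hb0]
  have hslabK : (γE).real (Kᶜ ∩ {x | x i ∈ Set.Ioo (-b) b}) = 2 * r := by
    have := measureReal_symm_decomp i hnegK hb0.le
    rw [hγ] at this
    linarith
  set M := 2 * r / (1 - 2 * tail b) with hM
  have hsum' : 2 * dens p ≤ 2 * prof (f b) + (1 - 2 * tail b) * prof M := by
    rw [show tail p - r = f b by ring,
      show r / (1 / 2 - tail b) = M by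
        rw [hM, show 1 - 2 * tail b = 2 * (1 / 2 - tail b) by ring, mul_div_mul_left _ _ two_ne_zero]]
      at hsum
    linarith
  set S := (ρ + 2 * R) / w with hS
  have hS0 : 0 < S := by positivity
  set g := 2 * dens p - S with hg
  have hg0 : 0 < g := by
    rw [hg, hS, sub_pos, div_lt_iff₀ hw0]
    linarith
  obtain ⟨η₁, hη₁, hcont₁⟩ := Metric.continuous_iff.1 continuous_prof (f b) (g / 8) (by positivity)
  obtain ⟨η₂, hη₂, hcont₂⟩ := Metric.continuous_iff.1 continuous_prof M (g / 8) (by positivity)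
  have hev : ∀ C : ℝ, ∀ ε : ℝ, 0 < ε → ∀ᶠ t in nhdsWithin 1 (Set.Ioi (1 : ℝ)), C * (t - 1) < ε := by
    intro C ε hε
    refine (Filter.Tendsto.eventually_lt_const (u := ε) (v := 0) hε ?_)
    have : Continuous fun t : ℝ => C * (t - 1) := by fun_prop
    simpa using (this.tendsto 1).mono_left nhdsWithin_le_nhds
  filter_upwards [self_mem_nhdsWithin, hev w b hb0, hev ρ η₁ hη₁, hev R η₁ hη₁,
    hev ρ (η₂ * (1 - 2 * tail b)) (by positivity), hev (w * S) (g / 2) (by positivity)]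
    with t ht htb ht₁ htR ht₂ htS
  have ht1 : 0 < t - 1 := sub_pos.2 ht
  by_contra! hlt
  set A := (t • K)ᶜ with hA
  have hAm : MeasurableSet A := (hclosed.measurableSet.const_smul₀ t).compl
  have hAB : A ⊆ Kᶜ := compl_smul_subset_compl hconv hw0 hball ht
  set δ := (t - 1) * w with hδ
  have hδ0 : 0 < δ := mul_pos ht1 hw0
  have hδR : δ * (R / w) = R * (t - 1) := by rw [hδ]; field_simp
  have hsep : ∀ x ∈ A, ∀ y, dist y x < δ → y ∈ Kᶜ := fun x hx y hy =>
    notMem_of_dist_lt hconv hball ht hx hy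
  have hAdec := measureReal_symm_decomp i (hneg t) hb0.le
  rw [← hA] at hAdec
  have hfδ : f (b - δ) ≤ f b + R * (t - 1) := by
    have := hbmin (b - δ) ⟨by linarith, by linarith⟩
    rw [sub_mul, hδR] at this
    linarith
  obtain ⟨m₁, hm₁, hp₁⟩ := isoperimetry (A := A ∩ {x | x i ∈ Set.Ici b})
    (B := Kᶜ ∩ {x | x i ∈ Set.Ici (b - δ)})
    (hAm.inter (measurableSet_coord i measurableSet_Ici))
    (hBm.inter (measurableSet_coord i measurableSet_Ici)) hδ0 (by
      intro x hx y hy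
      refine ⟨hsep x hx.1 y hy, ?_⟩
      have h1 : |y i - x i| ≤ dist y x := by
        rw [dist_eq_norm]; exact PiLp.norm_apply_le (y - x) i
      have h2 := (abs_le.1 h1).1
      have h3 : b ≤ x i := hx.2
      change b - δ ≤ y i
      linarith)
  obtain ⟨m₂, hm₂, hm₂', hp₂⟩ := isoperimetry_slab hAm hBm hδ0 hb0 i
    fun x hx _ y _ hy => hsep x hx y hy
  have hfb : (γE).real (A ∩ {x | x i ∈ Set.Ici b}) ≤ f b :=
    measureReal_mono fun x hx => ⟨hAB hx.1, hx.2⟩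
  have hsl : (γE).real (A ∩ {x | x i ∈ Set.Ioo (-b) b}) ≤ 2 * r :=
    hslabK ▸ measureReal_mono fun x hx => ⟨hAB hx.1, hx.2⟩
  rw [hslabK] at hm₂' hp₂
  change _ ∈ Set.Icc _ (f (b - δ)) at hm₁
  change _ ≤ _ * (f (b - δ) - _) at hp₁
  rw [hγ, hAdec] at hlt
  set α := (γE).real (A ∩ {x | x i ∈ Set.Ici b})
  set β := (γE).real (A ∩ {x | x i ∈ Set.Ioo (-b) b})
  have h1 : dist m₁ (f b) < η₁ := by
    rw [Real.dist_eq, abs_lt]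
    constructor <;> linarith [hm₁.1, hm₁.2]
  have h2 : dist m₂ M < η₂ := by
    rw [Real.dist_eq, abs_lt, hM]
    constructor
    · rw [lt_sub_iff_add_lt, neg_add_eq_sub, sub_lt_iff_lt_add, div_lt_iff₀ hcb]
      linarith
    · rw [sub_lt_iff_lt_add, ← sub_lt_iff_lt_add', lt_div_iff₀ hcb]
      nlinarith
  have h3 := (abs_lt.1 (Real.dist_eq _ _ ▸ hcont₁ m₁ h1)).1
  have h4 := (abs_lt.1 (Real.dist_eq _ _ ▸ hcont₂ m₂ h2)).1
  have h5 := mul_lt_mul_of_pos_left h4 hcb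
  have h6 : (1 - 2 * tail b) * (g / 8) ≤ g / 8 :=
    mul_le_of_le_one_left (by positivity) (by linarith [tail_pos b])
  have h7 : (1 / δ + 1) * (2 * (f (b - δ) - α) + (2 * r - β)) ≤ S + g / 2 := by
    calc _ ≤ (1 / δ + 1) * (S * δ) := by
          gcongr
          have : S * δ = (ρ + 2 * R) * (t - 1) := by rw [hS, hδ]; field_simp
          rw [this]; linarith
      _ = S + w * S * (t - 1) := by rw [add_mul, one_mul, hδ]; field_simp
      _ ≤ _ := by linarith
  linarith

end Growth

lemma measureReal_preimage_isometry
    (U : EuclideanSpace ℝ (Fin d) ≃ₗᵢ[ℝ] EuclideanSpace ℝ (Fin d))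
    (A : Set (EuclideanSpace ℝ (Fin d))) : (γE).real (U ⁻¹' A) = (γE).real A := by
  conv_rhs => rw [← stdGaussian_map U]
  rw [measureReal_def, measureReal_def]
  exact congrArg _ (U.toHomeomorph.toMeasurableEquiv.map_apply A).symm

lemma zero_mem_of_measureReal_compl_lt {K : Set (EuclideanSpace ℝ (Fin d))} (hconv : Convex ℝ K)
    (hsymm : ∀ x ∈ K, -x ∈ K) (h : (γE).real Kᶜ < 1) : (0 : EuclideanSpace ℝ (Fin d)) ∈ K := by
  obtain ⟨x, hx⟩ : K.Nonempty := by
    by_contra hne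
    rw [Set.not_nonempty_iff_eq_empty] at hne
    simp [hne] at h
  have := hconv hx (hsymm x hx) (a := 1 / 2) (b := 1 / 2) (by norm_num) (by norm_num) (by norm_num)
  simpa using this

/-- If `K` has the measure of a symmetric strip of half-width `p ≥ 1`, then its measure grows
under dilation at least as fast as that of the strip. -/
lemma growth {K : Set (EuclideanSpace ℝ (Fin d))} (hconv : Convex ℝ K) (hclosed : IsClosed K)
    (hsymm : ∀ x ∈ K, -x ∈ K) {p : ℝ} (hp : 1 ≤ p) (hγ : (γE).real Kᶜ = 2 * tail p)
    {ρ : ℝ} (hρ0 : 0 < ρ) (hρ : ρ < 2 * p * dens p) :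
    ∀ᶠ t in nhdsWithin 1 (Set.Ioi (1 : ℝ)),
      ρ * (t - 1) ≤ (γE).real Kᶜ - (γE).real (t • K)ᶜ := by
  have hq : tail p ≤ 1 / 5 := (strictAnti_tail.antitone hp).trans tail_one_le
  have h0 := zero_mem_of_measureReal_compl_lt hconv hsymm (by rw [hγ]; linarith)
  have hne : K ≠ Set.univ := by
    rintro rfl
    have := tail_pos p
    simp at hγ
    linarith
  obtain ⟨w, e, he, hslab, hball⟩ := exists_supporting_slab hconv hclosed hsymm h0 hne
  obtain ⟨i⟩ : Nonempty (Fin d) := by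
    by_contra hempty
    rw [not_nonempty_iff] at hempty
    have : e = 0 := by ext j; exact hempty.elim j
    simp [this] at he
  set v : EuclideanSpace ℝ (Fin d) := EuclideanSpace.single i 1 with hv
  have hve : ‖v‖ = ‖e‖ := by rw [he, hv]; simp
  obtain ⟨U, hUv⟩ : ∃ U : EuclideanSpace ℝ (Fin d) ≃ₗᵢ[ℝ] EuclideanSpace ℝ (Fin d), U v = e :=
    ⟨_, Submodule.reflection_sub hve⟩
  have hUi : ∀ x, inner ℝ e (U x) = x i := fun x => by
    rw [← hUv, U.inner_map_map, hv]
    simp [EuclideanSpace.inner_single_left]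
  set L : Set (EuclideanSpace ℝ (Fin d)) := U ⁻¹' K with hL
  have hLconv : Convex ℝ L := hconv.linear_preimage U.toLinearEquiv.toLinearMap
  have hLclosed : IsClosed L := hclosed.preimage U.continuous
  have hLsymm : ∀ x ∈ L, -x ∈ L := fun x hx => by
    change U (-x) ∈ K
    rw [map_neg]; exact hsymm _ hx
  have hLball : Metric.ball 0 w ⊆ L := fun x hx => hball (by
    rw [mem_ball_zero_iff] at hx ⊢; rwa [U.norm_map])
  have hLslab : ∀ x ∈ L, |x i| ≤ w := fun x hx => by
    rw [← hUi]; exact hslab _ hx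
  have hLγ : (γE).real Lᶜ = (γE).real Kᶜ := measureReal_preimage_isometry U Kᶜ
  have hLt : ∀ t : ℝ, 1 < t → (γE).real (t • L)ᶜ = (γE).real (t • K)ᶜ := fun t ht => by
    rw [← measureReal_preimage_isometry U (t • K)ᶜ]
    congr 1
    ext x
    have ht0 : t ≠ 0 := by linarith
    simp only [Set.mem_compl_iff, Set.mem_preimage, Set.mem_smul_set_iff_inv_smul_mem₀ ht0, hL,
      map_smul]
  have hw0 : 0 ≤ w := by simpa using hslab 0 h0
  have hpw : p ≤ w := by
    by_contra! hlt
    have h1 : (γE).real L ≤ 1 - 2 * tail ((w + p) / 2) := by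
      rw [← measureReal_Ioo_neg (by linarith), ← measureReal_coord i measurableSet_Ioo]
      refine measureReal_mono fun x hx => ?_
      have := abs_le.1 (hLslab x hx)
      exact ⟨by linarith, by linarith⟩
    have h2 := probReal_compl_eq_one_sub (μ := γE) hLclosed.measurableSet
    have h3 := strictAnti_tail (by linarith : (w + p) / 2 < p)
    linarith
  have key : ∀ᶠ t in nhdsWithin 1 (Set.Ioi (1 : ℝ)),
      ρ * (t - 1) ≤ (γE).real Lᶜ - (γE).real (t • L)ᶜ := by
    rcases le_total w (critWidth p) with hw | hw
    · exact growth_of_narrow hLconv hLclosed hLsymm hLball hp hρ0 hρ (hLγ.trans hγ) i hLslab hpw hw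
    · exact growth_of_wide hLconv hLclosed hLball hp hρ0 hρ (hLγ.trans hγ) hw
  filter_upwards [key, self_mem_nhdsWithin] with t ht ht1
  rwa [hLγ, hLt t ht1] at ht

/-! ### Comparison with strips -/

lemma smul_subset_smul_of_le {E : Type*} [AddCommGroup E] [Module ℝ E] {K : Set E}
    (hconv : Convex ℝ K) (h0 : (0 : E) ∈ K) {s t : ℝ} (hs : 0 < s) (hst : s ≤ t) :
    s • K ⊆ t • K := by
  rintro _ ⟨x, hx, rfl⟩
  have ht : 0 < t := hs.trans_le hst
  refine ⟨(s / t) • x, hconv.smul_mem_of_zero_mem h0 hx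
    ⟨by positivity, (div_le_one ht).2 hst⟩, ?_⟩
  simp only [smul_smul]
  rw [mul_div_cancel₀ _ ht.ne']

lemma eventually_strip_ge {p s ρ : ℝ} (hρ : 2 * p * s * dens p < ρ) :
    ∀ᶠ v in nhdsWithin 1 (Set.Ioi (1 : ℝ)),
      2 * tail p - ρ * (v - 1) ≤ 2 * tail (p * v ^ s) := by
  have h1 : HasDerivAt (fun v : ℝ => p * v ^ s) (p * s) 1 := by
    simpa using (Real.hasDerivAt_rpow_const (x := 1) (p := s) (Or.inl one_ne_zero)).const_mul p
  have h2 : HasDerivAt (fun v : ℝ => 2 * tail (p * v ^ s) + ρ * (v - 1))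
      (2 * (-dens (p * 1 ^ s) * (p * s)) + ρ * 1) 1 :=
    (((hasDerivAt_tail _).comp (1 : ℝ) h1).const_mul 2).add
      (((hasDerivAt_id (1 : ℝ)).sub_const 1).const_mul ρ)
  rw [Real.one_rpow, mul_one, mul_one] at h2
  have h3 := (hasDerivAt_iff_tendsto_slope.1 h2).eventually_const_lt
    (u := 0) (by linarith)
  have h4 := nhdsWithin_mono (1 : ℝ) (s := Set.Ioi 1) (t := {1}ᶜ) fun x hx => (ne_of_gt hx)
  filter_upwards [h4 h3, self_mem_nhdsWithin] with v hv hv1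
  have hv1' : 0 < v - 1 := sub_pos.2 hv1
  rw [slope_def_field, div_pos_iff_of_pos_right hv1'] at hv
  simp only [Real.one_rpow, mul_one, sub_self, mul_zero, add_zero] at hv
  linarith

/-- Comparison with the strip of half-width `t ^ s`. -/
lemma measureReal_compl_smul_le_rpow {K : Set (EuclideanSpace ℝ (Fin d))} (hconv : Convex ℝ K)
    (hclosed : IsClosed K) (hsymm : ∀ x ∈ K, -x ∈ K) (hK : (γE).real Kᶜ ≤ 2 * tail 1)
    {s : ℝ} (hs0 : 0 < s) (hs1 : s < 1) {t : ℝ} (ht : 1 ≤ t) :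
    (γE).real (t • K)ᶜ ≤ 2 * tail (t ^ s) := by
  have h0 := zero_mem_of_measureReal_compl_lt hconv hsymm (by linarith [tail_one_le])
  set g : ℝ → ℝ := fun u => (γE).real (u • K)ᶜ with hg
  set G : ℝ → ℝ := fun u => 2 * tail (u ^ s) with hG
  have hGc : Continuous G :=
    continuous_const.mul (continuous_tail.comp (Real.continuous_rpow_const hs0.le))
  have hanti : ∀ u v, 1 ≤ u → u ≤ v → g v ≤ g u := fun u v hu huv =>
    measureReal_mono (Set.compl_subset_compl.2
      (smul_subset_smul_of_le hconv h0 (by linarith) huv))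
  by_contra! hlt
  set S : Set ℝ := {u | u ∈ Set.Icc 1 t ∧ g u ≤ G u} with hS
  have h1S : (1 : ℝ) ∈ S := ⟨⟨le_rfl, ht⟩, by simpa [hg, hG] using hK⟩
  have hbdd : BddAbove S := ⟨t, fun u hu => hu.1.2⟩
  set T := sSup S with hT
  have hT1 : 1 ≤ T := le_csSup hbdd h1S
  have hTt : T ≤ t := csSup_le ⟨1, h1S⟩ fun u hu => hu.1.2
  have hTS : g T ≤ G T := by
    obtain ⟨u, -, hu, huS⟩ := exists_seq_tendsto_sSup ⟨1, h1S⟩ hbdd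
    exact ge_of_tendsto' ((hGc.tendsto T).comp hu) fun n =>
      (hanti _ _ (huS n).1.1 (le_csSup hbdd (huS n))).trans (huS n).2
  have hTlt : T < t := lt_of_le_of_ne hTt fun h => absurd hTS (by rw [h]; exact not_le.2 hlt)
  have hT0 : 0 < T := by linarith
  have hev : ∀ᶠ v in nhdsWithin 1 (Set.Ioi (1 : ℝ)), g (v * T) ≤ G (v * T) := by
    rcases hTS.lt_or_eq with hstrict | heq
    · have hc : Filter.Tendsto (fun v => G (v * T)) (nhdsWithin 1 (Set.Ioi (1 : ℝ)))
          (nhds (G T)) := by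
        have : Continuous fun v => G (v * T) := hGc.comp (continuous_id.mul continuous_const)
        simpa using (this.tendsto 1).mono_left nhdsWithin_le_nhds
      filter_upwards [hc.eventually_const_lt hstrict, self_mem_nhdsWithin] with v hv hv1
      exact (hanti T _ hT1 (le_mul_of_one_le_left hT0.le (le_of_lt hv1))).trans hv.le
    · have hp : 1 ≤ T ^ s := Real.one_le_rpow hT1 hs0.le
      have hpos : 0 < 2 * T ^ s * dens (T ^ s) := by have := dens_pos (T ^ s); positivity
      obtain ⟨ρ, hρ1, hρ2⟩ := exists_between
        (by nlinarith : 2 * T ^ s * s * dens (T ^ s) < 2 * T ^ s * dens (T ^ s))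
      have hρ0 : 0 < ρ := lt_trans (by have := dens_pos (T ^ s); positivity) hρ1
      have hgrow := growth (K := T • K) (hconv.smul T) (hclosed.smul_of_ne_zero hT0.ne')
        (by rintro _ ⟨x, hx, rfl⟩; exact ⟨-x, hsymm x hx, by simp⟩) hp heq hρ0 hρ2
      filter_upwards [hgrow, eventually_strip_ge hρ1, self_mem_nhdsWithin] with v hv hv' hv1
      have hv0 : (0 : ℝ) ≤ v := by linarith [Set.mem_Ioi.1 hv1]
      rw [smul_smul] at hv
      change _ ≤ g T - g (v * T) at hv
      simp only [hG] at heq ⊢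
      rw [Real.mul_rpow hv0 hT0.le, mul_comm (v ^ s)]
      linarith
  obtain ⟨v, hv, hv1, hvt⟩ := (hev.and
    (Ioo_mem_nhdsGT ((one_lt_div hT0).2 hTlt))).exists
  have hvT : T < v * T := lt_mul_of_one_lt_left hT0 hv1
  refine absurd (le_csSup hbdd (⟨⟨by linarith, ?_⟩, hv⟩ : v * T ∈ S)) (not_le.2 hvT)
  rw [lt_div_iff₀ hT0] at hvt
  exact hvt.le

theorem measureReal_compl_smul_le {K : Set (EuclideanSpace ℝ (Fin d))} (hconv : Convex ℝ K)
    (hclosed : IsClosed K) (hsymm : ∀ x ∈ K, -x ∈ K) (hK : (γE).real Kᶜ ≤ 2 * tail 1)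
    {t : ℝ} (ht : 1 ≤ t) : (γE).real (t • K)ᶜ ≤ 2 * tail t := by
  have hc : Filter.Tendsto (fun s : ℝ => 2 * tail (t ^ s)) (nhdsWithin 1 (Set.Iio 1))
      (nhds (2 * tail t)) := by
    have : Continuous fun s : ℝ => 2 * tail (t ^ s) := continuous_const.mul
      (continuous_tail.comp (Real.continuous_const_rpow (by linarith)))
    simpa using (this.tendsto 1).mono_left nhdsWithin_le_nhds
  refine ge_of_tendsto hc ?_
  filter_upwards [Ioo_mem_nhdsLT (zero_lt_one' ℝ)] with s hs
  exact measureReal_compl_smul_le_rpow hconv hclosed hsymm hK hs.1 hs.2 ht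

end GaussianDilation

open GaussianDilation in
theorem stmt6 (d : ℕ) (K : Set (Fin d → ℝ))
    (hconv : Convex ℝ K) (hclosed : IsClosed K) (hsymm : ∀ x ∈ K, -x ∈ K)
    (hK : (gaussianReal 0 1) (Set.Ioo (-1 : ℝ) 1) ≤ stdGaussian d K) :
    ∀ t : ℝ, 1 ≤ t →
      (gaussianReal 0 1) (Set.Ioo (-t) t) ≤ stdGaussian d (t • K) := by
  intro t ht
  have : IsProbabilityMeasure (stdGaussian d) := by unfold _root_.stdGaussian; infer_instance
  let L : Set (EuclideanSpace ℝ (Fin d)) := WithLp.ofLp ⁻¹' K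
  have hLγ : ∀ u : ℝ, u ≠ 0 → (ProbabilityTheory.stdGaussian (EuclideanSpace ℝ (Fin d))).real
      (u • L)ᶜ = 1 - (stdGaussian d).real (u • K) := by
    intro u hu
    rw [stdGaussian_real_eq, ← probReal_compl_eq_one_sub (hclosed.measurableSet.const_smul₀ u)]
    congr 1
    ext x
    simp only [Set.mem_preimage, Set.mem_compl_iff, Set.mem_smul_set_iff_inv_smul_mem₀ hu, L,
      WithLp.ofLp_smul]
  have hL1 := hLγ 1 one_ne_zero
  rw [one_smul, one_smul] at hL1
  have hK' := (ENNReal.toReal_le_toReal (measure_ne_top _ _) (measure_ne_top _ _)).2 hK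
  rw [← measureReal_def, ← measureReal_def, measureReal_Ioo_neg zero_le_one] at hK'
  have key := measureReal_compl_smul_le (K := L)
    (hconv.linear_preimage (WithLp.linearEquiv 2 ℝ (Fin d → ℝ)).toLinearMap)
    (hclosed.preimage (PiLp.continuous_ofLp 2 _)) (fun x hx => hsymm _ hx)
    (by rw [hL1]; linarith) ht
  rw [hLγ t (by linarith)] at key
  rw [← ENNReal.toReal_le_toReal (measure_ne_top _ _) (measure_ne_top _ _), ← measureReal_def,
    ← measureReal_def, measureReal_Ioo_neg (by linarith)]
  linarith
end

section
/- (Balancing lemma.) There exist absolute constants c, C > 0 such that: for all positive integers d, m and finite sets X₁, …, X_m of vectors in ℝ^d with Σ_{x∈X_s} |x|² ≤ 1 for every s, there exists ε ∈ {−1, 0, 1}^d with ||ε||₁ ≥ c·d and max_{1≤s≤m} (Σ_{x∈X_s} ⟨ε, x⟩²)^{1/2} ≤ C·(log(m/d + 2))^{1/2}. -/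
open Finset

open MeasureTheory Set
open scoped ENNReal NNReal

/-- The one-dimensional Brunn–Minkowski inequality for midpoints of compact sets. -/
lemma volume_add_le_two_mul_of_isCompact {A B C : Set ℝ} (hA : IsCompact A) (hB : IsCompact B)
    (hA' : A.Nonempty) (hB' : B.Nonempty) (h : ∀ a ∈ A, ∀ b ∈ B, 2⁻¹ * (a + b) ∈ C) :
    volume A + volume B ≤ 2 * volume C := by
  set a := sSup A with ha
  set b := sInf B with hb
  have haA : a ∈ A := hA.sSup_mem hA'
  have hbB : b ∈ B := hB.sInf_mem hB'
  have hS₁ : volume ((fun x => x + -b) ⁻¹' A) = volume A := measure_preimage_add_right _ _ _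
  have hS₂ : volume ((fun x => -a + x) ⁻¹' B) = volume B := measure_preimage_add _ _ _
  have hinter : volume ((fun x => x + -b) ⁻¹' A ∩ (fun x => -a + x) ⁻¹' B) = 0 := by
    refine measure_mono_null (t := {a + b}) ?_ (by simp)
    rintro x ⟨hx, hx'⟩
    have h₁ : x + -b ≤ a := le_csSup hA.bddAbove hx
    have h₂ : b ≤ -a + x := csInf_le hB.bddBelow hx'
    simp only [Set.mem_singleton_iff]
    linarith
  have hmeas : MeasurableSet ((fun x => -a + x) ⁻¹' B) :=
    (measurable_const_add (-a)) hB.measurableSet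
  have hunion := measure_union_add_inter (μ := (volume : Measure ℝ))
    ((fun x => x + -b) ⁻¹' A) hmeas
  rw [hinter, add_zero, hS₁, hS₂] at hunion
  have hC : volume ((fun x : ℝ => 2⁻¹ * x) ⁻¹' C) = 2 * volume C := by
    rw [Real.volume_preimage_mul_left (by norm_num)]
    simp
  rw [← hunion, ← hC]
  refine measure_mono ?_
  rintro x (hx | hx)
  · have := h _ hx _ hbB
    simpa using this
  · have := h _ haA _ hx
    simpa using this

/-- The one-dimensional Brunn–Minkowski inequality for midpoints. -/
lemma volume_add_le_two_mul {A B C : Set ℝ} (hA : MeasurableSet A) (hB : MeasurableSet B)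
    (hA' : A.Nonempty) (hB' : B.Nonempty) (h : ∀ a ∈ A, ∀ b ∈ B, 2⁻¹ * (a + b) ∈ C) :
    volume A + volume B ≤ 2 * volume C := by
  rw [hA.measure_eq_iSup_isCompact, hB.measure_eq_iSup_isCompact]
  simp only [iSup_and']
  obtain ⟨a, ha⟩ := hA'
  obtain ⟨b, hb⟩ := hB'
  refine ENNReal.biSup_add_biSup_le' ⟨∅, by simp⟩ ⟨∅, by simp⟩ ?_
  rintro K ⟨hKA, hK⟩ L ⟨hLB, hL⟩
  calc volume K + volume L ≤ volume (insert a K) + volume (insert b L) := by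
        gcongr <;> exact Set.subset_insert _ _
    _ ≤ 2 * volume C := by
        refine volume_add_le_two_mul_of_isCompact (hK.insert a) (hL.insert b)
          (Set.insert_nonempty _ _) (Set.insert_nonempty _ _) fun x hx y hy => ?_
        exact h x (Set.insert_subset ha hKA hx) y (Set.insert_subset hb hLB hy)

/-- The Prékopa–Leindler inequality on the line, for functions with supremum one. -/
lemma lintegral_add_le_two_mul_lintegral {f g h : ℝ → ℝ≥0∞} (hf : Measurable f)
    (hg : Measurable g) (hh : Measurable h) (hf₁ : ⨆ x, f x = 1) (hg₁ : ⨆ x, g x = 1)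
    (hfg : ∀ x y, f x * g y ≤ h (2⁻¹ * (x + y)) ^ 2) :
    (∫⁻ x, f x) + ∫⁻ x, g x ≤ 2 * ∫⁻ x, h x := by
  have layer : ∀ u : ℝ → ℝ≥0∞, Measurable u → (∀ x, u x ≤ 1) →
      ∫⁻ x, u x = ∫⁻ t in Ioi (0 : ℝ), volume {x | ENNReal.ofReal t < u x} := by
    intro u hu hu₁
    have htop : ∀ x, u x ≠ ∞ := fun x => ((hu₁ x).trans_lt ENNReal.one_lt_top).ne
    have := lintegral_eq_lintegral_meas_lt (volume : Measure ℝ) (f := fun x => (u x).toReal)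
      (Filter.Eventually.of_forall fun x => ENNReal.toReal_nonneg) hu.ennreal_toReal.aemeasurable
    simp only [ENNReal.ofReal_toReal (htop _)] at this
    rw [this]
    refine setLIntegral_congr_fun measurableSet_Ioi fun t ht => ?_
    simp only [ENNReal.ofReal_lt_iff_lt_toReal (le_of_lt ht) (htop _)]
  have hf' : ∀ x, f x ≤ 1 := fun x => hf₁ ▸ le_iSup f x
  have hg' : ∀ x, g x ≤ 1 := fun x => hg₁ ▸ le_iSup g x
  calc (∫⁻ x, f x) + ∫⁻ x, g x
      = ∫⁻ t in Ioi (0 : ℝ), (volume {x | ENNReal.ofReal t < f x} +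
          volume {x | ENNReal.ofReal t < g x}) := by
        rw [layer f hf hf', layer g hg hg', lintegral_add_left]
        refine Antitone.measurable fun s t hst => measure_mono fun x hx => ?_
        exact (ENNReal.ofReal_le_ofReal hst).trans_lt hx
    _ ≤ ∫⁻ t in Ioi (0 : ℝ), 2 * volume {x | ENNReal.ofReal t < min (h x) 1} := by
        refine setLIntegral_mono' measurableSet_Ioi fun t ht => ?_
        rcases lt_or_ge t 1 with ht₁ | ht₁
        · have ht₁' : ENNReal.ofReal t < 1 := by simpa using ht₁
          refine volume_add_le_two_mul (measurableSet_lt measurable_const hf)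
            (measurableSet_lt measurable_const hg) ?_ ?_ ?_
          · exact lt_iSup_iff.1 (hf₁ ▸ ht₁')
          · exact lt_iSup_iff.1 (hg₁ ▸ ht₁')
          · intro a ha b hb
            refine lt_min ?_ ht₁'
            by_contra! hcon
            have h₁ : ENNReal.ofReal t * ENNReal.ofReal t < f a * g b := ENNReal.mul_lt_mul ha hb
            have h₂ := hfg a b
            have h₃ : h (2⁻¹ * (a + b)) ^ 2 ≤ ENNReal.ofReal t ^ 2 := by gcongr
            rw [← sq] at h₁
            exact absurd (h₁.trans_le (h₂.trans h₃)) (lt_irrefl _)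
        · have ht₁' : 1 ≤ ENNReal.ofReal t := by simpa using ht₁
          have e : ∀ u : ℝ → ℝ≥0∞, (∀ x, u x ≤ 1) → {x | ENNReal.ofReal t < u x} = ∅ := by
            intro u hu
            ext x
            simpa using (hu x).trans ht₁'
          simp [e f hf', e g hg']
    _ = 2 * ∫⁻ x, min (h x) 1 := by
        rw [lintegral_const_mul', ← layer _ (hh.min measurable_const) fun x => min_le_right _ _]
        simp
    _ ≤ 2 * ∫⁻ x, h x := by
        gcongr
        exact min_le_left _ _

lemma ENNReal.mul_le_sq_of_add_le {x y z : ℝ≥0∞} (h : x + y ≤ 2 * z) : x * y ≤ z ^ 2 := by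
  rcases eq_or_ne z ∞ with rfl | hz
  · simp
  have hxy : x + y ≠ ∞ := (h.trans_lt (ENNReal.mul_lt_top (by simp) hz.lt_top)).ne
  rw [ENNReal.add_ne_top] at hxy
  lift x to ℝ≥0 using hxy.1
  lift y to ℝ≥0 using hxy.2
  lift z to ℝ≥0 using hz
  norm_cast at *
  have h' : (x : ℝ) + y ≤ 2 * z := by exact_mod_cast h
  rw [← NNReal.coe_le_coe]
  push_cast
  nlinarith [sq_nonneg ((x : ℝ) - y), x.2, y.2, z.2, mul_self_le_mul_self (by positivity) h']

/-- The Prékopa–Leindler inequality on the line, for bounded functions. -/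
lemma lintegral_mul_lintegral_le_sq_of_bounded {f g h : ℝ → ℝ≥0∞} (hf : Measurable f)
    (hg : Measurable g) (hh : Measurable h) (hf₁ : ⨆ x, f x ≠ ∞) (hg₁ : ⨆ x, g x ≠ ∞)
    (hfg : ∀ x y, f x * g y ≤ h (2⁻¹ * (x + y)) ^ 2) :
    (∫⁻ x, f x) * ∫⁻ x, g x ≤ (∫⁻ x, h x) ^ 2 := by
  rcases eq_or_ne (⨆ x, f x) 0 with hS₀ | hS₀
  · simp [ENNReal.iSup_eq_zero.1 hS₀]
  rcases eq_or_ne (⨆ x, g x) 0 with hT₀ | hT₀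
  · simp [ENNReal.iSup_eq_zero.1 hT₀]
  obtain ⟨R, hR⟩ : ∃ R : ℝ≥0∞, R ^ 2 = (⨆ x, f x) * ⨆ x, g x :=
    ⟨((⨆ x, f x) * ⨆ x, g x) ^ (2⁻¹ : ℝ), by
      rw [← ENNReal.rpow_natCast, ← ENNReal.rpow_mul]; norm_num⟩
  set S := ⨆ x, f x with hS
  set T := ⨆ x, g x with hT
  have hST : S * T ≠ ∞ := ENNReal.mul_ne_top hf₁ hg₁
  have hST₀ : S * T ≠ 0 := mul_ne_zero hS₀ hT₀
  have hinv : S⁻¹ * T⁻¹ = (R⁻¹) ^ 2 := by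
    rw [← ENNReal.inv_pow, hR, ENNReal.mul_inv (.inl hS₀) (.inl hf₁)]
  have key := lintegral_add_le_two_mul_lintegral (f := fun x => S⁻¹ * f x)
    (g := fun x => T⁻¹ * g x) (h := fun x => R⁻¹ * h x) (hf.const_mul _) (hg.const_mul _)
    (hh.const_mul _) (by rw [← ENNReal.mul_iSup, ← hS, ENNReal.inv_mul_cancel hS₀ hf₁])
    (by rw [← ENNReal.mul_iSup, ← hT, ENNReal.inv_mul_cancel hT₀ hg₁]) (by
      intro x y
      calc S⁻¹ * f x * (T⁻¹ * g y) = (S⁻¹ * T⁻¹) * (f x * g y) := by ring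
        _ ≤ (R⁻¹) ^ 2 * h (2⁻¹ * (x + y)) ^ 2 := by
          rw [hinv]
          gcongr
          exact hfg x y
        _ = _ := by ring)
  have key' := ENNReal.mul_le_sq_of_add_le key
  rw [lintegral_const_mul _ hf, lintegral_const_mul _ hg, lintegral_const_mul _ hh, mul_pow,
    ← hinv, mul_mul_mul_comm, ← ENNReal.mul_inv (.inl hS₀) (.inl hf₁)] at key'
  exact (ENNReal.mul_le_mul_iff_right (ENNReal.inv_ne_zero.2 hST) (ENNReal.inv_ne_top.2 hST₀)).1 key'

lemma lintegral_eq_iSup_lintegral_min {α : Type*} [MeasurableSpace α] {μ : Measure α}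
    {f : α → ℝ≥0∞} (hf : Measurable f) : ∫⁻ x, f x ∂μ = ⨆ n : ℕ, ∫⁻ x, min (f x) n ∂μ := by
  rw [← lintegral_iSup (fun n => hf.min measurable_const)]
  · refine lintegral_congr fun x => ?_
    rw [← inf_iSup_eq, ENNReal.iSup_natCast, inf_top_eq]
  · intro m n hmn x
    dsimp only
    gcongr

/-- The Prékopa–Leindler inequality on the line. -/
lemma lintegral_mul_lintegral_le_sq_real {f g h : ℝ → ℝ≥0∞} (hf : Measurable f)
    (hg : Measurable g) (hh : Measurable h)
    (hfg : ∀ x y, f x * g y ≤ h (2⁻¹ * (x + y)) ^ 2) :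
    (∫⁻ x, f x) * ∫⁻ x, g x ≤ (∫⁻ x, h x) ^ 2 := by
  rw [lintegral_eq_iSup_lintegral_min hf, lintegral_eq_iSup_lintegral_min hg, ENNReal.iSup_mul]
  refine iSup_le fun m => ?_
  rw [ENNReal.mul_iSup]
  refine iSup_le fun n => ?_
  refine lintegral_mul_lintegral_le_sq_of_bounded (hf.min measurable_const)
    (hg.min measurable_const) hh ?_ ?_ fun x y => ?_
  · exact ((iSup_le fun x => min_le_right _ _).trans_lt (ENNReal.natCast_lt_top m)).ne
  · exact ((iSup_le fun x => min_le_right _ _).trans_lt (ENNReal.natCast_lt_top n)).ne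
  · exact (mul_le_mul' (min_le_left _ _) (min_le_left _ _)).trans (hfg x y)

/-- The Prékopa–Leindler inequality for midpoints. -/
theorem lintegral_mul_lintegral_le_sq {n : ℕ} {f g h : (Fin n → ℝ) → ℝ≥0∞} (hf : Measurable f)
    (hg : Measurable g) (hh : Measurable h)
    (hfg : ∀ x y, f x * g y ≤ h ((2⁻¹ : ℝ) • (x + y)) ^ 2) :
    (∫⁻ x, f x) * ∫⁻ x, g x ≤ (∫⁻ x, h x) ^ 2 := by
  induction n with
  | zero =>
    have hvol : ∀ u : (Fin 0 → ℝ) → ℝ≥0∞, ∫⁻ x, u x = u 0 := by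
      intro u
      rw [lintegral_unique, volume_pi, Measure.pi_univ]
      simpa using congrArg u (Subsingleton.elim _ _)
    simpa [hvol] using hfg 0 0
  | succ n ih =>
    have e := (volume_preserving_piFinSuccAbove (fun _ : Fin (n + 1) => ℝ) 0).symm
    have split : ∀ u : (Fin (n + 1) → ℝ) → ℝ≥0∞, Measurable u →
        ∫⁻ x, u x = ∫⁻ s : ℝ, ∫⁻ y : Fin n → ℝ, u (Fin.cons s y) := by
      intro u hu
      rw [← e.lintegral_comp hu, Measure.volume_eq_prod]
      refine (lintegral_prod _ (hu.comp e.measurable).aemeasurable).trans ?_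
      simp [MeasurableEquiv.piFinSuccAbove_symm_apply, Fin.insertNthEquiv]
    have hcons : Measurable fun p : ℝ × (Fin n → ℝ) => (Fin.cons p.1 p.2 : Fin (n + 1) → ℝ) := by
      refine measurable_pi_iff.2 fun i => ?_
      refine Fin.cases ?_ (fun j => ?_) i
      · simpa using measurable_fst
      · simp only [Fin.cons_succ]
        fun_prop
    have meas : ∀ u : (Fin (n + 1) → ℝ) → ℝ≥0∞, Measurable u →
        Measurable fun s : ℝ => ∫⁻ y : Fin n → ℝ, u (Fin.cons s y) := fun u hu =>
      (hu.comp hcons).lintegral_prod_right'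
    have meas' : ∀ u : (Fin (n + 1) → ℝ) → ℝ≥0∞, Measurable u → ∀ s : ℝ,
        Measurable fun y : Fin n → ℝ => u (Fin.cons s y) := fun u hu s =>
      (hu.comp hcons).comp measurable_prodMk_left
    rw [split f hf, split g hg, split h hh]
    refine lintegral_mul_lintegral_le_sq_real (meas f hf) (meas g hg) (meas h hh) fun s t => ?_
    refine ih (meas' f hf s) (meas' g hg t) (meas' h hh _) fun x y => ?_
    refine (hfg _ _).trans_eq ?_
    congr 2
    ext i
    refine Fin.cases ?_ (fun j => ?_) i <;> simp [mul_add]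

/-- The unnormalised standard Gaussian density. -/
noncomputable def gaussWeight {d : ℕ} (x : Fin d → ℝ) : ℝ≥0∞ :=
  ENNReal.ofReal (Real.exp (-(∑ i, x i ^ 2) / 2))

lemma measurable_gaussWeight {d : ℕ} : Measurable (gaussWeight (d := d)) := by
  unfold gaussWeight
  fun_prop

lemma gaussWeight_neg {d : ℕ} (x : Fin d → ℝ) : gaussWeight (-x) = gaussWeight x := by
  simp [gaussWeight]

lemma exp_inner_mul_gaussWeight {d : ℕ} (v x : Fin d → ℝ) :
    ENNReal.ofReal (Real.exp (∑ i, v i * x i)) * gaussWeight x =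
      ENNReal.ofReal (Real.exp ((∑ i, v i ^ 2) / 2)) * gaussWeight (x + -v) := by
  unfold gaussWeight
  rw [← ENNReal.ofReal_mul (Real.exp_nonneg _), ← ENNReal.ofReal_mul (Real.exp_nonneg _),
    ← Real.exp_add, ← Real.exp_add]
  congr 2
  have : ∑ i, (x + -v) i ^ 2 = ∑ i, x i ^ 2 - 2 * ∑ i, v i * x i + ∑ i, v i ^ 2 := by
    rw [mul_sum, ← sum_sub_distrib, ← sum_add_distrib]
    refine sum_congr rfl fun i _ => ?_
    simp only [Pi.add_apply, Pi.neg_apply]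
    ring
  rw [this]
  ring

lemma lintegral_gaussWeight_ne_top {d : ℕ} : ∫⁻ x : Fin d → ℝ, gaussWeight x ≠ ∞ := by
  have hint : Integrable fun x : Fin d → ℝ => ∏ i, Real.exp (-(2⁻¹) * x i ^ 2) :=
    Integrable.fintype_prod (f := fun _ (t : ℝ) => Real.exp (-(2⁻¹) * t ^ 2))
      fun _ => integrable_exp_neg_mul_sq (by norm_num)
  convert hint.lintegral_lt_top.ne using 3 with x
  rw [gaussWeight, ← Real.exp_sum, ← mul_sum]
  congr 2
  ring

lemma lintegral_gaussWeight_ne_zero {d : ℕ} : ∫⁻ x : Fin d → ℝ, gaussWeight x ≠ 0 := by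
  rw [← pos_iff_ne_zero, lintegral_pos_iff_support measurable_gaussWeight]
  have : Function.support (gaussWeight (d := d)) = Set.univ := by
    ext x
    simp [gaussWeight, Real.exp_pos]
  rw [this]
  exact isOpen_univ.measure_pos _ univ_nonempty

/-- Measurable subsets of `ℝ^d` that are symmetric and closed under midpoints. -/
structure IsSymmMidconvex {d : ℕ} (K : Set (Fin d → ℝ)) : Prop where
  measurableSet : MeasurableSet K
  neg_mem : ∀ x ∈ K, -x ∈ K
  midpoint_mem : ∀ x ∈ K, ∀ y ∈ K, (2⁻¹ : ℝ) • (x + y) ∈ K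

/-- Anderson's inequality for the Gaussian weight. -/
lemma IsSymmMidconvex.setLIntegral_gaussWeight_add_le {d : ℕ} {K : Set (Fin d → ℝ)}
    (hK : IsSymmMidconvex K) (v : Fin d → ℝ) :
    ∫⁻ x in K, gaussWeight (x + v) ≤ ∫⁻ x in K, gaussWeight x := by
  have hG := measurable_gaussWeight (d := d)
  have hGv : ∀ w : Fin d → ℝ, Measurable fun x => gaussWeight (x + w) := fun w =>
    hG.comp (measurable_add_const w)
  have hsymm : ∫⁻ x in K, gaussWeight (x + -v) = ∫⁻ x in K, gaussWeight (x + v) := by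
    rw [← lintegral_indicator hK.measurableSet, ← lintegral_indicator hK.measurableSet,
      ← (Measure.measurePreserving_neg (volume : Measure (Fin d → ℝ))).lintegral_comp
        ((hGv v).indicator hK.measurableSet)]
    refine lintegral_congr fun x => ?_
    have hmem : -x ∈ K ↔ x ∈ K := ⟨fun h => by simpa using hK.neg_mem _ h, hK.neg_mem x⟩
    by_cases hx : x ∈ K
    · rw [Set.indicator_of_mem hx, Set.indicator_of_mem (hmem.2 hx), ← gaussWeight_neg]
      congr 1
      abel
    · rw [Set.indicator_of_notMem hx, Set.indicator_of_notMem (mt hmem.1 hx)]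
  have key := lintegral_mul_lintegral_le_sq
    (f := K.indicator fun x => gaussWeight (x + v))
    (g := K.indicator fun x => gaussWeight (x + -v)) (h := K.indicator gaussWeight)
    ((hGv v).indicator hK.measurableSet) ((hGv (-v)).indicator hK.measurableSet)
    (hG.indicator hK.measurableSet) (by
      intro x y
      by_cases hx : x ∈ K
      swap
      · simp [Set.indicator_of_notMem hx]
      by_cases hy : y ∈ K
      swap
      · simp [Set.indicator_of_notMem hy]
      rw [Set.indicator_of_mem hx, Set.indicator_of_mem hy,
        Set.indicator_of_mem (hK.midpoint_mem x hx y hy)]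
      unfold gaussWeight
      rw [← ENNReal.ofReal_mul (Real.exp_nonneg _), ← ENNReal.ofReal_pow (Real.exp_nonneg _),
        ← Real.exp_add, ← Real.exp_nat_mul]
      refine ENNReal.ofReal_le_ofReal (Real.exp_le_exp.2 ?_)
      have : ∑ i, ((2⁻¹ : ℝ) • (x + y)) i ^ 2 * 2
          ≤ ∑ i, (x + v) i ^ 2 + ∑ i, (y + -v) i ^ 2 := by
        rw [← sum_add_distrib]
        refine sum_le_sum fun i _ => ?_
        simp only [Pi.add_apply, Pi.neg_apply, Pi.smul_apply, smul_eq_mul]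
        nlinarith [sq_nonneg (x i + v i - (y i - v i))]
      rw [← sum_mul] at this
      push_cast
      linarith)
  rw [lintegral_indicator hK.measurableSet, lintegral_indicator hK.measurableSet,
    lintegral_indicator hK.measurableSet, hsymm, ← sq] at key
  exact (ENNReal.pow_le_pow_left_iff two_ne_zero).1 key

/-- Restricting the Gaussian weight to a symmetric convex set does not increase exponential
moments. -/
lemma IsSymmMidconvex.setLIntegral_exp_inner_le {d : ℕ} {K : Set (Fin d → ℝ)}
    (hK : IsSymmMidconvex K) (v : Fin d → ℝ) :
    ∫⁻ x in K, ENNReal.ofReal (Real.exp (∑ i, v i * x i)) * gaussWeight x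
      ≤ ENNReal.ofReal (Real.exp ((∑ i, v i ^ 2) / 2)) * ∫⁻ x in K, gaussWeight x := by
  simp only [exp_inner_mul_gaussWeight]
  rw [lintegral_const_mul' _ _ ENNReal.ofReal_ne_top]
  exact mul_le_mul_right (hK.setLIntegral_gaussWeight_add_le (-v)) _

lemma lintegral_exp_neg_mul_sq {b : ℝ} (hb : 0 < b) :
    ∫⁻ t : ℝ, ENNReal.ofReal (Real.exp (-b * t ^ 2)) = ENNReal.ofReal √(Real.pi / b) := by
  rw [← integral_gaussian, ofReal_integral_eq_lintegral_ofReal (integrable_exp_neg_mul_sq hb)]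
  exact Filter.Eventually.of_forall fun t => Real.exp_nonneg _

lemma lintegral_exp_neg_sq_add_mul (s : ℝ) :
    ∫⁻ t : ℝ, ENNReal.ofReal (Real.exp (-t ^ 2 + t * s)) =
      ENNReal.ofReal √Real.pi * ENNReal.ofReal (Real.exp (s ^ 2 / 4)) := by
  have h := lintegral_exp_neg_mul_sq (b := 1) one_pos
  rw [div_one, ← lintegral_add_right_eq_self _ (-(s / 2))] at h
  rw [← h, ← lintegral_mul_const' _ _ ENNReal.ofReal_ne_top]
  refine lintegral_congr fun t => ?_
  rw [← ENNReal.ofReal_mul (Real.exp_nonneg _), ← Real.exp_add]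
  congr 2
  ring

lemma IsSymmMidconvex.setLIntegral_exp_sq_inner_le {d : ℕ} {K : Set (Fin d → ℝ)}
    (hK : IsSymmMidconvex K) {u : Fin d → ℝ} (hu : ∑ i, u i ^ 2 ≤ 1) :
    ∫⁻ x in K, ENNReal.ofReal (Real.exp ((∑ i, u i * x i) ^ 2 / 4)) * gaussWeight x
      ≤ 2 * ∫⁻ x in K, gaussWeight x := by
  have hpi : ENNReal.ofReal √Real.pi ≠ 0 := by simp [Real.pi_pos]
  rw [← ENNReal.mul_le_mul_iff_right hpi ENNReal.ofReal_ne_top,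
    ← lintegral_const_mul' _ _ ENNReal.ofReal_ne_top]
  have hmeas : Measurable fun p : (Fin d → ℝ) × ℝ =>
      ENNReal.ofReal (Real.exp (-p.2 ^ 2 + p.2 * ∑ i, u i * p.1 i)) * gaussWeight p.1 :=
    Measurable.mul (by fun_prop) (measurable_gaussWeight.comp measurable_fst)
  calc ∫⁻ x in K, ENNReal.ofReal √Real.pi *
        (ENNReal.ofReal (Real.exp ((∑ i, u i * x i) ^ 2 / 4)) * gaussWeight x)
      = ∫⁻ x in K, ∫⁻ t : ℝ,
          ENNReal.ofReal (Real.exp (-t ^ 2 + t * ∑ i, u i * x i)) * gaussWeight x := by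
        refine lintegral_congr fun x => ?_
        rw [lintegral_mul_const _ (by fun_prop), lintegral_exp_neg_sq_add_mul, mul_assoc]
    _ = ∫⁻ t : ℝ, ∫⁻ x in K,
          ENNReal.ofReal (Real.exp (-t ^ 2 + t * ∑ i, u i * x i)) * gaussWeight x :=
        lintegral_lintegral_swap hmeas.aemeasurable
    _ ≤ ∫⁻ t : ℝ, ENNReal.ofReal (Real.exp (-2⁻¹ * t ^ 2)) * ∫⁻ x in K, gaussWeight x := by
        refine lintegral_mono fun t => ?_
        have h := hK.setLIntegral_exp_inner_le (t • u)
        calc ∫⁻ x in K, ENNReal.ofReal (Real.exp (-t ^ 2 + t * ∑ i, u i * x i)) * gaussWeight x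
            = ENNReal.ofReal (Real.exp (-t ^ 2)) *
              ∫⁻ x in K, ENNReal.ofReal (Real.exp (∑ i, (t • u) i * x i)) * gaussWeight x := by
              rw [← lintegral_const_mul' _ _ ENNReal.ofReal_ne_top]
              refine lintegral_congr fun x => ?_
              rw [← mul_assoc, ← ENNReal.ofReal_mul (Real.exp_nonneg _), ← Real.exp_add, mul_sum]
              simp [mul_assoc]
          _ ≤ ENNReal.ofReal (Real.exp (-t ^ 2)) *
              (ENNReal.ofReal (Real.exp ((∑ i, (t • u) i ^ 2) / 2)) *
                ∫⁻ x in K, gaussWeight x) := by gcongr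
          _ ≤ ENNReal.ofReal (Real.exp (-2⁻¹ * t ^ 2)) * ∫⁻ x in K, gaussWeight x := by
              rw [← mul_assoc, ← ENNReal.ofReal_mul (Real.exp_nonneg _), ← Real.exp_add]
              gcongr
              simp only [Pi.smul_apply, smul_eq_mul, mul_pow, ← mul_sum]
              nlinarith [sq_nonneg t, mul_le_mul_of_nonneg_left hu (sq_nonneg t)]
    _ = ENNReal.ofReal √(Real.pi / 2⁻¹) * ∫⁻ x in K, gaussWeight x := by
        rw [lintegral_mul_const, lintegral_exp_neg_mul_sq (by norm_num)]
        fun_prop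
    _ ≤ ENNReal.ofReal √Real.pi * (2 * ∫⁻ x in K, gaussWeight x) := by
        rw [← mul_assoc]
        gcongr
        rw [← ENNReal.ofReal_ofNat 2, ← ENNReal.ofReal_mul (Real.sqrt_nonneg _)]
        refine ENNReal.ofReal_le_ofReal (Real.sqrt_le_iff.2 ⟨by positivity, ?_⟩)
        rw [mul_pow, Real.sq_sqrt Real.pi_pos.le]
        norm_num
        linarith [Real.pi_pos]

/-- The quadratic form `x ↦ ∑ y ∈ X, ⟨y, x⟩²`. -/
def sumSqInner {d : ℕ} (X : Finset (Fin d → ℝ)) (x : Fin d → ℝ) : ℝ :=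
  ∑ y ∈ X, (∑ i, y i * x i) ^ 2

lemma measurable_sumSqInner {d : ℕ} (X : Finset (Fin d → ℝ)) : Measurable (sumSqInner X) := by
  unfold sumSqInner
  fun_prop

lemma exp_sumSqInner_le {d : ℕ} {X : Finset (Fin d → ℝ)} (hX : ∑ y ∈ X, ∑ i, y i ^ 2 ≤ 1)
    (x : Fin d → ℝ) :
    Real.exp (sumSqInner X x / 4) ≤ (1 - ∑ y ∈ X, ∑ i, y i ^ 2) +
      ∑ y ∈ X, (∑ i, y i ^ 2) *
        Real.exp ((∑ i, ((√(∑ j, y j ^ 2))⁻¹ • y) i * x i) ^ 2 / 4) := by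
  have h := convexOn_exp.map_add_sum_le (t := X) (w := fun y => ∑ i, y i ^ 2)
    (v := 1 - ∑ y ∈ X, ∑ i, y i ^ 2) (q := 0)
    (p := fun y => (∑ i, ((√(∑ j, y j ^ 2))⁻¹ • y) i * x i) ^ 2 / 4)
    (fun y _ => sum_nonneg fun i _ => sq_nonneg _) (by ring) (fun _ _ => mem_univ _)
    (by linarith) (mem_univ _)
  simp only [smul_eq_mul, mul_zero, zero_add, Real.exp_zero, mul_one] at h
  refine le_trans (le_of_eq ?_) h
  congr 1
  rw [sumSqInner, sum_div]
  refine sum_congr rfl fun y _ => ?_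
  have hy : 0 ≤ ∑ i, y i ^ 2 := sum_nonneg fun i _ => sq_nonneg _
  rcases hy.eq_or_lt with hy₀ | hy₀
  · have : ∀ i, y i = 0 := fun i => by
      simpa using (sum_eq_zero_iff_of_nonneg fun i _ => sq_nonneg (y i)).1 hy₀.symm i (mem_univ i)
    simp [this]
  · simp only [Pi.smul_apply, smul_eq_mul, mul_assoc, ← mul_sum, mul_pow, inv_pow, Real.sq_sqrt hy]
    field_simp

lemma IsSymmMidconvex.setLIntegral_exp_sumSqInner_le {d : ℕ} {K : Set (Fin d → ℝ)}
    (hK : IsSymmMidconvex K) {X : Finset (Fin d → ℝ)} (hX : ∑ y ∈ X, ∑ i, y i ^ 2 ≤ 1) :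
    ∫⁻ x in K, ENNReal.ofReal (Real.exp (sumSqInner X x / 4)) * gaussWeight x
      ≤ 2 * ∫⁻ x in K, gaussWeight x := by
  set u : (Fin d → ℝ) → Fin d → ℝ := fun y => (√(∑ j, y j ^ 2))⁻¹ • y with hu
  have hy : ∀ y : Fin d → ℝ, 0 ≤ ∑ i, y i ^ 2 := fun y => sum_nonneg fun i _ => sq_nonneg _
  have hu₁ : ∀ y, ∑ i, u y i ^ 2 ≤ 1 := by
    intro y
    simp only [hu, Pi.smul_apply, smul_eq_mul, mul_pow, inv_pow, Real.sq_sqrt (hy y), ← mul_sum]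
    exact inv_mul_le_one
  have hW : 0 ≤ 1 - ∑ y ∈ X, ∑ i, y i ^ 2 := by linarith
  have hG := measurable_gaussWeight (d := d)
  calc ∫⁻ x in K, ENNReal.ofReal (Real.exp (sumSqInner X x / 4)) * gaussWeight x
      ≤ ∫⁻ x in K, (ENNReal.ofReal (1 - ∑ y ∈ X, ∑ i, y i ^ 2) * gaussWeight x +
          ∑ y ∈ X, ENNReal.ofReal (∑ i, y i ^ 2) *
            (ENNReal.ofReal (Real.exp ((∑ i, u y i * x i) ^ 2 / 4)) * gaussWeight x)) := by
        refine lintegral_mono fun x => ?_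
        dsimp only
        simp only [← mul_assoc, ← ENNReal.ofReal_mul (hy _), ← sum_mul, ← add_mul]
        rw [← ENNReal.ofReal_sum_of_nonneg fun y _ => mul_nonneg (hy y) (Real.exp_nonneg _),
          ← ENNReal.ofReal_add hW
            (sum_nonneg fun y _ => mul_nonneg (hy y) (Real.exp_nonneg _))]
        gcongr
        exact exp_sumSqInner_le hX x
    _ = ENNReal.ofReal (1 - ∑ y ∈ X, ∑ i, y i ^ 2) * (∫⁻ x in K, gaussWeight x) +
          ∑ y ∈ X, ENNReal.ofReal (∑ i, y i ^ 2) *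
            ∫⁻ x in K, ENNReal.ofReal (Real.exp ((∑ i, u y i * x i) ^ 2 / 4)) *
              gaussWeight x := by
        rw [lintegral_add_left (hG.const_mul _), lintegral_const_mul _ hG,
          lintegral_finsetSum _ fun y _ => by fun_prop]
        simp only [lintegral_const_mul' _ _ ENNReal.ofReal_ne_top]
    _ ≤ ENNReal.ofReal (1 - ∑ y ∈ X, ∑ i, y i ^ 2) * (2 * ∫⁻ x in K, gaussWeight x) +
          ∑ y ∈ X, ENNReal.ofReal (∑ i, y i ^ 2) * (2 * ∫⁻ x in K, gaussWeight x) := by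
        gcongr with y _
        · exact le_mul_of_one_le_left' one_le_two
        · exact hK.setLIntegral_exp_sq_inner_le (hu₁ y)
    _ = 2 * ∫⁻ x in K, gaussWeight x := by
        rw [← sum_mul, ← add_mul, ← ENNReal.ofReal_sum_of_nonneg fun y _ => hy y,
          ← ENNReal.ofReal_add hW (sum_nonneg fun y _ => hy y), sub_add_cancel,
          ENNReal.ofReal_one, one_mul]

lemma isSymmMidconvex_forall_sumSqInner_le {d : ℕ} {ι : Type*} (S : Finset ι)
    (X : ι → Finset (Fin d → ℝ)) (T : ℝ) :
    IsSymmMidconvex {x | ∀ s ∈ S, sumSqInner (X s) x ≤ T} where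
  measurableSet := by
    simp only [Set.ofPred_forall]
    exact Finset.measurableSet_biInter _ fun s _ =>
      measurableSet_le (measurable_sumSqInner _) measurable_const
  neg_mem x hx s hs := by simpa [sumSqInner] using hx s hs
  midpoint_mem x hx y hy s hs := by
    have key : 2 * sumSqInner (X s) ((2⁻¹ : ℝ) • (x + y)) ≤
        sumSqInner (X s) x + sumSqInner (X s) y := by
      simp only [sumSqInner]
      rw [mul_sum, ← sum_add_distrib]
      refine sum_le_sum fun z _ => ?_
      have : ∑ i, z i * ((2⁻¹ : ℝ) • (x + y)) i = 2⁻¹ * (∑ i, z i * x i + ∑ i, z i * y i) := by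
        rw [← sum_add_distrib, mul_sum]
        refine sum_congr rfl fun i _ => ?_
        simp only [Pi.add_apply, Pi.smul_apply, smul_eq_mul]
        ring
      rw [this]
      nlinarith [sq_nonneg (∑ i, z i * x i - ∑ i, z i * y i)]
    linarith [hx s hs, hy s hs]

/-- Intersecting a symmetric convex set with an ellipsoid loses only a small proportion of its
Gaussian mass. -/
lemma IsSymmMidconvex.mul_setLIntegral_le_inter {d : ℕ} {K : Set (Fin d → ℝ)}
    (hK : IsSymmMidconvex K) {X : Finset (Fin d → ℝ)} (hX : ∑ y ∈ X, ∑ i, y i ^ 2 ≤ 1) (T : ℝ) :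
    ENNReal.ofReal (1 - 2 * Real.exp (-T / 4)) * ∫⁻ x in K, gaussWeight x
      ≤ ∫⁻ x in K ∩ {x | sumSqInner X x ≤ T}, gaussWeight x := by
  have hE : MeasurableSet {x | sumSqInner X x ≤ T} :=
    measurableSet_le (measurable_sumSqInner X) measurable_const
  have hfin : ∫⁻ x in K, gaussWeight x ≠ ∞ :=
    ((setLIntegral_le_lintegral K _).trans_lt lintegral_gaussWeight_ne_top.lt_top).ne
  have htail : ∫⁻ x in K \ {x | sumSqInner X x ≤ T}, gaussWeight x
      ≤ ENNReal.ofReal (2 * Real.exp (-T / 4)) * ∫⁻ x in K, gaussWeight x := by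
    calc ∫⁻ x in K \ {x | sumSqInner X x ≤ T}, gaussWeight x
        ≤ ∫⁻ x in K \ {x | sumSqInner X x ≤ T}, ENNReal.ofReal (Real.exp (-T / 4)) *
            (ENNReal.ofReal (Real.exp (sumSqInner X x / 4)) * gaussWeight x) := by
          refine setLIntegral_mono' (hK.measurableSet.diff hE) fun x hx => ?_
          have hx' : T < sumSqInner X x := not_le.1 hx.2
          rw [← mul_assoc, ← ENNReal.ofReal_mul (Real.exp_nonneg _), ← Real.exp_add]
          refine le_mul_of_one_le_left' ?_
          rw [ENNReal.one_le_ofReal, Real.one_le_exp_iff]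
          linarith
      _ ≤ ∫⁻ x in K, ENNReal.ofReal (Real.exp (-T / 4)) *
            (ENNReal.ofReal (Real.exp (sumSqInner X x / 4)) * gaussWeight x) :=
          lintegral_mono_set sdiff_subset
      _ ≤ ENNReal.ofReal (Real.exp (-T / 4)) * (2 * ∫⁻ x in K, gaussWeight x) := by
          rw [lintegral_const_mul' _ _ ENNReal.ofReal_ne_top]
          gcongr
          exact hK.setLIntegral_exp_sumSqInner_le hX
      _ = ENNReal.ofReal (2 * Real.exp (-T / 4)) * ∫⁻ x in K, gaussWeight x := by
          rw [mul_comm (2 : ℝ), ENNReal.ofReal_mul (Real.exp_nonneg _), ENNReal.ofReal_ofNat, mul_assoc]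
  rw [ENNReal.ofReal_sub _ (by positivity), ENNReal.ofReal_one,
    ENNReal.sub_mul fun _ _ => hfin, one_mul, tsub_le_iff_right]
  exact (lintegral_inter_add_sdiff _ K hE).symm.le.trans (by gcongr)

lemma pow_mul_lintegral_gaussWeight_le {d : ℕ} {ι : Type*} (S : Finset ι)
    (X : ι → Finset (Fin d → ℝ)) (hX : ∀ s, ∑ y ∈ X s, ∑ i, y i ^ 2 ≤ 1) (T : ℝ) :
    ENNReal.ofReal (1 - 2 * Real.exp (-T / 4)) ^ #S * ∫⁻ x : Fin d → ℝ, gaussWeight x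
      ≤ ∫⁻ x in {x | ∀ s ∈ S, sumSqInner (X s) x ≤ T}, gaussWeight x := by
  classical
  induction S using Finset.induction_on with
  | empty => simp
  | insert a S ha ih =>
    have hset : {x | ∀ s ∈ insert a S, sumSqInner (X s) x ≤ T} =
        {x | ∀ s ∈ S, sumSqInner (X s) x ≤ T} ∩ {x | sumSqInner (X a) x ≤ T} := by
      ext x
      simp [and_comm]
    rw [hset, card_insert_of_notMem ha, pow_succ', mul_assoc]
    refine le_trans ?_ ((isSymmMidconvex_forall_sumSqInner_le S X T).mul_setLIntegral_le_inter
      (hX a) T)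
    gcongr

/-- The vector of signs encoded by a Boolean vector. -/
def signVec {d : ℕ} (ε : Fin d → Bool) : Fin d → ℝ := fun i => if ε i then 1 else -1

lemma signVec_sq {d : ℕ} (ε : Fin d → Bool) (i : Fin d) : signVec ε i ^ 2 = 1 := by
  unfold signVec
  split_ifs <;> norm_num

lemma two_pow_le_sum_exp {d : ℕ} (y : Fin d → ℝ) :
    (2 : ℝ) ^ d ≤ ∑ ε : Fin d → Bool, Real.exp (∑ i, signVec ε i * y i) := by
  calc (2 : ℝ) ^ d = ∏ _i : Fin d, (2 : ℝ) := by simp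
    _ ≤ ∏ i, ∑ b : Bool, Real.exp ((if b then 1 else -1) * y i) := by
        refine prod_le_prod (fun _ _ => by norm_num) fun i _ => ?_
        have h := Real.one_le_cosh (y i)
        rw [Real.cosh_eq] at h
        simp
        linarith
    _ = ∑ ε : Fin d → Bool, Real.exp (∑ i, signVec ε i * y i) := by
        rw [prod_univ_sum, Fintype.piFinset_univ]
        simp only [← Real.exp_sum]
        rfl

lemma two_pow_mul_gaussWeight_le {d : ℕ} (y : Fin d → ℝ) :
    ENNReal.ofReal (2 ^ d * Real.exp (-d / 8)) * gaussWeight y ≤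
      ∑ ε : Fin d → Bool, gaussWeight (y + (2⁻¹ : ℝ) • signVec ε) := by
  unfold gaussWeight
  rw [← ENNReal.ofReal_mul (by positivity),
    ← ENNReal.ofReal_sum_of_nonneg fun _ _ => Real.exp_nonneg _]
  refine ENNReal.ofReal_le_ofReal ?_
  have h := two_pow_le_sum_exp (-((2⁻¹ : ℝ) • y))
  calc 2 ^ d * Real.exp (-d / 8) * Real.exp (-(∑ i, y i ^ 2) / 2)
      ≤ (∑ ε : Fin d → Bool, Real.exp (∑ i, signVec ε i * (-((2⁻¹ : ℝ) • y)) i)) *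
          Real.exp (-d / 8) * Real.exp (-(∑ i, y i ^ 2) / 2) := by gcongr
    _ = _ := by
        rw [sum_mul, sum_mul]
        refine sum_congr rfl fun ε _ => ?_
        rw [← Real.exp_add, ← Real.exp_add]
        congr 1
        have : ∑ i, (y + (2⁻¹ : ℝ) • signVec ε) i ^ 2 =
            ∑ i, y i ^ 2 - 2 * ∑ i, signVec ε i * (-((2⁻¹ : ℝ) • y)) i + d / 4 := by
          have hd : (d : ℝ) / 4 = ∑ _i : Fin d, (1 / 4 : ℝ) := by simp; ring
          rw [hd, mul_sum, ← sum_sub_distrib, ← sum_add_distrib]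
          refine sum_congr rfl fun i _ => ?_
          simp only [Pi.add_apply, Pi.neg_apply, Pi.smul_apply, smul_eq_mul]
          linear_combination (1 / 4) * signVec_sq ε i
        rw [this]
        ring

/-- If `K` has large Gaussian mass, some point lies in many of the translates of `K` by vectors in
`{-1/2, 1/2}^d`. -/
lemma exists_le_card_signVec {d : ℕ} {K : Set (Fin d → ℝ)} (hK : MeasurableSet K) {a : ℝ}
    (ha : 0 < a)
    (h : ENNReal.ofReal a * ∫⁻ x : Fin d → ℝ, gaussWeight x ≤ ∫⁻ x in K, gaussWeight x) :
    ∃ (x : Fin d → ℝ) (E : Finset (Fin d → Bool)),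
      (∀ ε ∈ E, x - (2⁻¹ : ℝ) • signVec ε ∈ K) ∧ 2 ^ d * Real.exp (-d / 8) * a ≤ #E := by
  classical
  set M := 2 ^ d * Real.exp (-d / 8) * a with hM
  have hM₀ : 0 < M := by positivity
  by_contra! hcon
  have hG := measurable_gaussWeight (d := d)
  set E : (Fin d → ℝ) → Finset (Fin d → Bool) :=
    fun x => {ε | x - (2⁻¹ : ℝ) • signVec ε ∈ K} with hE
  have hcard : ∀ x, #(E x) ≤ ⌈M⌉₊ - 1 := fun x =>
    Nat.le_sub_one_of_lt (Nat.lt_ceil.2 (hcon x (E x) (by simp [hE])))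
  have hlt : ((⌈M⌉₊ - 1 : ℕ) : ℝ) < M :=
    Nat.lt_ceil.1 (Nat.sub_one_lt (Nat.ceil_pos.2 hM₀).ne')
  have hshift : ∀ ε : Fin d → Bool,
      ∫⁻ x in K, gaussWeight (x + (2⁻¹ : ℝ) • signVec ε) =
        ∫⁻ x, if x - (2⁻¹ : ℝ) • signVec ε ∈ K then gaussWeight x else 0 := by
    intro ε
    rw [← lintegral_indicator hK, ← lintegral_add_right_eq_self
      (fun x => if x - (2⁻¹ : ℝ) • signVec ε ∈ K then gaussWeight x else 0)
      ((2⁻¹ : ℝ) • signVec ε)]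
    refine lintegral_congr fun x => ?_
    simp [Set.indicator_apply]
  have hmeas : ∀ ε : Fin d → Bool,
      Measurable fun x => if x - (2⁻¹ : ℝ) • signVec ε ∈ K then gaussWeight x else 0 := fun ε =>
    Measurable.ite ((measurable_sub_const _) hK) hG measurable_const
  have hle : ENNReal.ofReal M * ∫⁻ x : Fin d → ℝ, gaussWeight x ≤
      ((⌈M⌉₊ - 1 : ℕ) : ℝ≥0∞) * ∫⁻ x : Fin d → ℝ, gaussWeight x := by
    calc ENNReal.ofReal M * ∫⁻ x : Fin d → ℝ, gaussWeight x
        ≤ ENNReal.ofReal (2 ^ d * Real.exp (-d / 8)) * ∫⁻ x in K, gaussWeight x := by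
          rw [hM, ENNReal.ofReal_mul (by positivity), mul_assoc]
          gcongr
      _ ≤ ∫⁻ x in K, ∑ ε : Fin d → Bool, gaussWeight (x + (2⁻¹ : ℝ) • signVec ε) := by
          rw [← lintegral_const_mul _ hG]
          exact lintegral_mono fun x => two_pow_mul_gaussWeight_le x
      _ = ∫⁻ x, ∑ ε : Fin d → Bool,
            if x - (2⁻¹ : ℝ) • signVec ε ∈ K then gaussWeight x else 0 := by
          rw [lintegral_finsetSum _ fun ε _ => by fun_prop,
            lintegral_finsetSum _ fun ε _ => hmeas ε]
          exact sum_congr rfl fun ε _ => hshift ε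
      _ ≤ ∫⁻ x : Fin d → ℝ, ((⌈M⌉₊ - 1 : ℕ) : ℝ≥0∞) * gaussWeight x := by
          refine lintegral_mono fun x => ?_
          dsimp only
          rw [← sum_filter, sum_const, nsmul_eq_mul]
          gcongr
          exact hcard x
      _ = _ := lintegral_const_mul _ hG
  rw [ENNReal.mul_le_mul_iff_left lintegral_gaussWeight_ne_zero lintegral_gaussWeight_ne_top,
    ← ENNReal.ofReal_natCast, ENNReal.ofReal_le_ofReal_iff (Nat.cast_nonneg _)] at hle
  linarith

/-- A large subset of the discrete cube contains two points at a large Hamming distance. -/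
lemma exists_le_hammingDist {d : ℕ} {E : Finset (Fin d → Bool)} {a : ℝ}
    (hE : Real.exp (a * d) ≤ #E) :
    ∃ ε₁ ∈ E, ∃ ε₂ ∈ E, (a - Real.exp (-1)) * d ≤ hammingDist ε₁ ε₂ := by
  have hpos : (0 : ℝ) < #E := (Real.exp_pos _).trans_le hE
  obtain ⟨ε₁, hε₁⟩ : E.Nonempty := card_pos.1 (by exact_mod_cast hpos)
  refine ⟨ε₁, hε₁, ?_⟩
  by_contra! hcon
  have hsum : ∑ ε : Fin d → Bool, Real.exp (-(hammingDist ε₁ ε : ℝ)) = (1 + Real.exp (-1)) ^ d := by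
    calc ∑ ε : Fin d → Bool, Real.exp (-(hammingDist ε₁ ε : ℝ))
        = ∑ ε : Fin d → Bool, ∏ i, if ε₁ i ≠ ε i then Real.exp (-1) else 1 := by
          refine sum_congr rfl fun ε _ => ?_
          rw [prod_ite, prod_const, prod_const_one, mul_one, ← Real.exp_nat_mul, hammingDist]
          simp
      _ = ∏ i, ∑ b : Bool, if ε₁ i ≠ b then Real.exp (-1) else 1 := by
          rw [prod_univ_sum, Fintype.piFinset_univ]
      _ = ∏ _i : Fin d, (1 + Real.exp (-1)) := by
          refine prod_congr rfl fun i _ => ?_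
          cases ε₁ i <;> simp [add_comm]
      _ = (1 + Real.exp (-1)) ^ d := by simp
  have hup : (1 + Real.exp (-1)) ^ d ≤ Real.exp (Real.exp (-1) * d) := by
    rw [mul_comm, Real.exp_nat_mul]
    gcongr
    linarith [Real.add_one_le_exp (Real.exp (-1))]
  have hlow : #E * Real.exp (-((a - Real.exp (-1)) * d)) <
      ∑ ε ∈ E, Real.exp (-(hammingDist ε₁ ε : ℝ)) := by
    rw [← nsmul_eq_mul, ← sum_const]
    exact sum_lt_sum_of_nonempty ⟨ε₁, hε₁⟩ fun ε hε =>
      Real.exp_lt_exp.2 (neg_lt_neg (hcon ε hε))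
  have hsub : ∑ ε ∈ E, Real.exp (-(hammingDist ε₁ ε : ℝ)) ≤
      ∑ ε : Fin d → Bool, Real.exp (-(hammingDist ε₁ ε : ℝ)) :=
    sum_le_sum_of_subset_of_nonneg (subset_univ _) fun _ _ _ => Real.exp_nonneg _
  have hlow' : Real.exp (Real.exp (-1) * d) ≤ #E * Real.exp (-((a - Real.exp (-1)) * d)) := by
    calc Real.exp (Real.exp (-1) * d)
        = Real.exp (a * d) * Real.exp (-((a - Real.exp (-1)) * d)) := by
          rw [← Real.exp_add]
          ring_nf
      _ ≤ _ := by gcongr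
  linarith

lemma exp_neg_le_one_sub_pow {p : ℝ} (hp₀ : 0 ≤ p) (hp : p ≤ 1 / 2) (m : ℕ) :
    Real.exp (-(2 * (p * m))) ≤ (1 - p) ^ m := by
  have h : Real.exp (-(2 * p)) ≤ 1 - p := by
    rw [Real.exp_neg]
    refine inv_le_of_inv_le₀ (by linarith) ?_
    refine le_trans ?_ (Real.add_one_le_exp (2 * p))
    rw [inv_le_iff_one_le_mul₀ (by linarith)]
    nlinarith
  calc Real.exp (-(2 * (p * m))) = Real.exp (-(2 * p)) ^ m := by
        rw [← Real.exp_nat_mul]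
        ring_nf
    _ ≤ (1 - p) ^ m := by gcongr

/-- The failure probability `2 exp (-7 log (m / d + 2))` of one constraint is small compared with
`d / m`. -/
lemma two_mul_exp_neg_log_le {r : ℝ} (hr : 0 ≤ r) :
    2 * Real.exp (-(28 * Real.log (r + 2)) / 4) ≤ 1 / 2 ∧
      2 * Real.exp (-(28 * Real.log (r + 2)) / 4) * r ≤ 1 / 32 := by
  have he : Real.exp (-(28 * Real.log (r + 2)) / 4) = ((r + 2) ^ 7)⁻¹ := by
    have : -(28 * Real.log (r + 2)) / 4 = -Real.log ((r + 2) ^ 7) := by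
      rw [Real.log_pow]
      push_cast
      ring
    rw [this, Real.exp_neg, Real.exp_log (by positivity)]
  rw [he]
  have h6 : (64 : ℝ) ≤ (r + 2) ^ 6 := by
    calc (64 : ℝ) = 2 ^ 6 := by norm_num
      _ ≤ (r + 2) ^ 6 := by gcongr; linarith
  have hpos : (0 : ℝ) < (r + 2) ^ 7 := by positivity
  constructor
  · rw [← div_eq_mul_inv, div_le_iff₀ hpos, pow_succ]
    nlinarith
  · rw [← div_eq_mul_inv, div_mul_eq_mul_div, div_le_iff₀ hpos, pow_succ]
    nlinarith

lemma sqrt_sumSqInner_sub_le {d : ℕ} (X : Finset (Fin d → ℝ)) {x y : Fin d → ℝ} {T : ℝ}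
    (hx : sumSqInner X x ≤ T) (hy : sumSqInner X y ≤ T) : √(sumSqInner X (x - y)) ≤ 2 * √T := by
  have h : sumSqInner X (x - y) ≤ 2 * (sumSqInner X x + sumSqInner X y) := by
    simp only [sumSqInner]
    rw [← sum_add_distrib, mul_sum]
    refine sum_le_sum fun z _ => ?_
    simp only [Pi.sub_apply, mul_sub, sum_sub_distrib]
    nlinarith [sq_nonneg (∑ i, z i * x i + ∑ i, z i * y i)]
  calc √(sumSqInner X (x - y)) ≤ √(2 ^ 2 * T) := Real.sqrt_le_sqrt (by linarith)
    _ = 2 * √T := by rw [Real.sqrt_mul (by norm_num), Real.sqrt_sq (by norm_num)]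

/-- The balancing lemma (Lemma 1). -/
theorem stmt9 :
    ∃ c C : ℝ, 0 < c ∧ 0 < C ∧
      ∀ d m : ℕ, 0 < d → 0 < m →
        ∀ 𝒳 : Fin m → Finset (Fin d → ℝ),
          (∀ s, ∑ x ∈ 𝒳 s, ∑ i, (x i) ^ 2 ≤ 1) →
          ∃ ε : Fin d → ℝ, (∀ i, ε i = -1 ∨ ε i = 0 ∨ ε i = 1) ∧
            c * d ≤ ∑ i, |ε i| ∧
            ∀ s, Real.sqrt (∑ x ∈ 𝒳 s, (∑ i, ε i * x i) ^ 2)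
              ≤ C * Real.sqrt (Real.log ((m : ℝ) / d + 2)) := by
  refine ⟨1 / 10, 2 * √28, by norm_num, by positivity, fun d m hd hm 𝒳 h𝒳 => ?_⟩
  have hd' : (0 : ℝ) < d := by exact_mod_cast hd
  set T := 28 * Real.log ((m : ℝ) / d + 2) with hT
  set p := 2 * Real.exp (-T / 4) with hp
  obtain ⟨hp₁, hp₂⟩ := two_mul_exp_neg_log_le (r := (m : ℝ) / d) (by positivity)
  rw [← hT, ← hp] at hp₁ hp₂
  have hp₀ : 0 ≤ p := by positivity
  have hpm : p * m ≤ d / 32 := by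
    have : p * m = p * (m / d) * d := by field_simp
    rw [this]
    nlinarith
  set K := {x : Fin d → ℝ | ∀ s ∈ (univ : Finset (Fin m)), sumSqInner (𝒳 s) x ≤ T} with hK
  have hmass : ENNReal.ofReal (Real.exp (-d / 16)) * ∫⁻ x : Fin d → ℝ, gaussWeight x ≤
      ∫⁻ x in K, gaussWeight x := by
    refine le_trans ?_ (pow_mul_lintegral_gaussWeight_le univ 𝒳 h𝒳 T)
    rw [← ENNReal.ofReal_pow (by linarith), card_univ, Fintype.card_fin]
    gcongr
    refine le_trans (Real.exp_le_exp.2 ?_) (exp_neg_le_one_sub_pow hp₀ hp₁ m)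
    linarith
  obtain ⟨x, E, hEK, hE⟩ := exists_le_card_signVec
    (isSymmMidconvex_forall_sumSqInner_le univ 𝒳 T).measurableSet (Real.exp_pos _) hmass
  have hE' : Real.exp ((Real.log 2 - 3 / 16) * d) ≤ #E := by
    refine le_trans (le_of_eq ?_) hE
    rw [← Real.exp_log (show (0 : ℝ) < 2 ^ d by positivity), Real.log_pow, ← Real.exp_add,
      ← Real.exp_add]
    ring_nf
  obtain ⟨ε₁, hε₁, ε₂, hε₂, hdist⟩ := exists_le_hammingDist hE'
  refine ⟨(2⁻¹ : ℝ) • (signVec ε₁ - signVec ε₂), fun i => ?_, ?_, fun s => ?_⟩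
  · simp only [signVec, Pi.smul_apply, Pi.sub_apply, smul_eq_mul]
    split_ifs <;> norm_num
  · have habs : ∑ i, |((2⁻¹ : ℝ) • (signVec ε₁ - signVec ε₂)) i| = hammingDist ε₁ ε₂ := by
      rw [hammingDist, card_filter]
      push_cast
      refine sum_congr rfl fun i _ => ?_
      simp only [signVec, Pi.smul_apply, Pi.sub_apply, smul_eq_mul]
      cases ε₁ i <;> cases ε₂ i <;> norm_num
    rw [habs]
    refine le_trans ?_ hdist
    gcongr
    have := Real.exp_neg_one_lt_d9
    have := Real.log_two_gt_d9
    linarith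
  · have h := sqrt_sumSqInner_sub_le (𝒳 s) (hEK ε₂ hε₂ s (mem_univ s)) (hEK ε₁ hε₁ s (mem_univ s))
    have hsub : x - (2⁻¹ : ℝ) • signVec ε₂ - (x - (2⁻¹ : ℝ) • signVec ε₁) =
        (2⁻¹ : ℝ) • (signVec ε₁ - signVec ε₂) := by
      rw [smul_sub]
      abel
    rw [hsub, hT, Real.sqrt_mul (by norm_num), ← mul_assoc] at h
    simpa only [sumSqInner, mul_comm] using h
end
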